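/- Fix n ≥ 1 and k with 1 ≤ k ≤ 1+n and k ∉ {1,3}, and let T be a natural 2-covariant tensor associated to a Lorentzian metric and a k-form on open subsets of ℝ^{1+n}. If T is independent of the unit of scale, i.e. T(λ²g, λ^{k−1}ω) = T(g,ω) for every λ > 0, then there are constants a, b, c, d ∈ ℝ (independent of g and ω) such that T(g,ω) = a · Ricci(g) + b · r(g) g + c · ⟨i_−ω, i_−ω⟩_g + d · ⟨ω,ω⟩_g g. -/

import Mathlib

namespace Paper

noncomputable section

/-- Points of `ℝ^{1+n}`. -/
abbrev Pt (n : ℕ) := Fin (n + 1) → ℝ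

/-- Partial derivative `∂_a f` of a scalar function. -/
def pd (n : ℕ) (a : Fin (n + 1)) (f : Pt n → ℝ) (x : Pt n) : ℝ :=
  fderiv ℝ f x (Pi.single a 1)

/-- The signs `ε₀ = 1`, `ε_i = -1` for `i ≠ 0`. -/
def eps (n : ℕ) (i : Fin (n + 1)) : ℝ := if i = 0 then 1 else -1

/-- The standard Minkowski matrix `diag(1, -1, …, -1)`. -/
def minkM (n : ℕ) (a b : Fin (n + 1)) : ℝ := if a = b then eps n a else 0

/-- Prepend an entry to an index tuple: `(a, v₁, …, v_{k-1})`. -/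
def dcons {α : Type*} (k : ℕ) (a : α) (v : Fin (k - 1) → α) : Fin k → α :=
  fun j => if h : (j : ℕ) = 0 then a else v ⟨(j : ℕ) - 1, by have := j.isLt; omega⟩

/-- Append an entry to an index tuple: `(v₁, …, v_{k-1}, b)`. -/
def dsnoc {α : Type*} (k : ℕ) (v : Fin (k - 1) → α) (b : α) : Fin k → α :=
  fun j => if h : (j : ℕ) < k - 1 then v ⟨(j : ℕ), h⟩ else b

/-- `g` (given by its components) is a Lorentzian metric on the open set `W`:
it is smooth on `W` and, at each point of `W`, a symmetric bilinear form of
signature `(1,n)` (i.e. congruent to the Minkowski matrix). -/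
def IsMetricOn (n : ℕ) (W : Set (Pt n)) (g : Pt n → Fin (n + 1) → Fin (n + 1) → ℝ) : Prop :=
  (∀ a b, ContDiffOn ℝ (⊤ : ℕ∞) (fun x => g x a b) W) ∧
  (∀ x ∈ W, (∀ a b, g x a b = g x b a) ∧
    ∃ P : Matrix (Fin (n + 1)) (Fin (n + 1)) ℝ, IsUnit P.det ∧
      ∀ a b, (∑ c, ∑ d, P c a * g x c d * P d b) = minkM n a b)

/-- `ω` (given by its components) is a smooth `k`-form field on the open set `W`. -/
def IsFormOn (n k : ℕ) (W : Set (Pt n)) (ω : Pt n → (Fin k → Fin (n + 1)) → ℝ) : Prop :=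
  (∀ v, ContDiffOn ℝ (⊤ : ℕ∞) (fun x => ω x v) W) ∧
  (∀ x ∈ W, ∀ (v : Fin k → Fin (n + 1)) (σ : Equiv.Perm (Fin k)),
    ω x (v ∘ σ) = ((Equiv.Perm.sign σ : ℤ) : ℝ) * ω x v)

/-- `t` is a smooth 2-covariant tensor field on `W`. -/
def IsTensorFieldOn (n : ℕ) (W : Set (Pt n)) (t : Pt n → Fin (n + 1) → Fin (n + 1) → ℝ) : Prop :=
  ∀ a b, ContDiffOn ℝ (⊤ : ℕ∞) (fun x => t x a b) W

/-- `τ : W → W'` is a diffeomorphism between open subsets of `ℝ^{1+n}`, with inverse `σf`. -/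
structure IsDiffeoOn (n : ℕ) (τ σf : Pt n → Pt n) (W W' : Set (Pt n)) : Prop where
  open_src : IsOpen W
  open_tgt : IsOpen W'
  mapsTo : Set.MapsTo τ W W'
  mapsTo_inv : Set.MapsTo σf W' W
  left_inv : ∀ x ∈ W, σf (τ x) = x
  right_inv : ∀ y ∈ W', τ (σf y) = y
  smooth : ContDiffOn ℝ (⊤ : ℕ∞) τ W
  smooth_inv : ContDiffOn ℝ (⊤ : ℕ∞) σf W'

/-- The Jacobian matrix `(dτ_x)(e_a)_c` of a map `τ`. -/
def jac (n : ℕ) (τ : Pt n → Pt n) (x : Pt n) (a c : Fin (n + 1)) : ℝ :=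
  fderiv ℝ τ x (Pi.single a 1) c

/-- Pullback of a 2-covariant tensor field (in particular of a metric):
`(τ*g)_x(u,v) = g_{τ(x)}(dτ_x u, dτ_x v)`, componentwise. -/
def pullTensor (n : ℕ) (τ : Pt n → Pt n) (g : Pt n → Fin (n + 1) → Fin (n + 1) → ℝ) :
    Pt n → Fin (n + 1) → Fin (n + 1) → ℝ :=
  fun x a b => ∑ c, ∑ d, jac n τ x a c * jac n τ x b d * g (τ x) c d

/-- Pullback of a `k`-form field, componentwise. -/
def pullForm (n k : ℕ) (τ : Pt n → Pt n) (ω : Pt n → (Fin k → Fin (n + 1)) → ℝ) :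
    Pt n → (Fin k → Fin (n + 1)) → ℝ :=
  fun x v => ∑ w : Fin k → Fin (n + 1), (∏ j, jac n τ x (v j) (w j)) * ω (τ x) w

/-- A natural 2-covariant tensor `T(g,ω)` associated to a Lorentzian metric and a `k`-form
on open subsets of `ℝ^{1+n}`: a rule assigning to every open `W` and every pair `(g,ω)` on
`W` a 2-covariant tensor field `T(g,ω)` on `W` that commutes with restrictions, is
equivariant under diffeomorphisms between open subsets, and is regular (smooth families of
data yield smooth families of values). -/
structure NaturalTensor (n k : ℕ) where
  T : Set (Pt n) → (Pt n → Fin (n + 1) → Fin (n + 1) → ℝ) →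
      (Pt n → (Fin k → Fin (n + 1)) → ℝ) → (Pt n → Fin (n + 1) → Fin (n + 1) → ℝ)
  smooth : ∀ W g ω, IsOpen W → IsMetricOn n W g → IsFormOn n k W ω →
      IsTensorFieldOn n W (T W g ω)
  localize : ∀ W₁ W₂ g₁ ω₁ g₂ ω₂, IsOpen W₁ → IsOpen W₂ → W₁ ⊆ W₂ →
      IsMetricOn n W₁ g₁ → IsFormOn n k W₁ ω₁ →
      IsMetricOn n W₂ g₂ → IsFormOn n k W₂ ω₂ →
      (∀ x ∈ W₁, g₁ x = g₂ x ∧ ω₁ x = ω₂ x) →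
      ∀ x ∈ W₁, T W₁ g₁ ω₁ x = T W₂ g₂ ω₂ x
  natural : ∀ τ σf W W', IsDiffeoOn n τ σf W W' →
      ∀ g ω, IsMetricOn n W' g → IsFormOn n k W' ω →
      ∀ x ∈ W, ∀ a b, T W (pullTensor n τ g) (pullForm n k τ ω) x a b =
        pullTensor n τ (T W' g ω) x a b
  regular : ∀ (m : ℕ) (P : Set (Fin m → ℝ)) (W : Set (Pt n)), IsOpen P → IsOpen W →
      ∀ (g : (Fin m → ℝ) → Pt n → Fin (n + 1) → Fin (n + 1) → ℝ)
        (ω : (Fin m → ℝ) → Pt n → (Fin k → Fin (n + 1)) → ℝ),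
      (∀ a b, ContDiffOn ℝ (⊤ : ℕ∞)
        (fun p : (Fin m → ℝ) × Pt n => g p.1 p.2 a b) (P ×ˢ W)) →
      (∀ v, ContDiffOn ℝ (⊤ : ℕ∞)
        (fun p : (Fin m → ℝ) × Pt n => ω p.1 p.2 v) (P ×ˢ W)) →
      (∀ s ∈ P, IsMetricOn n W (g s) ∧ IsFormOn n k W (ω s)) →
      ∀ a b, ContDiffOn ℝ (⊤ : ℕ∞)
        (fun p : (Fin m → ℝ) × Pt n => T W (g p.1) (ω p.1) p.2 a b) (P ×ˢ W)

/-- The inverse metric `g^{ab}` at a point. -/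
def ginv (n : ℕ) (g : Pt n → Fin (n + 1) → Fin (n + 1) → ℝ) (x : Pt n) :
    Matrix (Fin (n + 1)) (Fin (n + 1)) ℝ :=
  (Matrix.of fun a b => g x a b)⁻¹

/-- The Christoffel symbols
`Γ^c_{ab} = (1/2) g^{cd}(∂_a g_{db} + ∂_b g_{da} − ∂_d g_{ab})`. -/
def christoffel (n : ℕ) (g : Pt n → Fin (n + 1) → Fin (n + 1) → ℝ) (x : Pt n)
    (c a b : Fin (n + 1)) : ℝ :=
  (1 / 2) * ∑ d, ginv n g x c d *
    (pd n a (fun y => g y d b) x + pd n b (fun y => g y d a) x - pd n d (fun y => g y a b) x)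

/-- The divergence of a 2-covariant tensor field: `(div_g t)_b = g^{ac} ∇_a t_{cb}`. -/
def divT (n : ℕ) (g t : Pt n → Fin (n + 1) → Fin (n + 1) → ℝ) (x : Pt n)
    (b : Fin (n + 1)) : ℝ :=
  ∑ a, ∑ c, ginv n g x a c *
    (pd n a (fun y => t y c b) x - (∑ e, christoffel n g x e a c * t x e b)
      - (∑ e, christoffel n g x e a b * t x c e))

/-- The covariant derivative `∇_a ω_{v₁…v_k}` of a `k`-form field. -/
def covd (n k : ℕ) (g : Pt n → Fin (n + 1) → Fin (n + 1) → ℝ)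
    (ω : Pt n → (Fin k → Fin (n + 1)) → ℝ) (x : Pt n) (a : Fin (n + 1))
    (v : Fin k → Fin (n + 1)) : ℝ :=
  pd n a (fun y => ω y v) x -
    ∑ l : Fin k, ∑ e, christoffel n g x e a (v l) * ω x (Function.update v l e)

/-- The codifferential `(∂_g ω)_{i₁…i_{k−1}} = −g^{ab} ∇_a ω_{b i₁…i_{k−1}}`. -/
def codiff (n k : ℕ) (g : Pt n → Fin (n + 1) → Fin (n + 1) → ℝ)
    (ω : Pt n → (Fin k → Fin (n + 1)) → ℝ) (x : Pt n)
    (v : Fin (k - 1) → Fin (n + 1)) : ℝ :=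
  -∑ a, ∑ b, ginv n g x a b * covd n k g ω x a (dcons k b v)

/-- The exterior differential `(dω)_{i₀…i_k} = Σ_j (−1)^j ∂_{i_j} ω_{i₀…î_j…i_k}`. -/
def dext (n k : ℕ) (ω : Pt n → (Fin k → Fin (n + 1)) → ℝ) (x : Pt n)
    (u : Fin (k + 1) → Fin (n + 1)) : ℝ :=
  ∑ j : Fin (k + 1), (-1 : ℝ) ^ (j : ℕ) * pd n (u j) (fun y => ω y (u ∘ j.succAbove)) x

/-- `(i_{∂_g ω} ω)_b = (1/(k−1)!) (∂_g ω)^{i₂…i_k} ω_{i₂…i_k b}`, indices raised with `g`. -/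
def iCodiff (n k : ℕ) (g : Pt n → Fin (n + 1) → Fin (n + 1) → ℝ)
    (ω : Pt n → (Fin k → Fin (n + 1)) → ℝ) (x : Pt n) (b : Fin (n + 1)) : ℝ :=
  (1 / ((k - 1).factorial : ℝ)) *
    ∑ v : Fin (k - 1) → Fin (n + 1), ∑ w : Fin (k - 1) → Fin (n + 1),
      (∏ j, ginv n g x (v j) (w j)) * codiff n k g ω x v * ω x (dsnoc k w b)

/-- The scalar product `⟨ω,ω⟩_g = (1/k!) ω^{i₁…i_k} ω_{i₁…i_k}`, indices raised with `g`. -/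
def scalarSq (n k : ℕ) (g : Pt n → Fin (n + 1) → Fin (n + 1) → ℝ)
    (ω : Pt n → (Fin k → Fin (n + 1)) → ℝ) (x : Pt n) : ℝ :=
  (1 / (k.factorial : ℝ)) * ∑ v : Fin k → Fin (n + 1), ∑ w : Fin k → Fin (n + 1),
    (∏ j, ginv n g x (v j) (w j)) * ω x v * ω x w

/-- The components of the 2-covariant tensor `⟨i_−ω, i_−ω⟩_g`:
`(1/(k−1)!) ω_a{}^{i₂…i_k} ω_{b i₂…i_k}`, indices raised with `g`. -/
def iiInner (n k : ℕ) (g : Pt n → Fin (n + 1) → Fin (n + 1) → ℝ)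
    (ω : Pt n → (Fin k → Fin (n + 1)) → ℝ) (x : Pt n) (a b : Fin (n + 1)) : ℝ :=
  (1 / ((k - 1).factorial : ℝ)) *
    ∑ v : Fin (k - 1) → Fin (n + 1), ∑ w : Fin (k - 1) → Fin (n + 1),
      (∏ j, ginv n g x (v j) (w j)) * ω x (dcons k a v) * ω x (dcons k b w)

/-- The energy tensor `E(g,ω) = (−1)^{k−1}(⟨i_−ω,i_−ω⟩_g − (1/2)⟨ω,ω⟩_g g)`. -/
def energyTensor (n k : ℕ) (g : Pt n → Fin (n + 1) → Fin (n + 1) → ℝ)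
    (ω : Pt n → (Fin k → Fin (n + 1)) → ℝ) (x : Pt n) (a b : Fin (n + 1)) : ℝ :=
  (-1 : ℝ) ^ (k - 1) *
    (iiInner n k g ω x a b - (1 / 2) * scalarSq n k g ω x * g x a b)

/-- The Ricci tensor
`Ricci_{ab} = ∂_c Γ^c_{ab} − ∂_a Γ^c_{cb} + Γ^c_{cd} Γ^d_{ab} − Γ^c_{ad} Γ^d_{cb}`. -/
def ricci (n : ℕ) (g : Pt n → Fin (n + 1) → Fin (n + 1) → ℝ) (x : Pt n)
    (a b : Fin (n + 1)) : ℝ :=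
  (∑ c, pd n c (fun y => christoffel n g y c a b) x)
  - (∑ c, pd n a (fun y => christoffel n g y c c b) x)
  + (∑ c, ∑ d, christoffel n g x c c d * christoffel n g x d a b)
  - (∑ c, ∑ d, christoffel n g x c a d * christoffel n g x d c b)

/-- The scalar curvature `r(g) = g^{ab} Ricci_{ab}`. -/
def scalarCurv (n : ℕ) (g : Pt n → Fin (n + 1) → Fin (n + 1) → ℝ) (x : Pt n) : ℝ :=
  ∑ a, ∑ b, ginv n g x a b * ricci n g x a b

end

end Paper

namespace Paper

open scoped ContDiff Topology

/-- Integrals over `[0,1]` of functions depending smoothly on a parameter are smooth. -/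
theorem contDiff_parametric_integral {X : Type} [NormedAddCommGroup X] [NormedSpace ℝ X]
    [ProperSpace X] (m : ℕ) : ∀ {F : Type} [NormedAddCommGroup F] [NormedSpace ℝ F]
    {f : X × ℝ → F}, ContDiff ℝ ∞ f → ContDiff ℝ m (fun x => ∫ t in (0 : ℝ)..1, f (x, t)) := by
  have key : ∀ {F : Type} [NormedAddCommGroup F] [NormedSpace ℝ F] {f : X × ℝ → F},
      ContDiff ℝ ∞ f → ∀ x₀, HasFDerivAt (fun x => ∫ t in (0 : ℝ)..1, f (x, t))
        (∫ t in (0 : ℝ)..1, (fderiv ℝ f (x₀, t)).comp (ContinuousLinearMap.inl ℝ X ℝ)) x₀ := by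
    intro F _ _ f hf x₀
    have hcont : Continuous fun p : X × ℝ =>
        (fderiv ℝ f p).comp (ContinuousLinearMap.inl ℝ X ℝ) :=
      (hf.continuous_fderiv (by simp)).clm_comp continuous_const
    obtain ⟨C, hC⟩ := ((isCompact_closedBall x₀ 1).prod
      (isCompact_Icc (a := (0 : ℝ)) (b := 1))).exists_bound_of_continuousOn hcont.continuousOn
    refine intervalIntegral.hasFDerivAt_integral_of_dominated_of_fderiv_le
      (F' := fun x t => (fderiv ℝ f (x, t)).comp (ContinuousLinearMap.inl ℝ X ℝ))
      (bound := fun _ => C) (Metric.ball_mem_nhds x₀ one_pos) ?_ ?_ ?_ ?_ ?_ ?_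
    · exact .of_forall fun x => (hf.continuous.comp (by fun_prop)).aestronglyMeasurable
    · exact (hf.continuous.comp (by fun_prop)).intervalIntegrable _ _
    · exact (hcont.comp (by fun_prop)).aestronglyMeasurable
    · refine .of_forall fun t ht x hx => hC (x, t) ⟨Metric.ball_subset_closedBall hx, ?_⟩
      rw [Set.uIoc_of_le zero_le_one] at ht
      exact ⟨ht.1.le, ht.2⟩
    · exact intervalIntegrable_const
    · refine .of_forall fun t _ x _ => ?_
      have h1 := (hf.differentiable (by simp) (x, t)).hasFDerivAt
      exact h1.comp x (hasFDerivAt_prodMk_left x t)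
  induction m with
  | zero =>
    intro F _ _ f hf
    rw [Nat.cast_zero, contDiff_zero, continuous_iff_continuousAt]
    exact fun x => (key hf x).continuousAt
  | succ m ih =>
    intro F _ _ f hf
    rw [Nat.cast_succ, contDiff_succ_iff_fderiv]
    refine ⟨fun x => (key hf x).differentiableAt, by simp, ?_⟩
    have : fderiv ℝ (fun x => ∫ t in (0 : ℝ)..1, f (x, t)) = fun x =>
        ∫ t in (0 : ℝ)..1, (fderiv ℝ f (x, t)).comp (ContinuousLinearMap.inl ℝ X ℝ) := by
      funext x
      exact (key hf x).fderiv
    rw [this]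
    exact ih (f := fun p => (fderiv ℝ f p).comp (ContinuousLinearMap.inl ℝ X ℝ))
      ((hf.fderiv_right (by simp)).clm_comp contDiff_const)

/-- Hadamard's lemma in the first variable. -/
theorem exists_hadamard {X : Type} [NormedAddCommGroup X] [NormedSpace ℝ X]
    [ProperSpace X] {u : ℝ × X → ℝ} (hu : ContDiff ℝ ∞ u) :
    ∃ v : ℝ × X → ℝ, ContDiff ℝ ∞ v ∧ (∀ l x, u (l, x) = u (0, x) + l * v (l, x)) ∧
      ∀ x, v (0, x) = fderiv ℝ u (0, x) (1, 0) := by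
  refine ⟨fun p => ∫ t in (0 : ℝ)..1, fderiv ℝ u (t * p.1, p.2) (1, 0), ?_, ?_, ?_⟩
  · rw [contDiff_infty]
    intro m
    refine contDiff_parametric_integral m
      (f := fun q : (ℝ × X) × ℝ => fderiv ℝ u (q.2 * q.1.1, q.1.2) (1, 0)) ?_
    refine ContDiff.clm_apply ?_ contDiff_const
    exact (hu.fderiv_right (by simp)).comp (by fun_prop)
  · intro l x
    have hd : ∀ t : ℝ, HasDerivAt (fun t => u (t * l, x)) (l * fderiv ℝ u (t * l, x) (1, 0)) t := by
      intro t
      have h1 := (hu.differentiable (by simp) (t * l, x)).hasFDerivAt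
      have h2 : HasDerivAt (fun t : ℝ => (t * l, x)) (l, (0 : X)) t := by
        simpa using ((hasDerivAt_id t).mul_const l).prodMk (hasDerivAt_const t x)
      have h3 := h1.comp_hasDerivAt t h2
      have : (l, (0 : X)) = l • ((1 : ℝ), (0 : X)) := by simp
      rw [this, map_smul, smul_eq_mul] at h3
      exact h3
    have := intervalIntegral.integral_eq_sub_of_hasDerivAt (a := 0) (b := 1)
      (fun t _ => hd t) ?_
    · rw [intervalIntegral.integral_const_mul] at this
      simp only [one_mul, zero_mul] at this
      simp only [this]
      ring
    · refine Continuous.intervalIntegrable ?_ _ _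
      refine continuous_const.mul (Continuous.clm_apply ?_ continuous_const)
      exact (hu.continuous_fderiv (by simp)).comp (by fun_prop)
  · intro x
    simp

/-- Agreeing near a point with a globally smooth function. -/
theorem exists_contDiff_eventuallyEq {X F : Type} [NormedAddCommGroup X] [NormedSpace ℝ X]
    [FiniteDimensional ℝ X] [NormedAddCommGroup F] [NormedSpace ℝ F]
    {f : X → F} {W : Set X} (hW : IsOpen W) {x₀ : X} (hx : x₀ ∈ W) (hf : ContDiffOn ℝ ∞ f W) :
    ∃ f' : X → F, ContDiff ℝ ∞ f' ∧ f' =ᶠ[𝓝 x₀] f := by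
  obtain ⟨r, hr, hrW⟩ := Metric.isOpen_iff.1 hW x₀ hx
  let χ : ContDiffBump x₀ := ⟨r / 4, r / 2, by positivity, by linarith⟩
  refine ⟨fun x => χ x • f x, ?_, ?_⟩
  · rw [contDiff_iff_contDiffAt]
    intro x
    by_cases hxW : x ∈ W
    · exact χ.contDiffAt.smul (hf.contDiffAt (hW.mem_nhds hxW))
    · have : (fun x => χ x • f x) =ᶠ[𝓝 x] fun _ => 0 := by
        have hx' : x ∉ tsupport χ := by
          rw [χ.tsupport_eq]
          intro h
          refine hxW (hrW (Metric.closedBall_subset_ball ?_ h))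
          change r / 2 < r
          linarith
        filter_upwards [(isClosed_tsupport χ).isOpen_compl.mem_nhds hx'] with y hy
        rw [image_eq_zero_of_notMem_tsupport hy, zero_smul]
      exact contDiffAt_const.congr_of_eventuallyEq this
  · filter_upwards [χ.eventuallyEq_one] with y hy
    simp [hy]

end Paper

namespace Paper

open scoped Topology Matrix

/-- The smoothness exponent of infinitely differentiable functions. -/
local notation "∞" => ((⊤ : ℕ∞) : WithTop ℕ∞)

variable {n k : ℕ}

/-- Square matrices of size `1 + n`. -/
abbrev Mat (n : ℕ) := Matrix (Fin (n + 1)) (Fin (n + 1)) ℝ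

/-- The Minkowski matrix. -/
abbrev mink (n : ℕ) : Mat n := Matrix.of (minkM n)

theorem eps_mul_eps (n : ℕ) (i : Fin (n + 1)) : eps n i * eps n i = 1 := by
  unfold eps; split_ifs <;> norm_num

theorem eps_ne_zero (n : ℕ) (i : Fin (n + 1)) : eps n i ≠ 0 := by
  unfold eps; split_ifs <;> norm_num

theorem mink_eq_diagonal (n : ℕ) : mink n = Matrix.diagonal (eps n) := by
  ext a b
  simp [minkM, Matrix.diagonal]

theorem mink_mul_mink (n : ℕ) : mink n * mink n = 1 := by
  rw [mink_eq_diagonal, Matrix.diagonal_mul_diagonal]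
  simp [eps_mul_eps]

theorem mink_transpose (n : ℕ) : (mink n)ᵀ = mink n := by
  rw [mink_eq_diagonal, Matrix.diagonal_transpose]

/-- A symmetric matrix of Lorentzian signature. -/
def Lor (n : ℕ) (G : Mat n) : Prop :=
  Gᵀ = G ∧ ∃ P : Mat n, IsUnit P.det ∧ Pᵀ * G * P = mink n

theorem transpose_mul_mul_apply {m : Type*} [Fintype m] (P G : Matrix m m ℝ) (a b : m) :
    (Pᵀ * G * P) a b = ∑ c, ∑ d, P c a * G c d * P d b := by
  simp only [Matrix.mul_apply, Matrix.transpose_apply, Finset.sum_mul]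
  exact Finset.sum_comm

theorem mul_mul_transpose_apply {m : Type*} [Fintype m] (J G : Matrix m m ℝ) (a b : m) :
    (J * G * Jᵀ) a b = ∑ c, ∑ d, J a c * J b d * G c d := by
  simp only [Matrix.mul_apply, Matrix.transpose_apply, Finset.sum_mul]
  rw [Finset.sum_comm]
  exact Finset.sum_congr rfl fun _ _ => Finset.sum_congr rfl fun _ _ => by ring

theorem lor_of_iff (n : ℕ) (G : Fin (n + 1) → Fin (n + 1) → ℝ) :
    Lor n (Matrix.of G) ↔ (∀ a b, G a b = G b a) ∧
      ∃ P : Mat n, IsUnit P.det ∧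
        ∀ a b, (∑ c, ∑ d, P c a * G c d * P d b) = minkM n a b := by
  unfold Lor
  refine and_congr ?_ (exists_congr fun P => and_congr Iff.rfl ?_)
  · rw [← Matrix.ext_iff]
    exact ⟨fun h a b => h b a, fun h a b => h b a⟩
  · rw [← Matrix.ext_iff]
    simp only [transpose_mul_mul_apply, Matrix.of_apply]

theorem lor_mink (n : ℕ) : Lor n (mink n) :=
  ⟨mink_transpose n, 1, by simp, by simp⟩

/-- Lorentzian signature is preserved by congruences. -/
theorem Lor.congr {n : ℕ} {G J : Mat n} (h : Lor n G)
    (hJ : IsUnit J.det) : Lor n (J * G * Jᵀ) := by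
  obtain ⟨hs, P, hP, hPG⟩ := h
  have hJt : IsUnit Jᵀ.det := by rwa [Matrix.det_transpose]
  refine ⟨by simp [Matrix.transpose_mul, hs, mul_assoc], (Jᵀ)⁻¹ * P, ?_, ?_⟩
  · rw [Matrix.det_mul]
    exact (Matrix.isUnit_nonsing_inv_det _ hJt).mul hP
  · rw [Matrix.transpose_mul, Matrix.transpose_nonsing_inv, Matrix.transpose_transpose]
    calc Pᵀ * J⁻¹ * (J * G * Jᵀ) * ((Jᵀ)⁻¹ * P)
        = Pᵀ * (J⁻¹ * J) * G * (Jᵀ * (Jᵀ)⁻¹) * P := by simp only [mul_assoc]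
      _ = mink n := by
        rw [Matrix.nonsing_inv_mul _ hJ, Matrix.mul_nonsing_inv _ hJt, mul_one, mul_one, hPG]

theorem Lor.smul {n : ℕ} {G : Mat n} (h : Lor n G) {c : ℝ}
    (hc : c ≠ 0) : Lor n (c ^ 2 • G) := by
  have : c ^ 2 • G = (c • (1 : Mat n)) * G * (c • 1)ᵀ := by
    rw [Matrix.transpose_smul, Matrix.transpose_one, smul_mul_assoc, one_mul, mul_smul_comm,
      mul_one, smul_smul, sq]
  rw [this]
  refine h.congr ?_
  rw [Matrix.det_smul, Matrix.det_one, mul_one]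
  exact (isUnit_iff_ne_zero.2 hc).pow _

section Open

attribute [local instance] Matrix.linftyOpNormedRing Matrix.linftyOpNormedAlgebra

theorem eventually_lor_mink (n : ℕ) :
    ∀ᶠ G in 𝓝 (mink n), Gᵀ = G → Lor n G := by
  set η := mink n with hη
  have hηη : η * η = 1 := mink_mul_mink n
  have hηt : ηᵀ = η := mink_transpose n
  -- matrices self-adjoint for the Minkowski product
  let S : Submodule ℝ (Mat n) :=
    { carrier := {X | Xᵀ * η = η * X}
      add_mem' := fun {X Y} hX hY => by
        simp only [Set.mem_ofPred_eq] at *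
        rw [Matrix.transpose_add, add_mul, mul_add, hX, hY]
      zero_mem' := by simp
      smul_mem' := fun c X hX => by
        simp only [Set.mem_ofPred_eq] at *
        rw [Matrix.transpose_smul, smul_mul_assoc, hX, mul_smul_comm] }
  let projL : Mat n →ₗ[ℝ] S :=
    { toFun := fun X => ⟨(1 / 2 : ℝ) • (X + η * Xᵀ * η), by
        change ((1 / 2 : ℝ) • (X + η * Xᵀ * η))ᵀ * η = η * ((1 / 2 : ℝ) • (X + η * Xᵀ * η))
        rw [Matrix.transpose_smul, Matrix.transpose_add, Matrix.transpose_mul,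
          Matrix.transpose_mul, Matrix.transpose_transpose, hηt, smul_mul_assoc, mul_smul_comm,
          add_mul, mul_add]
        congr 1
        have h1 : η * (X * η) * η = η * X * (η * η) := by simp only [mul_assoc]
        have h2 : η * (η * Xᵀ * η) = (η * η) * Xᵀ * η := by simp only [mul_assoc]
        rw [h1, h2, hηη, mul_one, one_mul]
        exact add_comm _ _⟩
      map_add' := fun X Y => by
        ext1
        simp only [Submodule.coe_add, Matrix.transpose_add, mul_add, add_mul, smul_add]
        abel
      map_smul' := fun c X => by
        ext1
        simp only [Submodule.coe_smul, Matrix.transpose_smul, mul_smul_comm, smul_mul_assoc,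
          RingHom.id_apply, ← smul_add]
        rw [smul_comm] }
  have hproj : ∀ X ∈ S, (projL X : Mat n) = X := by
    intro X hX
    change (1 / 2 : ℝ) • (X + η * Xᵀ * η) = X
    have hX' : Xᵀ * η = η * X := hX
    rw [mul_assoc, hX', ← mul_assoc, hηη, one_mul, ← two_smul ℝ X, smul_smul]
    norm_num
  have hsq : ∀ X ∈ S, X * X ∈ S := by
    intro X hX
    have hX' : Xᵀ * η = η * X := hX
    change (X * X)ᵀ * η = η * (X * X)
    rw [Matrix.transpose_mul, mul_assoc, hX', ← mul_assoc, hX', mul_assoc]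
  have h1S : (1 : Mat n) ∈ S := by
    change (1 : Mat n)ᵀ * η = η * 1
    rw [Matrix.transpose_one, one_mul, mul_one]
  let proj : Mat n →L[ℝ] S := LinearMap.toContinuousLinearMap projL
  let f : S → S := fun X => proj ((X : Mat n) * (X : Mat n))
  let one : S := ⟨1, h1S⟩
  have hf : HasStrictFDerivAt f ((2 : ℝ) • ContinuousLinearMap.id ℝ S) one := by
    have h := proj.hasStrictFDerivAt.comp one
      ((S.subtypeL.hasStrictFDerivAt (x := one)).mul' (S.subtypeL.hasStrictFDerivAt (x := one)))
    refine h.congr_fderiv ?_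
    ext1 Y
    apply Subtype.ext
    have : ((2 : ℝ) • Y : S) = projL ((1 : Mat n) * (Y : Mat n) + (Y : Mat n) * (1 : Mat n)) := by
      apply Subtype.ext
      have hm : (1 : Mat n) * (Y : Mat n) + (Y : Mat n) * (1 : Mat n) ∈ S := by
        rw [one_mul, mul_one]; exact S.add_mem Y.2 Y.2
      rw [hproj _ hm, one_mul, mul_one, two_smul]
      rfl
    change _ = (((2 : ℝ) • Y : S) : Mat n)
    rw [this]
    rfl
  have hnh : Filter.map f (𝓝 one) = 𝓝 (f one) := by
    refine hf.map_nhds_eq_of_surj ?_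
    rw [LinearMap.range_eq_top]
    intro Y
    refine ⟨(1 / 2 : ℝ) • Y, ?_⟩
    change (2 : ℝ) • ((1 / 2 : ℝ) • Y) = Y
    rw [smul_smul]; norm_num
  have hfone : f one = one := by
    apply Subtype.ext
    change ((projL ((1 : Mat n) * (1 : Mat n)) : S) : Mat n) = 1
    rw [hproj _ (hsq _ h1S), one_mul]
  have hdet : ∀ᶠ X : S in 𝓝 one, (X : Mat n).det ≠ 0 := by
    have hc : Continuous fun X : S => (X : Mat n).det :=
      Continuous.matrix_det continuous_subtype_val
    refine hc.continuousAt.eventually_ne ?_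
    change (1 : Mat n).det ≠ 0
    simp
  have himg : f '' {X : S | (X : Mat n).det ≠ 0} ∈ 𝓝 one := by
    rw [← hfone, ← hnh]
    exact Filter.image_mem_map hdet
  have hcont : Continuous fun G : Mat n => proj (η * G) := by fun_prop
  have hat : proj (η * η) = one := by
    apply Subtype.ext
    change ((projL (η * η) : S) : Mat n) = 1
    rw [hηη, hproj _ h1S]
  have hev := hcont.continuousAt (x := η) (by rw [hat]; exact himg)
  filter_upwards [hev] with G hG hGs
  obtain ⟨X, hX, hXG⟩ := hG
  have hXS : (X : Mat n)ᵀ * η = η * X := X.2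
  have hGS : η * G ∈ S := by
    change (η * G)ᵀ * η = η * (η * G)
    rw [Matrix.transpose_mul, hGs, hηt, mul_assoc, hηη, mul_one, ← mul_assoc, hηη, one_mul]
  have hXX : (X : Mat n) * X = η * G := by
    rw [← hproj _ (hsq _ X.2), ← hproj _ hGS]
    exact congrArg Subtype.val hXG
  have hGX : (X : Mat n)ᵀ * η * X = G := by
    rw [hXS, mul_assoc, hXX, ← mul_assoc, hηη, one_mul]
  have hXu : IsUnit (X : Mat n)ᵀ.det := by
    rw [Matrix.det_transpose]; exact isUnit_iff_ne_zero.2 hX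
  have := (lor_mink n).congr hXu
  rwa [Matrix.transpose_transpose, ← hη, hGX] at this

end Open

theorem Lor.eventually {n : ℕ} {G₀ : Mat n} (h : Lor n G₀) :
    ∀ᶠ G in 𝓝 G₀, Gᵀ = G → Lor n G := by
  obtain ⟨hs, P, hP, hPG⟩ := h
  have hc : Continuous fun G : Mat n => Pᵀ * G * P := by fun_prop
  have hev := hc.continuousAt (x := G₀) (by rw [hPG]; exact eventually_lor_mink n)
  filter_upwards [hev] with G hG hGs
  have h1 : Lor n (Pᵀ * G * P) := hG (by simp [Matrix.transpose_mul, hGs, mul_assoc])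
  have hPt : IsUnit Pᵀ.det := by rwa [Matrix.det_transpose]
  have h2 := h1.congr (Matrix.isUnit_nonsing_inv_det _ hPt)
  rw [Matrix.transpose_nonsing_inv, Matrix.transpose_transpose] at h2
  have : (Pᵀ)⁻¹ * (Pᵀ * G * P) * P⁻¹ = ((Pᵀ)⁻¹ * Pᵀ) * G * (P * P⁻¹) := by
    simp only [mul_assoc]
  rwa [this, Matrix.nonsing_inv_mul _ hPt, Matrix.mul_nonsing_inv _ hP, one_mul, mul_one] at h2

/-- Components of a 2-covariant tensor field. -/
abbrev MetricField (n : ℕ) := Pt n → Fin (n + 1) → Fin (n + 1) → ℝ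

/-- Components of an alternating `k`-form at a point. -/
abbrev FormComp (n k : ℕ) := (Fin k → Fin (n + 1)) → ℝ

abbrev FormField (n k : ℕ) := Pt n → FormComp n k

/-- The components `t` are alternating. -/
def IsAlt (n k : ℕ) (t : FormComp n k) : Prop :=
  ∀ (v : Fin k → Fin (n + 1)) (σ : Equiv.Perm (Fin k)),
    t (v ∘ σ) = ((Equiv.Perm.sign σ : ℤ) : ℝ) * t v

/-- Globally smooth symmetric and alternating tensor fields. -/
structure SmoothData (n k : ℕ) (g : MetricField n) (ω : FormField n k) : Prop where
  smooth_metric : ∀ a b, ContDiff ℝ ∞ (fun x => g x a b)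
  symm : ∀ x a b, g x a b = g x b a
  smooth_form : ∀ v, ContDiff ℝ ∞ (fun x => ω x v)
  alt : ∀ x, IsAlt n k (ω x)

/-- The set of points where `g` is Lorentzian. -/
def lorDom (n : ℕ) (g : MetricField n) : Set (Pt n) := {x | Lor n (Matrix.of (g x))}

theorem isOpen_lor_preimage {n : ℕ} {X : Type*} [TopologicalSpace X]
    {G : X → Fin (n + 1) → Fin (n + 1) → ℝ} (hc : ∀ a b, Continuous fun x => G x a b)
    (hs : ∀ x a b, G x a b = G x b a) : IsOpen {x | Lor n (Matrix.of (G x))} := by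
  rw [isOpen_iff_mem_nhds]
  intro x hx
  have hcont : Continuous fun x => (Matrix.of (G x) : Mat n) :=
    continuous_matrix fun a b => hc a b
  filter_upwards [hcont.continuousAt (x := x) hx.eventually] with y hy
  refine hy ?_
  ext a b
  exact hs y b a

theorem isMetricOn_iff {W : Set (Pt n)} {g : MetricField n} :
    IsMetricOn n W g ↔ (∀ a b, ContDiffOn ℝ ∞ (fun x => g x a b) W) ∧ W ⊆ lorDom n g := by
  refine and_congr Iff.rfl (forall₂_congr fun x _ => ?_)
  exact (lor_of_iff n (g x)).symm

section SmoothData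

variable {g : MetricField n} {ω : FormField n k}

theorem SmoothData.isOpen_lorDom (h : SmoothData n k g ω) : IsOpen (lorDom n g) :=
  isOpen_lor_preimage (fun a b => (h.smooth_metric a b).continuous) h.symm

theorem SmoothData.isMetricOn (h : SmoothData n k g ω) {W : Set (Pt n)} (hW : W ⊆ lorDom n g) : IsMetricOn n W g :=
  isMetricOn_iff.2 ⟨fun a b => (h.smooth_metric a b).contDiffOn, hW⟩

theorem SmoothData.isFormOn (h : SmoothData n k g ω) (W : Set (Pt n)) : IsFormOn n k W ω :=
  ⟨fun v => (h.smooth_form v).contDiffOn, fun x _ => h.alt x⟩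

end SmoothData

/-- The value of a natural tensor on globally defined data. -/
def NaturalTensor.val (T : NaturalTensor n k) (g : MetricField n) (ω : FormField n k) (x : Pt n) :
    Fin (n + 1) → Fin (n + 1) → ℝ :=
  T.T (lorDom n g) g ω x

theorem NaturalTensor.eq_of_eventuallyEq (T : NaturalTensor n k) {W W' : Set (Pt n)}
    {g g' : MetricField n} {ω ω' : FormField n k} (hW : IsOpen W) (hW' : IsOpen W')
    (hg : IsMetricOn n W g) (hω : IsFormOn n k W ω) (hg' : IsMetricOn n W' g')
    (hω' : IsFormOn n k W' ω') {x : Pt n} (hx : x ∈ W) (hx' : x ∈ W')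
    (heg : g =ᶠ[𝓝 x] g') (heω : ω =ᶠ[𝓝 x] ω') : T.T W g ω x = T.T W' g' ω' x := by
  obtain ⟨U, hU, hUo, hxU⟩ := mem_nhds_iff.1 (Filter.inter_mem
    (Filter.inter_mem (hW.mem_nhds hx) (hW'.mem_nhds hx')) (heg.and heω))
  have hUW : U ⊆ W := fun y hy => (hU hy).1.1
  have hUW' : U ⊆ W' := fun y hy => (hU hy).1.2
  have hgU : IsMetricOn n U g :=
    ⟨fun a b => (hg.1 a b).mono hUW, fun y hy => hg.2 y (hUW hy)⟩
  have hωU : IsFormOn n k U ω :=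
    ⟨fun v => (hω.1 v).mono hUW, fun y hy => hω.2 y (hUW hy)⟩
  rw [← T.localize U W g ω g ω hUo hW hUW hgU hωU hg hω (fun _ _ => ⟨rfl, rfl⟩) x hxU]
  exact T.localize U W' g ω g' ω' hUo hW' hUW' hgU hωU hg' hω' (fun y hy => (hU hy).2) x hxU

theorem NaturalTensor.val_eq (T : NaturalTensor n k) {W : Set (Pt n)}
    {g g' : MetricField n} {ω ω' : FormField n k} (h : SmoothData n k g ω) (hW : IsOpen W)
    (hg' : IsMetricOn n W g') (hω' : IsFormOn n k W ω') {x : Pt n} (hx : x ∈ W)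
    (heg : g =ᶠ[𝓝 x] g') (heω : ω =ᶠ[𝓝 x] ω') : T.val g ω x = T.T W g' ω' x := by
  refine T.eq_of_eventuallyEq h.isOpen_lorDom hW (h.isMetricOn subset_rfl) (h.isFormOn _) hg' hω'
    ?_ hx heg heω
  have := (isMetricOn_iff.1 hg').2 hx
  change Lor n (Matrix.of (g x))
  rw [heg.self_of_nhds]
  exact this

/-- The matrix of the differential of `φ`. -/
noncomputable def jacM (n : ℕ) (φ : Pt n → Pt n) (x : Pt n) : Mat n := Matrix.of (jac n φ x)

theorem pullTensor_eq (φ : Pt n → Pt n) (g : MetricField n) (x : Pt n) :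
    Matrix.of (pullTensor n φ g x) = jacM n φ x * Matrix.of (g (φ x)) * (jacM n φ x)ᵀ := by
  ext a b
  rw [mul_mul_transpose_apply]
  rfl

theorem contDiff_jac {φ : Pt n → Pt n} (hφ : ContDiff ℝ ∞ φ) (a c : Fin (n + 1)) :
    ContDiff ℝ ∞ (fun x => jac n φ x a c) := by
  have : ContDiff ℝ ∞ fun x => fderiv ℝ φ x (Pi.single a 1) :=
    (hφ.fderiv_right (by simp)).clm_apply contDiff_const
  exact contDiff_pi.1 this c

/-- Pullback of components of a form by a linear map. -/
def pullComp (L : Mat n) (t : FormComp n k) : FormComp n k :=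
  fun v => ∑ w : Fin k → Fin (n + 1), (∏ j, L (v j) (w j)) * t w

theorem pullComp_comp_perm (L : Mat n) (t : FormComp n k) (σ : Equiv.Perm (Fin k))
    (v : Fin k → Fin (n + 1)) :
    pullComp L t (v ∘ σ) = pullComp L (fun w => t (w ∘ σ)) v := by
  unfold pullComp
  rw [← (Equiv.arrowCongr σ.symm (Equiv.refl (Fin (n + 1)))).sum_comp]
  refine Finset.sum_congr rfl fun w _ => ?_
  have : (Equiv.arrowCongr σ.symm (Equiv.refl (Fin (n + 1)))) w = w ∘ σ := by
    ext j; simp [Equiv.arrowCongr]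
  rw [this]
  congr 1
  exact Equiv.prod_comp σ fun j => L (v j) (w j)

theorem IsAlt.pullComp {t : FormComp n k} (h : IsAlt n k t) (L : Mat n) :
    IsAlt n k (pullComp L t) := by
  intro v σ
  rw [pullComp_comp_perm]
  simp only [h _ σ]
  unfold Paper.pullComp
  rw [Finset.mul_sum]
  exact Finset.sum_congr rfl fun w _ => by ring

theorem pullForm_eq (φ : Pt n → Pt n) (ω : FormField n k) (x : Pt n) :
    pullForm n k φ ω x = pullComp (jacM n φ x) (ω (φ x)) := rfl

theorem SmoothData.pull {g : MetricField n} {ω : FormField n k} (h : SmoothData n k g ω)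
    {φ : Pt n → Pt n} (hφ : ContDiff ℝ ∞ φ) :
    SmoothData n k (pullTensor n φ g) (pullForm n k φ ω) where
  smooth_metric a b := by
    unfold pullTensor
    refine ContDiff.sum fun c _ => ContDiff.sum fun d _ => ?_
    exact ((contDiff_jac hφ a c).mul (contDiff_jac hφ b d)).mul ((h.smooth_metric c d).comp hφ)
  symm x a b := by
    unfold pullTensor
    rw [Finset.sum_comm]
    refine Finset.sum_congr rfl fun c _ => Finset.sum_congr rfl fun d _ => ?_
    rw [h.symm]; ring
  smooth_form v := by
    unfold pullForm
    refine ContDiff.sum fun w _ => ?_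
    exact (contDiff_prod fun j _ => contDiff_jac hφ (v j) (w j)).mul ((h.smooth_form w).comp hφ)
  alt x := (h.alt _).pullComp _

theorem val_pull (T : NaturalTensor n k) {g : MetricField n} {ω : FormField n k}
    (h : SmoothData n k g ω) {φ : Pt n → Pt n} (hφ : ContDiff ℝ ∞ φ) {x : Pt n}
    (hJ : IsUnit (jacM n φ x).det) (hx : φ x ∈ lorDom n g) (a b : Fin (n + 1)) :
    T.val (pullTensor n φ g) (pullForm n k φ ω) x a b =
      (jacM n φ x * Matrix.of (T.val g ω (φ x)) * (jacM n φ x)ᵀ) a b := by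
  classical
  -- the differential as a continuous linear equivalence
  have hd : ∀ y, HasFDerivAt φ (fderiv ℝ φ y) y :=
    fun y => (hφ.differentiable (by simp) y).hasFDerivAt
  have hmat : ∀ y, LinearMap.toMatrix' (fderiv ℝ φ y : Pt n →ₗ[ℝ] Pt n) = (jacM n φ y)ᵀ := by
    intro y
    ext i j
    rw [LinearMap.toMatrix'_apply, Matrix.transpose_apply]
    simp [jacM, jac]
  have hequiv : ∀ y, IsUnit (jacM n φ y).det →
      ∃ e : Pt n ≃L[ℝ] Pt n, (e : Pt n →L[ℝ] Pt n) = fderiv ℝ φ y := by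
    intro y hy
    have hu : IsUnit (LinearMap.det (fderiv ℝ φ y : Pt n →ₗ[ℝ] Pt n)) := by
      rwa [← LinearMap.det_toMatrix', hmat, Matrix.det_transpose]
    refine ⟨(LinearEquiv.ofIsUnitDet (f := (fderiv ℝ φ y : Pt n →ₗ[ℝ] Pt n))
      (v := Pi.basisFun ℝ _) (v' := Pi.basisFun ℝ _) ?_).toContinuousLinearEquiv, ?_⟩
    · rwa [← LinearMap.det_toMatrix (Pi.basisFun ℝ _)] at hu
    · ext; rfl
  obtain ⟨e, he⟩ := hequiv x hJ
  have hde : HasFDerivAt φ (e : Pt n →L[ℝ] Pt n) x := he ▸ hd x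
  set ψ := hφ.contDiffAt.toOpenPartialHomeomorph φ hde (by simp) with hψ
  have hψφ : (ψ : Pt n → Pt n) = φ := rfl
  have hdet : IsOpen {y | IsUnit (jacM n φ y).det} := by
    have : Continuous fun y => (jacM n φ y).det :=
      Continuous.matrix_det (continuous_matrix fun a b => (contDiff_jac hφ a b).continuous)
    simp only [isUnit_iff_ne_zero]
    exact isOpen_ne_fun this continuous_const
  set U : Set (Pt n) := ψ.source ∩ ({y | IsUnit (jacM n φ y).det} ∩ φ ⁻¹' lorDom n g) with hU
  have hUo : IsOpen U := ψ.open_source.inter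
    (hdet.inter (h.isOpen_lorDom.preimage hφ.continuous))
  have hxU : x ∈ U := ⟨hφ.contDiffAt.mem_toOpenPartialHomeomorph_source hde (by simp), hJ, hx⟩
  set W' : Set (Pt n) := φ '' U with hW'
  have hUs : U ⊆ ψ.source := Set.inter_subset_left
  have hW'o : IsOpen W' := ψ.isOpen_image_of_subset_source hUo hUs
  have hdiff : IsDiffeoOn n φ ψ.symm U W' :=
    { open_src := hUo
      open_tgt := hW'o
      mapsTo := Set.mapsTo_image _ _
      mapsTo_inv := by
        rintro _ ⟨y, hy, rfl⟩
        have : ψ.symm (φ y) = y := ψ.left_inv (hUs hy)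
        rwa [this]
      left_inv := fun y hy => ψ.left_inv (hUs hy)
      right_inv := by
        rintro _ ⟨y, hy, rfl⟩
        exact ψ.right_inv (ψ.map_source (hUs hy))
      smooth := hφ.contDiffOn
      smooth_inv := by
        rintro _ ⟨y, hy, rfl⟩
        obtain ⟨e', he'⟩ := hequiv y hy.2.1
        have hsy : ψ.symm (φ y) = y := ψ.left_inv (hUs hy)
        refine ContDiffAt.contDiffWithinAt ?_
        refine ψ.contDiffAt_symm (f₀' := e') (ψ.map_source (hUs hy)) ?_ ?_
        · rw [hsy, he']; exact hd y
        · exact hφ.contDiffAt }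
  have hgW' : IsMetricOn n W' g := by
    refine h.isMetricOn ?_
    rintro _ ⟨y, hy, rfl⟩
    exact hy.2.2
  have hp := h.pull hφ
  have hgU : IsMetricOn n U (pullTensor n φ g) := by
    refine hp.isMetricOn fun y hy => ?_
    change Lor n _
    rw [pullTensor_eq]
    exact Lor.congr hy.2.2 hy.2.1
  rw [T.val_eq hp hUo hgU (hp.isFormOn _) hxU .rfl .rfl,
    T.natural φ ψ.symm U W' hdiff g ω hgW' (h.isFormOn _) x hxU,
    T.val_eq h hW'o hgW' (h.isFormOn _) ⟨x, hxU, rfl⟩ .rfl .rfl, ← pullTensor_eq]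
  rfl

/-- Smooth dependence on parameters. -/
theorem contDiffAt_val (T : NaturalTensor n k) {E : Type} [NormedAddCommGroup E] [NormedSpace ℝ E]
    [FiniteDimensional ℝ E] {G : E → MetricField n} {Ω : E → FormField n k}
    (hG : ∀ a b, ContDiff ℝ ∞ fun p : E × Pt n => G p.1 p.2 a b)
    (hΩ : ∀ v, ContDiff ℝ ∞ fun p : E × Pt n => Ω p.1 p.2 v)
    (hsymm : ∀ s x a b, G s x a b = G s x b a) (halt : ∀ s x, IsAlt n k (Ω s x)) {s₀ : E} {x₀ : Pt n}
    (hlor : x₀ ∈ lorDom n (G s₀)) (a b : Fin (n + 1)) :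
    ContDiffAt ℝ ∞ (fun s => T.val (G s) (Ω s) x₀ a b) s₀ := by
  let e : E ≃L[ℝ] (Fin (Module.finrank ℝ E) → ℝ) :=
    ContinuousLinearEquiv.ofFinrankEq (by simp)
  have hopen : IsOpen {p : E × Pt n | Lor n (Matrix.of (G p.1 p.2))} :=
    isOpen_lor_preimage (fun a b => (hG a b).continuous) (fun p => hsymm p.1 p.2)
  obtain ⟨P, W, hP, hW, hsP, hxW, hPW⟩ := isOpen_prod_iff.1 hopen s₀ x₀ hlor
  have hdata : ∀ s, SmoothData n k (G s) (Ω s) := fun s =>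
    ⟨fun a b => (hG a b).comp (contDiff_const.prodMk contDiff_id), hsymm s,
      fun v => (hΩ v).comp (contDiff_const.prodMk contDiff_id), halt s⟩
  have hmet : ∀ s ∈ P, IsMetricOn n W (G s) := fun s hs =>
    (hdata s).isMetricOn fun x hx => hPW (Set.mk_mem_prod hs hx)
  have hreg := T.regular _ (e.symm ⁻¹' P) W (hP.preimage e.symm.continuous) hW
    (fun r => G (e.symm r)) (fun r => Ω (e.symm r))
    (fun a b => ((hG a b).comp
      ((e.symm.contDiff.comp contDiff_fst).prodMk contDiff_snd)).contDiffOn)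
    (fun v => ((hΩ v).comp
      ((e.symm.contDiff.comp contDiff_fst).prodMk contDiff_snd)).contDiffOn)
    (fun s hs => ⟨hmet _ hs, (hdata _).isFormOn _⟩) a b
  have hmem : (e.symm ⁻¹' P) ×ˢ W ∈ 𝓝 (e s₀, x₀) := by
    refine ((hP.preimage e.symm.continuous).prod hW).mem_nhds ⟨?_, hxW⟩
    change e.symm (e s₀) ∈ P
    rwa [e.symm_apply_apply]
  have h1 := (hreg.contDiffAt hmem).comp s₀ (e.contDiff.prodMk contDiff_const).contDiffAt
  refine h1.congr_of_eventuallyEq ?_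
  filter_upwards [hP.mem_nhds hsP] with s hs
  simp only [Function.comp, e.symm_apply_apply]
  rw [T.val_eq (hdata s) hW (hmet s hs) ((hdata s).isFormOn _) hxW .rfl .rfl]

/-- Comparison of two curves whose difference is exactly quadratic. -/
theorem strictDeriv_apply_eq {E : Type*} [NormedAddCommGroup E] [NormedSpace ℝ E] {H : E → ℝ}
    {D : E →L[ℝ] ℝ} {x : E} (hD : HasStrictFDerivAt H D x) {u w : ℝ → E} {e : E} {c : ℝ}
    (hu : Filter.Tendsto u (𝓝[>] 0) (𝓝 x)) (hw : Filter.Tendsto w (𝓝[>] 0) (𝓝 x))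
    {r : ℝ → ℝ} (hr : ∀ μ, 0 < μ → r μ ≠ 0)
    (huw : ∀ μ, 0 < μ → u μ - w μ = r μ • e)
    (hH : ∀ μ, 0 < μ → H (u μ) - H (w μ) = r μ * c) : D e = c := by
  have h1 := hD.isLittleO.comp_tendsto (hu.prodMk_nhds hw)
  have h2 : (fun μ : ℝ => r μ * (c - D e)) =o[𝓝[>] 0] fun μ => r μ • e := by
    refine (h1.congr' ?_ ?_)
    · filter_upwards [self_mem_nhdsWithin] with μ hμ
      simp only [Function.comp]
      rw [hH μ hμ, huw μ hμ, map_smul, smul_eq_mul]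
      ring
    · filter_upwards [self_mem_nhdsWithin] with μ hμ
      simp only [Function.comp]
      rw [huw μ hμ]
  by_contra hne
  have hne' : 0 < |c - D e| := abs_pos.2 (sub_ne_zero.2 (Ne.symm hne))
  obtain ⟨μ, hμ, hμ0⟩ := ((h2.def (c := |c - D e| / (2 * (‖e‖ + 1))) (by positivity)).and
    self_mem_nhdsWithin).exists
  have hrp : 0 < |r μ| := abs_pos.2 (hr μ hμ0)
  rw [Real.norm_eq_abs, abs_mul, norm_smul, Real.norm_eq_abs] at hμ
  have h3 : |c - D e| / (2 * (‖e‖ + 1)) * (|r μ| * ‖e‖) ≤ |r μ| * |c - D e| / 2 := by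
    rw [div_mul_eq_mul_div, div_le_div_iff₀ (by positivity) (by norm_num)]
    nlinarith [norm_nonneg e, mul_pos hrp hne']
  nlinarith [mul_pos hrp hne']

theorem tendsto_smul_zero {E : Type*} [NormedAddCommGroup E] [NormedSpace ℝ E] (x : E) :
    Filter.Tendsto (fun μ : ℝ => μ • x) (𝓝[>] 0) (𝓝 0) := by
  have : Continuous fun μ : ℝ => μ • x := by fun_prop
  have h := this.tendsto 0
  rw [zero_smul] at h
  exact h.mono_left nhdsWithin_le_nhds

/-- A smooth positively homogeneous function of degree one is linear. -/
theorem eq_fderiv_of_homogeneous {E : Type*} [NormedAddCommGroup E] [NormedSpace ℝ E] {f : E → ℝ}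
    (hf : ContDiffAt ℝ ∞ f 0) (hh : ∀ s : ℝ, 0 < s → ∀ x, f (s • x) = s * f x) (x : E) :
    f x = fderiv ℝ f 0 x := by
  have h0 : f 0 = 0 := by have := hh 2 two_pos 0; rw [smul_zero] at this; linarith
  refine (strictDeriv_apply_eq (hf.hasStrictFDerivAt (by simp)) (w := fun _ => 0) (r := id)
    (tendsto_smul_zero x) tendsto_const_nhds (fun μ hμ => ne_of_gt hμ) ?_ ?_).symm
  · intro μ _; simp
  · intro μ hμ; rw [hh μ hμ, h0, sub_zero]; rfl

/-- A smooth positively homogeneous function of degree two is a quadratic form. -/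
theorem exists_bilin_of_homogeneous {E : Type*} [NormedAddCommGroup E] [NormedSpace ℝ E]
    {f : E → ℝ} (hf : ContDiffAt ℝ ∞ f 0)
    (hh : ∀ s : ℝ, 0 < s → ∀ x, f (s • x) = s ^ 2 * f x) :
    ∃ b : E →ₗ[ℝ] E →ₗ[ℝ] ℝ, (∀ x y, b x y = b y x) ∧ ∀ x, f x = b x x := by
  set D := fderiv ℝ (fderiv ℝ f) 0 with hD
  have hF : ContDiffAt ℝ ∞ (fderiv ℝ f) 0 := hf.fderiv_right (by simp)
  have hstrict : HasStrictFDerivAt (fderiv ℝ f) D 0 := hF.hasStrictFDerivAt (by simp)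
  have hhF : ∀ s : ℝ, 0 < s → ∀ x, fderiv ℝ f (s • x) = s • fderiv ℝ f x := by
    intro s hs x
    have e1 : (fun y => f (s • y)) = s ^ 2 • f := funext (hh s hs)
    have e2 := congrArg (fun u => fderiv ℝ u x) e1
    rw [fderiv_comp_smul, fderiv_const_smul_field] at e2
    rw [← smul_right_injective _ hs.ne' |>.eq_iff, e2, smul_smul, sq]
    rfl
  have h0 : fderiv ℝ f 0 = 0 := by
    have := hhF 2 two_pos 0
    rw [smul_zero, two_smul] at this
    simpa using this
  have hquad : ∀ x y, fderiv ℝ f x y = D x y := by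
    intro x y
    have hs2 : HasStrictFDerivAt (fun z => fderiv ℝ f z y)
        ((ContinuousLinearMap.apply ℝ ℝ y).comp D) 0 :=
      (ContinuousLinearMap.apply ℝ ℝ y).hasStrictFDerivAt.comp 0 hstrict
    refine (strictDeriv_apply_eq hs2 (w := fun _ => 0) (r := id) (e := x)
      (tendsto_smul_zero x) tendsto_const_nhds (fun μ hμ => ne_of_gt hμ) ?_ ?_).symm
    · intro μ _; simp
    · intro μ hμ; rw [hhF μ hμ, h0]; simp
  have hfx : ∀ x, 2 * f x = D x x := by
    intro x
    -- differentiate `s ↦ f (s • x) = s ^ 2 * f x`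
    have hd : ∀ᶠ y in 𝓝 (0 : E), DifferentiableAt ℝ f y := by
      have h1 : ContDiffAt ℝ 1 f 0 := hf.of_le (by simp)
      filter_upwards [h1.eventually (by simp)] with y hy
      exact hy.differentiableAt (by simp)
    obtain ⟨s, hs, hs0⟩ := (((tendsto_smul_zero x).eventually hd).and self_mem_nhdsWithin).exists
    have hs0' : (0 : ℝ) < s := hs0
    have h1 : HasDerivAt (fun r : ℝ => f (r • x)) (fderiv ℝ f (s • x) x) s := by
      have h2 : HasDerivAt (fun r : ℝ => r • x) x s := by
        simpa using (hasDerivAt_id s).smul_const x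
      exact hs.hasFDerivAt.comp_hasDerivAt s h2
    have h3 : HasDerivAt (fun r : ℝ => f (r • x)) (2 * s * f x) s := by
      have h4 : HasDerivAt (fun r : ℝ => r ^ 2 * f x) (2 * s * f x) s := by
        simpa using (hasDerivAt_pow 2 s).mul_const (f x)
      refine h4.congr_of_eventuallyEq ?_
      filter_upwards [lt_mem_nhds hs0'] with r hr
      exact hh r hr x
    have h5 := h1.unique h3
    rw [hhF s hs0', _root_.smul_apply, hquad, smul_eq_mul] at h5
    have := mul_left_cancel₀ hs0'.ne' (h5.trans (by ring : 2 * s * f x = s * (2 * f x)))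
    exact this.symm
  let b : E →ₗ[ℝ] E →ₗ[ℝ] ℝ := LinearMap.mk₂ ℝ (fun x y => (1 / 4 : ℝ) * (D x y + D y x))
    (fun x y z => by simp; ring) (fun c x y => by simp; ring)
    (fun x y z => by simp; ring) (fun c x y => by simp; ring)
  refine ⟨b, fun x y => ?_, fun x => ?_⟩
  · change (1 / 4 : ℝ) * (D x y + D y x) = (1 / 4 : ℝ) * (D y x + D x y)
    ring
  · change f x = (1 / 4 : ℝ) * (D x x + D x x)
    linarith [hfx x]

/-- Values of weighted-homogeneous families are additive. -/
theorem jet_additive {H : ℝ × ℝ × ℝ × ℝ → ℝ} (hH : ContDiffAt ℝ ∞ H 0) (h0 : H 0 = 0)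
    {p q r s : ℝ} (hp : ∀ μ, 0 < μ → H (μ, μ ^ 2, μ, μ ^ 2) = μ ^ 2 * p)
    (hq : ∀ μ, 0 < μ → H (μ, 0, μ, 0) = μ ^ 2 * q)
    (hr : ∀ μ, 0 < μ → H (0, μ ^ 2, 0, 0) = μ ^ 2 * r)
    (hs : ∀ μ, 0 < μ → H (0, 0, 0, μ ^ 2) = μ ^ 2 * s) : p = q + r + s := by
  have hD := hH.hasStrictFDerivAt (by simp)
  have tend : ∀ u : ℝ → ℝ × ℝ × ℝ × ℝ, Continuous u → u 0 = 0 →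
      Filter.Tendsto u (𝓝[>] 0) (𝓝 0) := fun u hu hu0 => by
    have := hu.tendsto 0
    rw [hu0] at this
    exact this.mono_left nhdsWithin_le_nhds
  have hsq : ∀ μ : ℝ, 0 < μ → μ ^ 2 ≠ 0 := fun μ hμ => by positivity
  have t0 : Filter.Tendsto (fun _ : ℝ => (0 : ℝ × ℝ × ℝ × ℝ)) (𝓝[>] 0) (𝓝 0) :=
    tendsto_const_nhds
  have e1 := strictDeriv_apply_eq hD (e := (0, 1, 0, 1)) (c := p - q)
    (tend (fun μ => (μ, μ ^ 2, μ, μ ^ 2)) (by fun_prop) (by simp))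
    (tend (fun μ => (μ, 0, μ, 0)) (by fun_prop) (by simp)) hsq
    (fun μ _ => by simp) (fun μ hμ => by rw [hp μ hμ, hq μ hμ]; ring)
  have e2 := strictDeriv_apply_eq hD (e := (0, 1, 0, 0)) (c := r)
    (tend (fun μ => (0, μ ^ 2, 0, 0)) (by fun_prop) (by simp)) t0 hsq
    (fun μ _ => by simp) (fun μ hμ => by rw [hr μ hμ, h0]; ring)
  have e3 := strictDeriv_apply_eq hD (e := (0, 0, 0, 1)) (c := s)
    (tend (fun μ => (0, 0, 0, μ ^ 2)) (by fun_prop) (by simp)) t0 hsq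
    (fun μ _ => by simp) (fun μ hμ => by rw [hs μ hμ, h0]; ring)
  have e4 : ((0, 1, 0, 1) : ℝ × ℝ × ℝ × ℝ) = (0, 1, 0, 0) + (0, 0, 0, 1) := by simp
  rw [e4, map_add, e2, e3] at e1
  linarith

/-- Antisymmetrization of components. -/
noncomputable def altz (n k : ℕ) : FormComp n k →ₗ[ℝ] FormComp n k where
  toFun t v := (1 / (k.factorial : ℝ)) *
    ∑ σ : Equiv.Perm (Fin k), ((Equiv.Perm.sign σ : ℤ) : ℝ) * t (v ∘ σ)
  map_add' s t := by
    ext v; simp only [Pi.add_apply, mul_add, Finset.sum_add_distrib]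
  map_smul' c t := by
    ext v
    simp only [Pi.smul_apply, smul_eq_mul, RingHom.id_apply, Finset.mul_sum]
    exact Finset.sum_congr rfl fun σ _ => by ring

theorem altz_apply (t : FormComp n k) (v : Fin k → Fin (n + 1)) :
    altz n k t v = (1 / (k.factorial : ℝ)) *
      ∑ σ : Equiv.Perm (Fin k), ((Equiv.Perm.sign σ : ℤ) : ℝ) * t (v ∘ σ) := rfl

theorem sign_mul_self (σ : Equiv.Perm (Fin k)) :
    ((Equiv.Perm.sign σ : ℤ) : ℝ) * ((Equiv.Perm.sign σ : ℤ) : ℝ) = 1 := by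
  rcases Int.units_eq_one_or (Equiv.Perm.sign σ) with h | h <;> simp [h]

theorem isAlt_altz (t : FormComp n k) : IsAlt n k (altz n k t) := by
  intro v σ
  rw [altz_apply, altz_apply, mul_left_comm]
  congr 1
  rw [Finset.mul_sum, ← Equiv.sum_comp (Equiv.mulLeft σ⁻¹)]
  refine Finset.sum_congr rfl fun τ _ => ?_
  have : (v ∘ σ) ∘ (Equiv.mulLeft σ⁻¹ τ) = v ∘ τ := by ext j; simp
  rw [this, Equiv.coe_mulLeft, Equiv.Perm.sign_mul, Equiv.Perm.sign_inv]
  push_cast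
  ring

theorem altz_of_isAlt {t : FormComp n k} (h : IsAlt n k t) : altz n k t = t := by
  ext v
  rw [altz_apply]
  simp only [h v, ← mul_assoc, sign_mul_self, one_mul, Finset.sum_const, Finset.card_univ,
    Fintype.card_perm, Fintype.card_fin, nsmul_eq_mul]
  have : (k.factorial : ℝ) ≠ 0 := by positivity
  field_simp

theorem IsAlt.smul {t : FormComp n k} (h : IsAlt n k t) (c : ℝ) : IsAlt n k (c • t) := by
  intro v σ
  simp only [Pi.smul_apply, smul_eq_mul, h v σ]
  ring

theorem IsAlt.add {s t : FormComp n k} (hs : IsAlt n k s) (ht : IsAlt n k t) :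
    IsAlt n k (s + t) := by
  intro v σ
  simp only [Pi.add_apply, hs v σ, ht v σ]
  ring

theorem isAlt_zero : IsAlt n k (0 : FormComp n k) := by
  intro v σ; simp

/-- Independence of the unit of scale. -/
def NaturalTensor.ScaleInv (T : NaturalTensor n k) : Prop :=
  ∀ W g ω, IsOpen W → IsMetricOn n W g → IsFormOn n k W ω →
      ∀ lam : ℝ, 0 < lam → ∀ x ∈ W, ∀ a b,
        T.T W (fun y c d => lam ^ 2 * g y c d) (fun y v => lam ^ (k - 1) * ω y v) x a b
          = T.T W g ω x a b

theorem pullComp_smul_one (c : ℝ) (t : FormComp n k) :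
    pullComp (c • (1 : Mat n)) t = c ^ k • t := by
  ext v
  unfold pullComp
  rw [Finset.sum_eq_single v]
  · simp [Matrix.smul_apply]
  · intro w _ hw
    obtain ⟨j, hj⟩ := Function.ne_iff.1 hw
    rw [Finset.prod_eq_zero (Finset.mem_univ j), zero_mul]
    simp [Matrix.smul_apply, Matrix.one_apply_ne (Ne.symm hj)]
  · simp

theorem jacM_smul (μ : ℝ) (x : Pt n) :
    jacM n (fun y : Pt n => μ • y) x = μ • (1 : Mat n) := by
  have h : HasFDerivAt (fun y : Pt n => μ • y) (μ • ContinuousLinearMap.id ℝ (Pt n)) x :=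
    (hasFDerivAt_id x).const_smul μ
  ext a c
  change fderiv ℝ (fun y : Pt n => μ • y) x (Pi.single a 1) c = _
  rw [h.fderiv]
  simp [Matrix.one_apply, Pi.single_apply, eq_comm]

/-- Combined effect of a homothety of space and a change of the unit of scale. -/
theorem val_dilate {T : NaturalTensor n k} (hT : T.ScaleInv) (hk : 1 ≤ k) {g : MetricField n}
    {ω : FormField n k} (h : SmoothData n k g ω) (h0 : 0 ∈ lorDom n g) {μ : ℝ} (hμ : 0 < μ)
    (a b : Fin (n + 1)) :
    T.val (fun x => g (μ • x)) (fun x => μ • ω (μ • x)) 0 a b = μ ^ 2 * T.val g ω 0 a b := by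
  have hφ : ContDiff ℝ ∞ (fun y : Pt n => μ • y) := contDiff_const_smul μ
  have hdet : IsUnit (jacM n (fun y : Pt n => μ • y) 0).det := by
    rw [jacM_smul, Matrix.det_smul, Matrix.det_one, mul_one]
    exact (isUnit_iff_ne_zero.2 hμ.ne').pow _
  have hp := val_pull T h hφ (x := 0) hdet (by simpa using h0) a b
  have hR : (jacM n (fun y : Pt n => μ • y) 0 * Matrix.of (T.val g ω (μ • 0)) *
      (jacM n (fun y : Pt n => μ • y) 0)ᵀ) a b = μ ^ 2 * T.val g ω 0 a b := by
    rw [jacM_smul, Matrix.transpose_smul, Matrix.transpose_one, smul_mul_assoc, one_mul,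
      mul_smul_comm, mul_one, smul_smul, smul_zero, sq]
    rfl
  rw [hR] at hp
  rw [← hp]
  have hgd : SmoothData n k (fun x => g (μ • x)) (fun x => μ • ω (μ • x)) :=
    ⟨fun a b => (h.smooth_metric a b).comp hφ, fun x => h.symm _,
      fun v => ((h.smooth_form v).comp hφ).const_smul μ, fun x => (h.alt _).smul μ⟩
  have h0' : (0 : Pt n) ∈ lorDom n (fun x => g (μ • x)) := by
    change Lor n (Matrix.of (g (μ • 0)))
    rw [smul_zero]; exact h0
  have hpd := h.pull hφ
  have e1 : pullTensor n (fun y : Pt n => μ • y) g = fun x c d => μ ^ 2 * g (μ • x) c d := by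
    ext x c d
    have := congrFun (congrFun (pullTensor_eq (fun y : Pt n => μ • y) g x) c) d
    rw [jacM_smul, Matrix.transpose_smul, Matrix.transpose_one, smul_mul_assoc, one_mul,
      mul_smul_comm, mul_one, smul_smul, ← sq] at this
    exact this
  have e2 : pullForm n k (fun y : Pt n => μ • y) ω =
      fun x v => μ ^ (k - 1) * (μ • ω (μ • x)) v := by
    ext x v
    rw [pullForm_eq, jacM_smul, pullComp_smul_one]
    simp only [Pi.smul_apply, smul_eq_mul, ← mul_assoc]
    rw [← pow_succ, Nat.sub_add_cancel hk]
  have hs := hT (lorDom n fun x => g (μ • x)) _ _ hgd.isOpen_lorDom (hgd.isMetricOn subset_rfl)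
    (hgd.isFormOn _) μ hμ 0 h0' a b
  rw [← e1, ← e2] at hs
  change T.T _ _ _ 0 a b = _
  rw [← hs]
  refine (congrFun (congrFun (T.val_eq hpd hgd.isOpen_lorDom ?_ (hpd.isFormOn _) h0' .rfl .rfl) a)
    b).symm
  refine hpd.isMetricOn fun x hx => ?_
  rw [e1]
  exact Lor.smul hx hμ.ne'

/-- The flat metric. -/
abbrev flat (n : ℕ) : MetricField n := fun _ => minkM n

theorem minkM_comm (a b : Fin (n + 1)) : minkM n a b = minkM n b a :=
  congrFun (congrFun (mink_transpose n) b) a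

theorem smoothData_of_flat {ω : FormField n k} (hω : ∀ v, ContDiff ℝ ∞ fun x => ω x v)
    (ha : ∀ x, IsAlt n k (ω x)) : SmoothData n k (flat n) ω :=
  ⟨fun _ _ => contDiff_const, fun _ => minkM_comm, hω, ha⟩

theorem zero_mem_lorDom {g : MetricField n} (h : g 0 = minkM n) : 0 ∈ lorDom n g := by
  change Lor n (Matrix.of (g 0))
  rw [h]; exact lor_mink n

theorem val_flat_zero {T : NaturalTensor n k} (hT : T.ScaleInv) (hk : 1 ≤ k) (a b : Fin (n + 1)) :
    T.val (flat n) (fun _ => 0) 0 a b = 0 := by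
  have := val_dilate hT hk (smoothData_of_flat (n := n) (k := k) (ω := fun _ => 0)
    (fun _ => contDiff_const) (fun _ => isAlt_zero)) (zero_mem_lorDom rfl) two_pos a b
  simp only [smul_zero] at this
  linarith

/-- Additivity of the value of a scale-invariant natural tensor in normal form. -/
theorem val_additive {T : NaturalTensor n k} (hT : T.ScaleInv) (hk : 1 ≤ k) {g : MetricField n}
    {ω : FormField n k} (h : SmoothData n k g ω)
    {R : ℝ × Pt n → Fin (n + 1) → Fin (n + 1) → ℝ} {θ : FormComp n k}
    {W : ℝ × Pt n → FormComp n k}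
    (hR : ∀ a b, ContDiff ℝ ∞ fun p => R p a b) (hRs : ∀ p a b, R p a b = R p b a)
    (hθ : IsAlt n k θ) (hW : ∀ v, ContDiff ℝ ∞ fun p => W p v) (hWa : ∀ p, IsAlt n k (W p))
    (hg : ∀ (l : ℝ) x a b, g (l • x) a b = minkM n a b + l ^ 2 * R (l, x) a b)
    (hω : ∀ (l : ℝ) x v, ω (l • x) v = θ v + l * W (l, x) v)
    (hR0 : ∀ (l : ℝ) x a b, R (0, l • x) a b = l ^ 2 * R (0, x) a b)
    (hW0 : ∀ (l : ℝ) x v, W (0, l • x) v = l * W (0, x) v) (a b : Fin (n + 1)) :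
    T.val g ω 0 a b = T.val (flat n) (fun _ => θ) 0 a b +
      T.val (fun x c d => minkM n c d + R (0, x) c d) (fun _ => 0) 0 a b +
      T.val (flat n) (fun x => W (0, x)) 0 a b := by
  let G : ℝ × ℝ × ℝ × ℝ → MetricField n := fun s x c d => minkM n c d + s.2.1 * R (s.1, x) c d
  let Ω : ℝ × ℝ × ℝ × ℝ → FormField n k :=
    fun s x v => s.2.2.1 * θ v + s.2.2.2 * W (s.1, x) v
  have hR00 : ∀ c d, R (0, 0) c d = 0 := fun c d => by
    have := hR0 0 0 c d
    simpa using this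
  have hsd : ∀ s, SmoothData n k (G s) (Ω s) := fun s =>
    ⟨fun c d => contDiff_const.add (contDiff_const.mul
        ((hR c d).comp (contDiff_const.prodMk contDiff_id))),
      fun x c d => by simp only [G]; rw [minkM_comm, hRs],
      fun v => contDiff_const.add (contDiff_const.mul
        ((hW v).comp (contDiff_const.prodMk contDiff_id))),
      fun x => (hθ.smul _).add ((hWa _).smul _)⟩
  have hsm : ContDiffAt ℝ ∞ (fun s => T.val (G s) (Ω s) 0 a b) 0 := by
    refine contDiffAt_val T ?_ ?_ (fun s => (hsd s).symm) (fun s => (hsd s).alt) ?_ a b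
    · intro c d
      have : ContDiff ℝ ∞ fun p : (ℝ × ℝ × ℝ × ℝ) × Pt n => R (p.1.1, p.2) c d :=
        (hR c d).comp ((contDiff_fst.comp contDiff_fst).prodMk contDiff_snd)
      simp only [G]
      fun_prop
    · intro v
      have : ContDiff ℝ ∞ fun p : (ℝ × ℝ × ℝ × ℝ) × Pt n => W (p.1.1, p.2) v :=
        (hW v).comp ((contDiff_fst.comp contDiff_fst).prodMk contDiff_snd)
      simp only [Ω]
      fun_prop
    · refine zero_mem_lorDom ?_
      ext c d; simp [G]
  have hg0 : g 0 = minkM n := by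
    ext c d
    have := hg 0 0 c d
    simpa using this
  have key : ∀ (g' : MetricField n) (ω' : FormField n k) (s : ℝ × ℝ × ℝ × ℝ) (μ : ℝ), 0 < μ →
      SmoothData n k g' ω' → g' 0 = minkM n → (∀ x c d, G s x c d = g' (μ • x) c d) →
      (∀ x v, Ω s x v = μ * ω' (μ • x) v) →
      T.val (G s) (Ω s) 0 a b = μ ^ 2 * T.val g' ω' 0 a b := by
    intro g' ω' s μ hμ hd h0 e1 e2
    rw [← val_dilate hT hk hd (zero_mem_lorDom h0) hμ]
    congr 1
    · ext x c d; exact e1 x c d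
    · ext x v; exact e2 x v
  refine jet_additive hsm ?_ ?_ ?_ ?_ ?_
  · rw [← val_flat_zero hT hk a b]
    congr 1
    · ext x c d; simp [G]
    · ext x v; simp [Ω]
  · intro μ hμ
    refine key _ _ _ μ hμ h hg0 (fun x c d => ?_) (fun x v => ?_)
    · rw [hg]
    · rw [hω]; simp only [Ω]; ring
  · intro μ hμ
    refine key _ _ _ μ hμ (smoothData_of_flat (fun _ => contDiff_const) (fun _ => hθ)) rfl
      (fun x c d => ?_) (fun x v => ?_)
    · simp [G]
    · simp [Ω]
  · intro μ hμ
    refine key _ _ _ μ hμ ⟨fun c d => contDiff_const.add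
      ((hR c d).comp (contDiff_const.prodMk contDiff_id)), fun x c d => by rw [minkM_comm, hRs],
      fun _ => contDiff_const, fun _ => isAlt_zero⟩ (by ext c d; simp [hR00])
      (fun x c d => ?_) (fun x v => ?_)
    · simp only [G]; rw [hR0]
    · simp [Ω]
  · intro μ hμ
    refine key _ _ _ μ hμ (smoothData_of_flat (fun v => (hW v).comp
      (contDiff_const.prodMk contDiff_id)) (fun _ => hWa _)) rfl (fun x c d => ?_) (fun x v => ?_)
    · simp [G]
    · simp only [Ω]; rw [hW0]; ring

theorem contDiff_vecMul (L : Mat n) : ContDiff ℝ ∞ (fun x : Pt n => x ᵥ* L) := by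
  refine contDiff_pi.2 fun c => ?_
  simp only [Matrix.vecMul, dotProduct]
  fun_prop

theorem jacM_vecMul (L : Mat n) (x : Pt n) : jacM n (fun x : Pt n => x ᵥ* L) x = L := by
  have h : HasFDerivAt (fun x : Pt n => x ᵥ* L)
      (LinearMap.toContinuousLinearMap (Matrix.vecMulLinear L)) x :=
    (LinearMap.toContinuousLinearMap (Matrix.vecMulLinear L)).hasFDerivAt
  ext a c
  change fderiv ℝ (fun x : Pt n => x ᵥ* L) x (Pi.single a 1) c = _
  rw [h.fderiv]
  change (Pi.single a 1 ᵥ* L) c = _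
  simp

/-- Equivariance under linear maps. -/
theorem val_linear_pull (T : NaturalTensor n k) {g : MetricField n} {ω : FormField n k}
    (h : SmoothData n k g ω) (h0 : 0 ∈ lorDom n g) {L : Mat n} (hL : IsUnit L.det)
    {g' : MetricField n} {ω' : FormField n k}
    (hg' : ∀ x, Matrix.of (g' x) = L * Matrix.of (g (x ᵥ* L)) * Lᵀ)
    (hω' : ∀ x, ω' x = pullComp L (ω (x ᵥ* L))) :
    Matrix.of (T.val g' ω' 0) = L * Matrix.of (T.val g ω 0) * Lᵀ := by
  ext a b
  have := val_pull T h (contDiff_vecMul L) (x := 0) (by rwa [jacM_vecMul])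
    (by rwa [Matrix.zero_vecMul]) a b
  rw [jacM_vecMul, Matrix.zero_vecMul] at this
  rw [← this]
  change T.val g' ω' 0 a b = _
  congr 1
  · ext x c d
    have h1 := congrFun (congrFun (pullTensor_eq (fun x : Pt n => x ᵥ* L) g x) c) d
    rw [jacM_vecMul, ← hg'] at h1
    exact h1.symm
  · ext x v
    rw [pullForm_eq, jacM_vecMul, hω']

theorem isUnit_det_of_isometry {L : Mat n} (hL : L * mink n * Lᵀ = mink n) : IsUnit L.det := by
  have h := congrArg Matrix.det hL
  rw [Matrix.det_mul, Matrix.det_mul, Matrix.det_transpose] at h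
  have hη : (mink n).det * (mink n).det = 1 := by
    rw [← Matrix.det_mul, mink_mul_mink, Matrix.det_one]
  refine isUnit_iff_ne_zero.2 fun h0 => ?_
  rw [h0] at h
  simp only [zero_mul] at h
  rw [← h] at hη
  simp at hη

/-- Coefficients of quadratic perturbations of the flat metric. -/
abbrev Quad (n : ℕ) := Fin (n + 1) → Fin (n + 1) → Fin (n + 1) → Fin (n + 1) → ℝ

/-- A quadratic perturbation of the flat metric. -/
noncomputable def quadMetric (n : ℕ) (Q : Quad n) : MetricField n := fun x a b =>
  minkM n a b + ∑ c, ∑ d, (1 / 2) * (Q a b c d + Q b a c d) * (x c * x d)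

theorem quadMetric_symm (Q : Quad n) (x : Pt n) (a b : Fin (n + 1)) :
    quadMetric n Q x a b = quadMetric n Q x b a := by
  unfold quadMetric
  rw [minkM_comm]
  congr 1
  exact Finset.sum_congr rfl fun c _ => Finset.sum_congr rfl fun d _ => by ring

theorem smoothData_quadMetric (Q : Quad n) :
    SmoothData n k (quadMetric n Q) (fun _ => 0) where
  smooth_metric a b := by unfold quadMetric; fun_prop
  symm := quadMetric_symm Q
  smooth_form _ := contDiff_const
  alt _ := isAlt_zero

theorem quadMetric_zero (Q : Quad n) : quadMetric n Q 0 = minkM n := by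
  ext a b; simp [quadMetric]

/-- The metric part of a scale-invariant natural tensor is linear. -/
theorem exists_metricPart {T : NaturalTensor n k} (hT : T.ScaleInv) (hk : 1 ≤ k) :
    ∃ A : Fin (n + 1) → Fin (n + 1) → Quad n →ₗ[ℝ] ℝ,
      ∀ Q i j, T.val (quadMetric n Q) (fun _ => 0) 0 i j = A i j Q := by
  refine ⟨fun i j => (fderiv ℝ (fun Q => T.val (quadMetric n Q) (fun _ => 0) 0 i j) 0 :
    Quad n →L[ℝ] ℝ), fun Q i j => ?_⟩
  refine eq_fderiv_of_homogeneous (f := fun Q => T.val (quadMetric n Q) (fun _ => 0) 0 i j)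
    ?_ ?_ Q
  · refine contDiffAt_val T (G := quadMetric n) (Ω := fun _ _ => 0) ?_ ?_ quadMetric_symm
      (fun _ _ => isAlt_zero) (zero_mem_lorDom (quadMetric_zero _)) i j
    · intro a b
      unfold quadMetric
      fun_prop
    · intro v; exact contDiff_const
  · intro s hs Q
    obtain ⟨μ, hμ, rfl⟩ : ∃ μ : ℝ, 0 < μ ∧ s = μ ^ 2 :=
      ⟨√s, Real.sqrt_pos.2 hs, (Real.sq_sqrt hs.le).symm⟩
    rw [← val_dilate hT hk (smoothData_quadMetric Q) (zero_mem_lorDom (quadMetric_zero _)) hμ]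
    congr 1
    · ext x a b
      simp only [quadMetric, Pi.smul_apply, smul_eq_mul]
      congr 1
      exact Finset.sum_congr rfl fun c _ => Finset.sum_congr rfl fun d _ => by ring
    · ext x v; simp

/-- The algebraic form part of a scale-invariant natural tensor is quadratic. -/
theorem exists_formPart {T : NaturalTensor n k} (hT : T.ScaleInv) (hk : 1 ≤ k) :
    ∃ b : Fin (n + 1) → Fin (n + 1) → FormComp n k →ₗ[ℝ] FormComp n k →ₗ[ℝ] ℝ,
      (∀ i j s t, b i j s t = b i j t s) ∧
      ∀ t i j, T.val (flat n) (fun _ => altz n k t) 0 i j = b i j t t := by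
  have hlin : ∀ v, ContDiff ℝ ∞ fun t : FormComp n k => altz n k t v := fun v => by
    simp only [altz_apply]; fun_prop
  have : ∀ i j, ∃ b : FormComp n k →ₗ[ℝ] FormComp n k →ₗ[ℝ] ℝ, (∀ s t, b s t = b t s) ∧
      ∀ t, T.val (flat n) (fun _ => altz n k t) 0 i j = b t t := by
    intro i j
    refine exists_bilin_of_homogeneous
      (f := fun t => T.val (flat n) (fun _ => altz n k t) 0 i j) ?_ ?_
    · exact contDiffAt_val T (G := fun _ => flat n) (Ω := fun t _ => altz n k t)
        (fun _ _ => contDiff_const) (fun v => (hlin v).comp contDiff_fst)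
        (fun _ _ => minkM_comm) (fun t _ => isAlt_altz t) (zero_mem_lorDom rfl) i j
    · intro s hs t
      rw [map_smul]
      exact val_dilate (ω := fun _ => altz n k t) hT hk (smoothData_of_flat
        (fun _ => contDiff_const) (fun _ => isAlt_altz t)) (zero_mem_lorDom rfl) hs i j
  choose b hb using this
  exact ⟨b, fun i j => (hb i j).1, fun t i j => (hb i j).2 t⟩

theorem diagonal_isometry {f : Fin (n + 1) → ℝ} (hf : ∀ i, f i * f i = 1) :
    Matrix.diagonal f * mink n * (Matrix.diagonal f)ᵀ = mink n := by
  rw [Matrix.diagonal_transpose, mink_eq_diagonal, Matrix.diagonal_mul_diagonal,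
    Matrix.diagonal_mul_diagonal]
  congr 1; ext i
  linear_combination eps n i * hf i

theorem pullComp_diagonal (f : Fin (n + 1) → ℝ) (t : FormComp n k) (v : Fin k → Fin (n + 1)) :
    pullComp (Matrix.diagonal f) t v = (∏ j, f (v j)) * t v := by
  unfold pullComp
  rw [Finset.sum_eq_single v]
  · simp
  · intro w _ hw
    obtain ⟨j, hj⟩ := Function.ne_iff.1 hw
    rw [Finset.prod_eq_zero (Finset.mem_univ j), zero_mul]
    exact Matrix.diagonal_apply_ne _ (Ne.symm hj)
  · simp

/-- The basis element of the space of components. -/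
abbrev basisComp (n k : ℕ) (v : Fin k → Fin (n + 1)) : FormComp n k := Pi.single v 1

theorem altz_basisComp_apply (v w : Fin k → Fin (n + 1)) (h : altz n k (basisComp n k v) w ≠ 0) :
    ∃ σ : Equiv.Perm (Fin k), w ∘ σ = v := by
  by_contra hne
  push Not at hne
  refine h ?_
  rw [altz_apply, Finset.sum_eq_zero, mul_zero]
  intro σ _
  rw [basisComp, Pi.single_eq_of_ne (hne σ), mul_zero]

theorem IsAlt.eq_zero {t : FormComp n k} (h : IsAlt n k t) {v : Fin k → Fin (n + 1)}
    (hv : ¬ Function.Injective v) : t v = 0 := by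
  obtain ⟨i, j, hij, hne⟩ := Function.not_injective_iff.1 hv
  have h1 := h v (Equiv.swap i j)
  have h2 : v ∘ Equiv.swap i j = v := by
    ext l
    simp only [Function.comp]
    rcases eq_or_ne l i with rfl | hi
    · rw [Equiv.swap_apply_left, hij]
    · rcases eq_or_ne l j with rfl | hj
      · rw [Equiv.swap_apply_right, hij]
      · rw [Equiv.swap_apply_of_ne_of_ne hi hj]
  rw [h2, Equiv.Perm.sign_swap hne] at h1
  push_cast at h1
  linarith

theorem altz_comp_perm (t : FormComp n k) (σ : Equiv.Perm (Fin k)) :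
    altz n k (fun v => t (v ∘ σ)) = ((Equiv.Perm.sign σ : ℤ) : ℝ) • altz n k t := by
  ext v
  rw [Pi.smul_apply, altz_apply, altz_apply, smul_eq_mul, mul_left_comm]
  congr 1
  rw [Finset.mul_sum, ← Equiv.sum_comp (Equiv.mulRight σ⁻¹)]
  refine Finset.sum_congr rfl fun τ _ => ?_
  have : (v ∘ (Equiv.mulRight σ⁻¹ τ)) ∘ σ = v ∘ τ := by ext j; simp
  rw [this, Equiv.coe_mulRight, Equiv.Perm.sign_mul, Equiv.Perm.sign_inv]
  push_cast
  ring

theorem altz_basisComp_comp (v : Fin k → Fin (n + 1)) (σ : Equiv.Perm (Fin k)) :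
    altz n k (basisComp n k (v ∘ σ)) =
      ((Equiv.Perm.sign σ : ℤ) : ℝ) • altz n k (basisComp n k v) := by
  have : basisComp n k v = fun w => basisComp n k (v ∘ σ) (w ∘ σ) := by
    ext w
    simp only [basisComp, Pi.single_apply, σ.surjective.injective_comp_right.eq_iff]
  rw [this, altz_comp_perm, smul_smul, sign_mul_self, one_smul]

theorem altz_basisComp_eq_zero {v : Fin k → Fin (n + 1)} (hv : ¬ Function.Injective v) :
    altz n k (basisComp n k v) = 0 := by
  ext w
  by_contra h
  obtain ⟨σ, rfl⟩ := altz_basisComp_apply v w h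
  refine h ((isAlt_altz _).eq_zero fun hw => hv ?_)
  exact hw.comp σ.injective

theorem pullComp_diagonal_altz (f : Fin (n + 1) → ℝ) (v : Fin k → Fin (n + 1)) :
    pullComp (Matrix.diagonal f) (altz n k (basisComp n k v)) =
      (∏ j, f (v j)) • altz n k (basisComp n k v) := by
  ext w
  rw [pullComp_diagonal, Pi.smul_apply, smul_eq_mul]
  by_cases h : altz n k (basisComp n k v) w = 0
  · rw [h]; simp
  · obtain ⟨σ, rfl⟩ := altz_basisComp_apply v w h
    congr 1
    exact (Equiv.prod_comp σ fun j => f (w j)).symm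

/-- The sign flip in direction `c`. -/
def flip (c : Fin (n + 1)) (i : Fin (n + 1)) : ℝ := if i = c then -1 else 1

theorem flip_mul_self (c i : Fin (n + 1)) : flip c i * flip c i = 1 := by
  unfold flip; split_ifs <;> norm_num

theorem prod_flip {v : Fin k → Fin (n + 1)} (hv : Function.Injective v) (l : Fin k) :
    ∏ j, flip (v l) (v j) = -1 := by
  rw [Finset.prod_eq_single l]
  · simp [flip]
  · intro j _ hj
    simp [flip, hv.eq_iff, hj]
  · simp

/-- The linear form part of a scale-invariant natural tensor vanishes. -/
theorem linear_formPart_eq_zero {T : NaturalTensor n k} (hT : T.ScaleInv) (hk : 1 ≤ k)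
    (hk1 : k ≠ 1) (hk3 : k ≠ 3) (w : (Fin k → Fin (n + 1)) → Fin (n + 1) → ℝ)
    (i j : Fin (n + 1)) :
    T.val (flat n) (fun x => altz n k fun v => ∑ c, w v c * x c) 0 i j = 0 := by
  let F : ((Fin k → Fin (n + 1)) → Fin (n + 1) → ℝ) → FormField n k :=
    fun w x => altz n k fun v => ∑ c, w v c * x c
  have hF : ∀ v, ContDiff ℝ ∞ fun p : ((Fin k → Fin (n + 1)) → Fin (n + 1) → ℝ) × Pt n =>
      F p.1 p.2 v := fun v => by
    simp only [F, altz_apply]; fun_prop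
  have hFd : ∀ w, SmoothData n k (flat n) (F w) := fun w =>
    smoothData_of_flat (fun v => (hF v).comp (contDiff_const.prodMk contDiff_id))
      fun _ => isAlt_altz _
  have hFs : ∀ (s : ℝ) w x, F (s • w) x = s • F w x := by
    intro s w x
    simp only [F]
    rw [← map_smul]
    congr 1; ext v
    simp only [Pi.smul_apply, smul_eq_mul, Finset.mul_sum]
    exact Finset.sum_congr rfl fun c _ => by ring
  have hFx : ∀ (s : ℝ) w x, F w (s • x) = s • F w x := by
    intro s w x
    simp only [F]
    rw [← map_smul]
    congr 1; ext v
    simp only [Pi.smul_apply, smul_eq_mul, Finset.mul_sum]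
    exact Finset.sum_congr rfl fun c _ => by ring
  set f := fun w => T.val (flat n) (F w) 0 i j with hf
  have hlin := eq_fderiv_of_homogeneous (f := f)
    (contDiffAt_val T (G := fun _ => flat n) (Ω := F) (fun _ _ => contDiff_const) hF
      (fun _ _ => minkM_comm) (fun _ _ => isAlt_altz _) (zero_mem_lorDom rfl) i j) (by
      intro s hs w
      obtain ⟨μ, hμ, rfl⟩ : ∃ μ : ℝ, 0 < μ ∧ s = μ ^ 2 :=
        ⟨√s, Real.sqrt_pos.2 hs, (Real.sq_sqrt hs.le).symm⟩
      simp only [f]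
      rw [← val_dilate hT hk (hFd w) (zero_mem_lorDom rfl) hμ]
      congr 1
      ext x v
      rw [hFs, hFx, smul_smul, sq])
  change f w = 0
  rw [hlin]
  suffices hz : (fderiv ℝ f 0 : _ →ₗ[ℝ] ℝ) = 0 from LinearMap.congr_fun hz w
  refine LinearMap.pi_ext' fun v => LinearMap.pi_ext' fun c => LinearMap.ext_ring ?_
  change fderiv ℝ f 0 (Pi.single v (Pi.single c 1)) = 0
  have hFb : ∀ x, F (Pi.single v (Pi.single c 1)) x = x c • altz n k (basisComp n k v) := by
    intro x
    simp only [F]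
    rw [← map_smul]
    congr 1; ext u
    rcases eq_or_ne u v with rfl | hu
    · simp [basisComp, Pi.single_apply]
    · simp [basisComp, hu]
  by_cases hv : Function.Injective v
  swap
  · rw [← hlin]
    simp only [f]
    rw [← val_flat_zero hT hk i j]
    congr 1
    ext x u
    rw [hFb, altz_basisComp_eq_zero hv]; simp
  obtain ⟨g, hg, hgi⟩ : ∃ g : Fin (n + 1) → ℝ, (∀ i, g i * g i = 1) ∧
      g c * (∏ l, g (v l)) * (g i * g j) = -1 := by
    rcases eq_or_ne k 2 with rfl | hk2
    · refine ⟨fun _ => -1, fun _ => by norm_num, by norm_num⟩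
    · have hcard : ({c, i, j} : Finset (Fin (n + 1))).card < (Finset.univ.image v).card := by
        rw [Finset.card_image_of_injective _ hv, Finset.card_fin]
        exact lt_of_le_of_lt Finset.card_le_three (by omega)
      obtain ⟨e, he, hne⟩ := Finset.exists_mem_notMem_of_card_lt_card hcard
      obtain ⟨l, -, rfl⟩ := Finset.mem_image.1 he
      simp only [Finset.mem_insert, Finset.mem_singleton, not_or] at hne
      refine ⟨flip (v l), flip_mul_self _, ?_⟩
      rw [prod_flip hv]
      simp [flip, Ne.symm hne.1, Ne.symm hne.2.1, Ne.symm hne.2.2]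
  have hiso := diagonal_isometry hg
  have hpull := val_linear_pull T (hFd (Pi.single v (Pi.single c 1))) (zero_mem_lorDom rfl)
    (isUnit_det_of_isometry hiso) (g' := flat n)
    (ω' := F ((g c * ∏ l, g (v l)) • Pi.single v (Pi.single c 1))) (fun x => hiso.symm) (by
      intro x
      rw [hFs, hFb, hFb]
      ext u
      rw [pullComp_diagonal]
      have := congrFun (pullComp_diagonal_altz g v) u
      rw [pullComp_diagonal] at this
      simp only [Pi.smul_apply, smul_eq_mul] at this ⊢
      rw [mul_left_comm (∏ j, g (u j)), this, Matrix.vecMul_diagonal]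
      ring)
  have h1 := congrFun (congrFun hpull i) j
  rw [Matrix.diagonal_transpose, Matrix.mul_diagonal, Matrix.diagonal_mul] at h1
  change f _ = g i * f _ * g j at h1
  rw [hlin, hlin (Pi.single v (Pi.single c 1)), map_smul, smul_eq_mul] at h1
  have h2 := hg i
  have h3 := hg j
  set X := fderiv ℝ f 0 (Pi.single v (Pi.single c 1))
  set G := g c * ∏ l, g (v l)
  have h4 : G * X * (g i * g j) = X := by
    rw [h1]; linear_combination X * g j * g j * h2 + X * h3
  have h5 : -X = X := by linear_combination h4 - X * hgi
  linarith

theorem pullComp_add (L : Mat n) (s t : FormComp n k) :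
    pullComp L (s + t) = pullComp L s + pullComp L t := by
  ext v; simp only [pullComp, Pi.add_apply, mul_add, Finset.sum_add_distrib]

theorem pullComp_altz (L : Mat n) (t : FormComp n k) :
    pullComp L (altz n k t) = altz n k (pullComp L t) := by
  ext v
  rw [altz_apply]
  simp only [pullComp_comp_perm]
  simp only [pullComp, altz_apply, Finset.mul_sum]
  rw [Finset.sum_comm]
  refine Finset.sum_congr rfl fun σ _ => Finset.sum_congr rfl fun w _ => ?_
  ring

theorem pullComp_basisComp (L : Mat n) (v u : Fin k → Fin (n + 1)) :
    pullComp L (basisComp n k v) u = ∏ j, L (u j) (v j) := by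
  simp [pullComp, basisComp, Pi.single_apply]

/-- The contraction of two tensors with a matrix in all indices. -/
noncomputable def contr (M : Mat n) : FormComp n k →ₗ[ℝ] FormComp n k →ₗ[ℝ] ℝ :=
  LinearMap.mk₂ ℝ (fun s t => ∑ v, ∑ w, (∏ j, M (v j) (w j)) * s v * t w)
    (fun s s' t => by simp only [Pi.add_apply, mul_add, add_mul, Finset.sum_add_distrib])
    (fun c s t => by
      simp only [Pi.smul_apply, smul_eq_mul, Finset.mul_sum]
      exact Finset.sum_congr rfl fun w _ => Finset.sum_congr rfl fun w _ => by ring)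
    (fun s s' t => by simp only [Pi.add_apply, mul_add, Finset.sum_add_distrib])
    (fun c s t => by
      simp only [Pi.smul_apply, smul_eq_mul, Finset.mul_sum]
      exact Finset.sum_congr rfl fun w _ => Finset.sum_congr rfl fun w _ => by ring)

theorem contr_apply (M : Mat n) (s t : FormComp n k) :
    contr M s t = ∑ v, ∑ w, (∏ j, M (v j) (w j)) * s v * t w := rfl

theorem contr_symm {M : Mat n} (hM : Mᵀ = M) (s t : FormComp n k) : contr M s t = contr M t s := by
  rw [contr_apply, contr_apply, Finset.sum_comm]
  refine Finset.sum_congr rfl fun w _ => Finset.sum_congr rfl fun w' _ => ?_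
  have : ∀ a b, M a b = M b a := fun a b => congrFun (congrFun hM b) a
  rw [Finset.prod_congr rfl fun j _ => this (w' j) (w j)]
  ring

theorem contr_pull {M M' J : Mat n} (h : Jᵀ * M' * J = M) (s t : FormComp n k) :
    contr M' (pullComp J s) (pullComp J t) = contr M s t := by
  have key : ∀ p q : Fin k → Fin (n + 1), ∏ j, M (p j) (q j) =
      ∑ v : Fin k → Fin (n + 1), ∑ w : Fin k → Fin (n + 1),
        (∏ j, M' (v j) (w j)) * (∏ j, J (v j) (p j)) * ∏ j, J (w j) (q j) := by
    intro p q
    simp only [← Finset.prod_mul_distrib]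
    rw [← h]
    simp only [transpose_mul_mul_apply]
    rw [Finset.prod_univ_sum]
    rw [Fintype.piFinset_univ]
    refine Finset.sum_congr rfl fun v _ => ?_
    rw [Finset.prod_univ_sum, Fintype.piFinset_univ]
    refine Finset.sum_congr rfl fun w _ => Finset.prod_congr rfl fun j _ => ?_
    ring
  simp only [contr_apply, key, pullComp]
  simp only [Finset.mul_sum, Finset.sum_mul]
  -- order of summation: `v, w, p, q` versus `p, q, v, w`
  have e1 : ∀ f : (Fin k → Fin (n + 1)) → (Fin k → Fin (n + 1)) → (Fin k → Fin (n + 1)) →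
      (Fin k → Fin (n + 1)) → ℝ,
      ∑ v, ∑ w, ∑ q, ∑ p, f v w q p = ∑ p, ∑ q, ∑ v, ∑ w, f v w q p := by
    intro f
    calc _ = ∑ v, ∑ p, ∑ w, ∑ q, f v w q p := Finset.sum_congr rfl fun v _ => by
          rw [Finset.sum_comm]
          rw [Finset.sum_congr rfl fun q _ => Finset.sum_comm]
          rw [Finset.sum_comm]
          exact Finset.sum_congr rfl fun p _ => Finset.sum_comm
      _ = ∑ p, ∑ v, ∑ q, ∑ w, f v w q p := by
          rw [Finset.sum_comm]
          exact Finset.sum_congr rfl fun p _ => Finset.sum_congr rfl fun v _ => Finset.sum_comm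
      _ = _ := Finset.sum_congr rfl fun p _ => Finset.sum_comm
  rw [e1]
  refine Finset.sum_congr rfl fun p _ => Finset.sum_congr rfl fun q _ =>
    Finset.sum_congr rfl fun v _ => Finset.sum_congr rfl fun w _ => ?_
  ring

/-- Contraction of components with the first argument. -/
def slot (n k : ℕ) (a : Fin (n + 1)) : FormComp n k →ₗ[ℝ] FormComp n (k - 1) where
  toFun t v := t (dcons k a v)
  map_add' _ _ := rfl
  map_smul' _ _ := rfl

theorem slot_apply (a : Fin (n + 1)) (t : FormComp n k) (v : Fin (k - 1) → Fin (n + 1)) :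
    slot n k a t v = t (dcons k a v) := rfl

theorem dcons_succ {α : Type*} (m : ℕ) (a : α) (v : Fin m → α) :
    dcons (m + 1) a v = Fin.cons a v := by
  ext j
  refine Fin.cases ?_ (fun i => ?_) j
  · simp [dcons]
  · simp [dcons]

theorem slot_pullComp (hk : 1 ≤ k) (L : Mat n) (t : FormComp n k) (a : Fin (n + 1)) :
    slot n k a (pullComp L t) = ∑ c, L a c • pullComp L (slot n k c t) := by
  obtain ⟨m, rfl⟩ : ∃ m, k = m + 1 := ⟨k - 1, by omega⟩
  ext v
  simp only [slot_apply, Finset.sum_apply, Pi.smul_apply, smul_eq_mul, pullComp, dcons_succ]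
  rw [← (Fin.consEquiv fun _ : Fin (m + 1) => Fin (n + 1)).sum_comp, Fintype.sum_prod_type]
  refine Finset.sum_congr rfl fun c _ => ?_
  rw [Finset.mul_sum]
  refine Finset.sum_congr rfl fun w _ => ?_
  simp only [Fin.consEquiv, Equiv.coe_fn_mk, Fin.prod_univ_succ, Fin.cons_zero, Fin.cons_succ]
  rw [mul_assoc]
  rfl

/-- The partial square of a form. -/
noncomputable def iiM (n k : ℕ) (M : Mat n) (t : FormComp n k) : Mat n :=
  Matrix.of fun a b => (1 / ((k - 1).factorial : ℝ)) * contr M (slot n k a t) (slot n k b t)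

/-- The square of a form. -/
noncomputable def sqM (n k : ℕ) (M : Mat n) (t : FormComp n k) : ℝ :=
  (1 / (k.factorial : ℝ)) * contr M t t

theorem iiInner_eq (g : MetricField n) (ω : FormField n k) (x : Pt n) :
    Matrix.of (iiInner n k g ω x) = iiM n k (ginv n g x) (ω x) := rfl

theorem scalarSq_eq (g : MetricField n) (ω : FormField n k) (x : Pt n) :
    scalarSq n k g ω x = sqM n k (ginv n g x) (ω x) := rfl

theorem sqM_pull {M M' J : Mat n} (h : Jᵀ * M' * J = M) (t : FormComp n k) :
    sqM n k M' (pullComp J t) = sqM n k M t := by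
  rw [sqM, contr_pull h, sqM]

theorem iiM_pull (hk : 1 ≤ k) {M M' J : Mat n} (h : Jᵀ * M' * J = M) (t : FormComp n k) :
    iiM n k M' (pullComp J t) = J * iiM n k M t * Jᵀ := by
  ext a b
  rw [mul_mul_transpose_apply]
  simp only [iiM, Matrix.of_apply, slot_pullComp hk]
  simp only [map_sum, LinearMap.sum_apply, map_smul, LinearMap.smul_apply, contr_pull h,
    smul_eq_mul, Finset.mul_sum]
  rw [Finset.sum_comm]
  refine Finset.sum_congr rfl fun c _ => Finset.sum_congr rfl fun d _ => ?_
  ring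

/-- Equivariant quadratic maps from `k`-forms to matrices. -/
structure QuadLaw (n k : ℕ) (h : FormComp n k → Mat n) : Prop where
  bilin : ∀ i j, ∃ b : FormComp n k →ₗ[ℝ] FormComp n k →ₗ[ℝ] ℝ,
    (∀ s t, b s t = b t s) ∧ ∀ t, h t i j = b t t
  alt : ∀ t, h (altz n k t) = h t
  equivariant : ∀ L : Mat n, L * mink n * Lᵀ = mink n → ∀ t, h (pullComp L t) = L * h t * Lᵀ

theorem isometry_transpose {L : Mat n} (hL : L * mink n * Lᵀ = mink n) :
    Lᵀ * mink n * L = mink n := by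
  have h1 : L * (mink n * Lᵀ * mink n) = 1 := by
    rw [← mul_assoc, ← mul_assoc, hL, mink_mul_mink]
  have h2 := mul_eq_one_comm.1 h1
  calc Lᵀ * mink n * L = (mink n * mink n) * (Lᵀ * mink n * L) := by rw [mink_mul_mink, one_mul]
    _ = mink n * (mink n * Lᵀ * mink n * L) := by simp only [mul_assoc]
    _ = mink n := by rw [h2, mul_one]

theorem altz_altz (t : FormComp n k) : altz n k (altz n k t) = altz n k t :=
  altz_of_isAlt (isAlt_altz t)

theorem quadLaw_ii (hk : 1 ≤ k) :
    QuadLaw n k fun t => iiM n k (mink n) (altz n k t) where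
  bilin i j := by
    refine ⟨(1 / ((k - 1).factorial : ℝ) / 2) •
      ((contr (mink n)).compl₁₂ (slot n k i ∘ₗ altz n k) (slot n k j ∘ₗ altz n k) +
      (contr (mink n)).compl₁₂ (slot n k j ∘ₗ altz n k) (slot n k i ∘ₗ altz n k)), ?_, ?_⟩
    · intro s t
      simp only [LinearMap.smul_apply, LinearMap.add_apply, LinearMap.compl₁₂_apply,
        LinearMap.comp_apply, smul_eq_mul]
      rw [contr_symm (mink_transpose n) (slot n k i (altz n k s)),
        contr_symm (mink_transpose n) (slot n k j (altz n k s)), add_comm]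
    · intro t
      simp only [LinearMap.smul_apply, LinearMap.add_apply, LinearMap.compl₁₂_apply,
        LinearMap.comp_apply, smul_eq_mul, iiM, Matrix.of_apply]
      rw [contr_symm (mink_transpose n) (slot n k j (altz n k t))]
      ring
  alt t := by rw [altz_altz]
  equivariant L hL t := by rw [← pullComp_altz, iiM_pull hk (isometry_transpose hL)]

theorem quadLaw_sq : QuadLaw n k fun t => sqM n k (mink n) (altz n k t) • mink n where
  bilin i j := by
    refine ⟨(minkM n i j * (1 / (k.factorial : ℝ))) •
      (contr (mink n)).compl₁₂ (altz n k) (altz n k), ?_, ?_⟩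
    · intro s t
      simp only [LinearMap.smul_apply, LinearMap.compl₁₂_apply]
      rw [contr_symm (mink_transpose n)]
    · intro t
      simp only [LinearMap.smul_apply, LinearMap.compl₁₂_apply, smul_eq_mul, sqM,
        Matrix.smul_apply, Matrix.of_apply]
      ring
  alt t := by rw [altz_altz]
  equivariant L hL t := by
    rw [← pullComp_altz, sqM_pull (isometry_transpose hL), mul_smul_comm, smul_mul_assoc, hL]

theorem QuadLaw.sub_smul {h h' : FormComp n k → Mat n} (hh : QuadLaw n k h)
    (hh' : QuadLaw n k h') (c : ℝ) : QuadLaw n k fun t => h t - c • h' t where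
  bilin i j := by
    obtain ⟨b, hb, hbt⟩ := hh.bilin i j
    obtain ⟨b', hb', hbt'⟩ := hh'.bilin i j
    refine ⟨b - c • b', fun s t => ?_, fun t => ?_⟩
    · simp only [LinearMap.sub_apply, LinearMap.smul_apply, hb s t, hb' s t]
    · simp only [LinearMap.sub_apply, LinearMap.smul_apply, Matrix.sub_apply, Matrix.smul_apply,
        hbt, hbt']
  alt t := by rw [hh.alt, hh'.alt]
  equivariant L hL t := by
    rw [hh.equivariant L hL, hh'.equivariant L hL, mul_sub, sub_mul, mul_smul_comm,
      smul_mul_assoc]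

theorem exists_perm_of_subset {v w : Fin k → Fin (n + 1)} (hv : Function.Injective v)
    (h : ∀ m, ∃ l, w l = v m) : ∃ σ : Equiv.Perm (Fin k), w ∘ σ = v := by
  choose s hs using h
  have hinj : Function.Injective s := fun a b hab => hv (by rw [← hs a, ← hs b, hab])
  exact ⟨Equiv.ofBijective s (Finite.injective_iff_bijective.1 hinj), funext hs⟩

theorem altz_basisComp_self {v : Fin k → Fin (n + 1)} (hv : Function.Injective v) :
    altz n k (basisComp n k v) v = 1 / (k.factorial : ℝ) := by
  rw [altz_apply, Finset.sum_eq_single 1]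
  · simp [basisComp]
  · intro σ _ hσ
    have : v ∘ σ ≠ v := fun h => hσ (by
      ext m
      exact congrArg Fin.val (hv (congrFun h m)))
    simp [basisComp, this]
  · simp

theorem altz_basisComp_comp_sq (v w : Fin k → Fin (n + 1))
    (h : altz n k (basisComp n k v) w ≠ 0) : ∏ j, eps n (w j) = ∏ j, eps n (v j) := by
  obtain ⟨σ, rfl⟩ := altz_basisComp_apply v w h
  exact (Equiv.prod_comp σ fun j => eps n (w j)).symm

theorem contr_mink (s t : FormComp n k) :
    contr (mink n) s t = ∑ v, (∏ j, eps n (v j)) * s v * t v := by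
  rw [contr_apply]
  refine Finset.sum_congr rfl fun v _ => ?_
  rw [Finset.sum_eq_single v]
  · simp [minkM]
  · intro w _ hw
    obtain ⟨j, hj⟩ := Function.ne_iff.1 hw
    rw [Finset.prod_eq_zero (Finset.mem_univ j), zero_mul, zero_mul]
    simp [minkM, Ne.symm hj]
  · simp

theorem sqM_basisComp_ne_zero {v : Fin k → Fin (n + 1)} (hv : Function.Injective v) :
    sqM n k (mink n) (altz n k (basisComp n k v)) ≠ 0 := by
  have hE : ∏ j, eps n (v j) ≠ 0 := Finset.prod_ne_zero_iff.2 fun j _ => eps_ne_zero _ _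
  rw [sqM, contr_mink]
  have : ∀ w, (∏ j, eps n (w j)) * altz n k (basisComp n k v) w * altz n k (basisComp n k v) w =
      (∏ j, eps n (v j)) * (altz n k (basisComp n k v) w) ^ 2 := by
    intro w
    by_cases h : altz n k (basisComp n k v) w = 0
    · rw [h]; ring
    · rw [altz_basisComp_comp_sq v w h]; ring
  simp only [this, ← Finset.mul_sum]
  refine mul_ne_zero (by positivity) (mul_ne_zero hE (ne_of_gt ?_))
  refine Finset.sum_pos' (fun w _ => sq_nonneg _) ⟨v, Finset.mem_univ v, ?_⟩
  rw [altz_basisComp_self hv]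
  positivity

/-- A quadratic law is invariant under isometries preserving a coordinate subspace. -/
theorem QuadLaw.stabilizer {h : FormComp n k → Mat n} (hh : QuadLaw n k h)
    {v : Fin k → Fin (n + 1)} (hv : Function.Injective v) {L : Mat n}
    (hL : L * mink n * Lᵀ = mink n) (hLv : ∀ a m, L a (v m) ≠ 0 → ∃ l, v l = a) :
    h (basisComp n k v) = L * h (basisComp n k v) * Lᵀ := by
  set t := altz n k (basisComp n k v) with ht
  have hk0 : (k.factorial : ℝ) ≠ 0 := by positivity
  obtain ⟨c, hc⟩ : ∃ c : ℝ, pullComp L t = c • t := by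
    refine ⟨k.factorial * pullComp L t v, ?_⟩
    have halt : IsAlt n k (pullComp L t) := (isAlt_altz _).pullComp L
    ext u
    rw [Pi.smul_apply, smul_eq_mul]
    by_cases hu : ∃ σ : Equiv.Perm (Fin k), v ∘ σ = u
    · obtain ⟨σ, rfl⟩ := hu
      have h1 : t (v ∘ σ) = _ := isAlt_altz (basisComp n k v) v σ
      rw [halt v σ, h1, altz_basisComp_self hv]
      field_simp
    · have e1 : t u = 0 := by
        by_contra hne
        obtain ⟨σ, hσ⟩ := altz_basisComp_apply v u hne
        refine hu ⟨σ⁻¹, ?_⟩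
        rw [← hσ]; ext m; simp
      rw [e1, mul_zero]
      by_contra hne
      have huinj : Function.Injective u := by
        by_contra hni
        exact hne (halt.eq_zero hni)
      rw [ht, pullComp_altz, altz_apply] at hne
      obtain ⟨σ, -, hσ⟩ := Finset.exists_ne_zero_of_sum_ne_zero (right_ne_zero_of_mul hne)
      have h2 := right_ne_zero_of_mul hσ
      rw [pullComp_basisComp] at h2
      refine hu (exists_perm_of_subset huinj fun m => ?_)
      have h3 := Finset.prod_ne_zero_iff.1 h2 (σ⁻¹ m) (Finset.mem_univ _)
      refine hLv _ (σ⁻¹ m) ?_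
      simpa using h3
  have hsq : c ^ 2 = 1 := by
    have h1 := sqM_pull (k := k) (isometry_transpose hL) t
    rw [hc] at h1
    simp only [sqM, map_smul, LinearMap.smul_apply, smul_eq_mul] at h1
    have h2 := sqM_basisComp_ne_zero hv
    rw [← ht, sqM] at h2
    have h3 : (c ^ 2 - 1) * (1 / (k.factorial : ℝ) * contr (mink n) t t) = 0 := by
      linear_combination h1
    rcases mul_eq_zero.1 h3 with h4 | h4
    · linarith
    · exact absurd h4 h2
  rw [← hh.alt, ← ht, ← hh.equivariant L hL, hc]
  ext i j
  obtain ⟨b, -, hb⟩ := hh.bilin i j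
  rw [hb, hb, map_smul, map_smul, LinearMap.smul_apply, smul_smul, ← sq, hsq, one_smul]

/-- A rotation or boost in the plane spanned by two coordinate directions. -/
noncomputable def planeIso (n : ℕ) (i j : Fin (n + 1)) (p r : ℝ) : Mat n := Matrix.of fun a =>
  if a = i then Pi.single i p + Pi.single j (-(eps n i * eps n j * r))
  else if a = j then Pi.single i r + Pi.single j p else Pi.single a 1

theorem planeIso_isometry {i j : Fin (n + 1)} (hij : i ≠ j) {p r : ℝ}
    (hpr : p ^ 2 + eps n i * eps n j * r ^ 2 = 1) :
    planeIso n i j p r * mink n * (planeIso n i j p r)ᵀ = mink n := by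
  have hi := eps_mul_eps n i
  have hj := eps_mul_eps n j
  ext a b
  have e : (planeIso n i j p r * mink n * (planeIso n i j p r)ᵀ) a b =
      ∑ c, planeIso n i j p r a c * eps n c * planeIso n i j p r b c := by
    rw [mink_eq_diagonal, Matrix.mul_apply]
    exact Finset.sum_congr rfl fun c _ => by rw [Matrix.mul_diagonal, Matrix.transpose_apply]
  rw [e]
  have hji := Ne.symm hij
  simp only [planeIso, Matrix.of_apply, minkM]
  by_cases hai : a = i
  · subst hai
    by_cases hbi : b = a
    · subst hbi
      simp [Pi.single_apply, add_mul, mul_add, Finset.sum_add_distrib, hij, hji]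
      linear_combination eps n b * hpr + eps n b * eps n b * eps n j * r ^ 2 * hj
    · by_cases hbj : b = j
      · subst hbj
        simp [Pi.single_apply, add_mul, mul_add, Finset.sum_add_distrib, hij, hji]
        linear_combination -(p * r * eps n a) * hj
      · simp [Pi.single_apply, add_mul, hbi, hbj, Ne.symm hbi]
  · by_cases haj : a = j
    · subst haj
      by_cases hbi : b = i
      · subst hbi
        simp [Pi.single_apply, add_mul, mul_add, Finset.sum_add_distrib, hij, hji]
        linear_combination -(p * r * eps n b) * hj
      · by_cases hbj : b = a
        · subst hbj
          simp [Pi.single_apply, add_mul, mul_add, Finset.sum_add_distrib, hij, hji]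
          linear_combination eps n b * hpr - eps n i * r ^ 2 * hj
        · simp [Pi.single_apply, hbi, hbj, hji, Ne.symm hbj]
    · by_cases hbi : b = i
      · subst hbi
        simp [Pi.single_apply, hai, haj]
      · by_cases hbj : b = j
        · subst hbj
          simp [Pi.single_apply, hai, haj, hji]
        · simp [Pi.single_apply, hai, haj, hbi, hbj]
          by_cases h : a = b
          · simp [h]
          · simp [h, Ne.symm h]

theorem exists_plane_params (i j : Fin (n + 1)) :
    ∃ p r : ℝ, p ≠ 0 ∧ r ≠ 0 ∧ p ^ 2 + eps n i * eps n j * r ^ 2 = 1 := by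
  have h : eps n i * eps n j = 1 ∨ eps n i * eps n j = -1 := by
    unfold eps; split_ifs <;> norm_num
  rcases h with h | h
  · exact ⟨4 / 5, 3 / 5, by norm_num, by norm_num, by rw [h]; norm_num⟩
  · exact ⟨5 / 4, 3 / 4, by norm_num, by norm_num, by rw [h]; norm_num⟩

theorem planeIso_apply (i j : Fin (n + 1)) (p r : ℝ) (a b : Fin (n + 1)) :
    planeIso n i j p r a b = if a = i then (if b = i then p else 0) +
      (if b = j then -(eps n i * eps n j * r) else 0)
    else if a = j then (if b = i then r else 0) + (if b = j then p else 0)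
    else if b = a then 1 else 0 := by
  simp only [planeIso, Matrix.of_apply]
  split_ifs <;> simp_all

/-- The value of a quadratic law at a basis element. -/
theorem QuadLaw.apply_basisComp {h : FormComp n k → Mat n} (hh : QuadLaw n k h)
    {v : Fin k → Fin (n + 1)} (hv : Function.Injective v) :
    ∃ α β : ℝ, ∀ i j, h (basisComp n k v) i j =
      if i = j then eps n i * (if ∃ l, v l = i then α else β) else 0 := by
  classical
  set C := h (basisComp n k v) with hC
  have hoff : ∀ i j, i ≠ j → C i j = 0 := by
    intro i j hij
    have h1 := congrFun (congrFun (hh.stabilizer hv (diagonal_isometry (flip_mul_self i))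
      (fun a m ham => ⟨m, by
        by_contra hne
        exact ham (Matrix.diagonal_apply_ne _ (Ne.symm hne))⟩)) i) j
    rw [Matrix.diagonal_transpose, Matrix.mul_diagonal, Matrix.diagonal_mul, ← hC] at h1
    simp [flip, Ne.symm hij] at h1
    linarith
  have hdiag : ∀ i j, i ≠ j → ((∃ l, v l = i) ↔ ∃ l, v l = j) →
      eps n i * C i i = eps n j * C j j := by
    intro i j hij hiff
    obtain ⟨p, r, hp, hr, hpr⟩ := exists_plane_params (n := n) i j
    have h1 := congrFun (congrFun (hh.stabilizer hv (planeIso_isometry hij hpr)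
      (fun a m ham => by
        rw [planeIso_apply] at ham
        by_cases hai : a = i
        · rw [if_pos hai] at ham
          rw [hai]
          by_cases hm : v m = i
          · exact ⟨m, hm⟩
          · by_cases hm' : v m = j
            · exact hiff.2 ⟨m, hm'⟩
            · simp [hm, hm'] at ham
        · rw [if_neg hai] at ham
          by_cases haj : a = j
          · rw [if_pos haj] at ham
            rw [haj]
            by_cases hm : v m = i
            · exact hiff.1 ⟨m, hm⟩
            · by_cases hm' : v m = j
              · exact ⟨m, hm'⟩
              · simp [hm, hm'] at ham
          · rw [if_neg haj] at ham
            exact ⟨m, by by_contra hne; simp [hne] at ham⟩)) i) i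
    have hCd : C = Matrix.diagonal fun a => C a a := by
      ext a b
      by_cases hab : a = b
      · subst hab; simp
      · rw [hoff a b hab, Matrix.diagonal_apply_ne _ hab]
    rw [← hC, hCd] at h1
    rw [Matrix.mul_apply] at h1
    simp only [Matrix.mul_diagonal, Matrix.transpose_apply, planeIso_apply] at h1
    simp [add_mul, mul_add, Finset.sum_add_distrib, hij, Ne.symm hij] at h1
    have hi := eps_mul_eps n i
    have hj := eps_mul_eps n j
    have h2 : r ^ 2 * (eps n i * eps n j * C i i - C j j) = 0 := by
      linear_combination h1 + hpr * C i i + r ^ 2 * C j j * (eps n j * eps n j * hi + hj)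
    have h3 := (mul_eq_zero.1 h2).resolve_left (pow_ne_zero 2 hr)
    linear_combination eps n j * h3 - eps n i * C i i * hj
  have hval : ∀ S : Fin (n + 1) → Prop, (∀ i j, S i → S j → ((∃ l, v l = i) ↔ ∃ l, v l = j)) →
      ∃ α, ∀ i, S i → C i i = eps n i * α := by
    intro S hS
    by_cases he : ∃ i, S i
    · obtain ⟨i, hi⟩ := he
      refine ⟨eps n i * C i i, fun j hj => ?_⟩
      have hjj := eps_mul_eps n j
      by_cases hij : i = j
      · subst hij; linear_combination -C i i * hjj
      · rw [hdiag i j hij (hS i j hi hj)]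
        linear_combination -C j j * hjj
    · exact ⟨0, fun i hi => absurd ⟨i, hi⟩ he⟩
  obtain ⟨α, hα⟩ := hval (fun i => ∃ l, v l = i) fun i j hi hj => ⟨fun _ => hj, fun _ => hi⟩
  obtain ⟨β, hβ⟩ := hval (fun i => ¬ ∃ l, v l = i)
    fun i j hi hj => ⟨fun h => absurd h hi, fun h => absurd h hj⟩
  refine ⟨α, β, fun i j => ?_⟩
  by_cases hij : i = j
  · subst hij
    rw [if_pos rfl]
    by_cases hi : ∃ l, v l = i
    · rw [if_pos hi, hα i hi]
    · rw [if_neg hi, hβ i hi]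
  · rw [if_neg hij, hoff i j hij]

theorem QuadLaw.smul {h : FormComp n k → Mat n} (hh : QuadLaw n k h) (c : ℝ) (t : FormComp n k) :
    h (c • t) = c ^ 2 • h t := by
  ext i j
  obtain ⟨b, -, hb⟩ := hh.bilin i j
  rw [Matrix.smul_apply, hb, hb, map_smul, map_smul, LinearMap.smul_apply, smul_eq_mul,
    smul_eq_mul, smul_eq_mul]
  ring

theorem polarization {V : Type*} [AddCommGroup V] [Module ℝ V] {b : V →ₗ[ℝ] V →ₗ[ℝ] ℝ}
    (hb : ∀ s t, b s t = b t s) (s t : V) :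
    b s t = (b (s + t) (s + t) - b s s - b t t) / 2 := by
  simp only [map_add, LinearMap.add_apply, hb t s]
  ring

theorem QuadLaw.bilin_altz {h : FormComp n k → Mat n} (hh : QuadLaw n k h) {i j : Fin (n + 1)}
    {b : FormComp n k →ₗ[ℝ] FormComp n k →ₗ[ℝ] ℝ} (hb : ∀ s t, b s t = b t s)
    (hbt : ∀ t, h t i j = b t t) (s t : FormComp n k) :
    b (altz n k s) (altz n k t) = b s t := by
  have key : ∀ s, b (altz n k s) (altz n k s) = b s s := fun s => by rw [← hbt, ← hbt, hh.alt]
  rw [polarization hb, polarization hb s t, key, key, ← map_add, key]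

theorem QuadLaw.bilin_flip {h : FormComp n k → Mat n} (hh : QuadLaw n k h) {i j : Fin (n + 1)}
    {b : FormComp n k →ₗ[ℝ] FormComp n k →ₗ[ℝ] ℝ} (hb : ∀ s t, b s t = b t s)
    (hbt : ∀ t, h t i j = b t t) (c : Fin (n + 1)) (s t : FormComp n k) :
    b (pullComp (Matrix.diagonal (flip c)) s) (pullComp (Matrix.diagonal (flip c)) t) =
      flip c i * flip c j * b s t := by
  have key : ∀ s, b (pullComp (Matrix.diagonal (flip c)) s)
      (pullComp (Matrix.diagonal (flip c)) s) = flip c i * flip c j * b s s := fun s => by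
    rw [← hbt, ← hbt, hh.equivariant _ (diagonal_isometry (flip_mul_self c)),
      Matrix.diagonal_transpose, Matrix.mul_diagonal, Matrix.diagonal_mul]
    ring
  rw [polarization hb, polarization hb s t, key, key, ← pullComp_add, key]
  ring

theorem pullComp_planeIso {v : Fin k → Fin (n + 1)} (hv : Function.Injective v) (l : Fin k)
    {j : Fin (n + 1)} (hj : ∀ m, v m ≠ j) (p r : ℝ) :
    pullComp (planeIso n (v l) j p r) (basisComp n k v) =
      p • basisComp n k v + r • basisComp n k (Function.update v l j) := by
  have hcol : ∀ a, planeIso n (v l) j p r a (v l) =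
      if a = v l then p else if a = j then r else 0 := by
    intro a
    rw [planeIso_apply]
    by_cases ha : a = v l
    · simp [ha, hj l]
    · by_cases ha' : a = j
      · simp [ha', Ne.symm (hj l), hj l]
      · simp [ha, ha', Ne.symm ha]
  have hcol' : ∀ m, m ≠ l → ∀ a, planeIso n (v l) j p r a (v m) = if a = v m then 1 else 0 := by
    intro m hm a
    have h1 : v m ≠ v l := fun h => hm (hv h)
    rw [planeIso_apply]
    by_cases ha : a = v l
    · simp [ha, hj m, h1, Ne.symm h1]
    · by_cases ha' : a = j
      · simp [ha', Ne.symm (hj l), hj m, h1, Ne.symm (hj m)]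
      · simp [ha, ha', eq_comm]
  ext u
  rw [pullComp_basisComp]
  simp only [Pi.add_apply, Pi.smul_apply, smul_eq_mul, basisComp, Pi.single_apply]
  rw [← Finset.mul_prod_erase _ _ (Finset.mem_univ l), hcol]
  by_cases hu : ∀ m, m ≠ l → u m = v m
  · rw [Finset.prod_eq_one fun m hm => by
      rw [hcol' m (Finset.ne_of_mem_erase hm), if_pos (hu m (Finset.ne_of_mem_erase hm))], mul_one]
    have e1 : u = v ↔ u l = v l := ⟨fun h => by rw [h], fun h => funext fun m => by
      by_cases hm : m = l
      · rw [hm, h]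
      · exact hu m hm⟩
    have e2 : u = Function.update v l j ↔ u l = j := ⟨fun h => by rw [h]; simp, fun h =>
      funext fun m => by
        by_cases hm : m = l
        · rw [hm, h]; simp
        · rw [hu m hm]; simp [hm]⟩
    simp only [e1, e2]
    by_cases h1 : u l = v l
    · simp [h1, hj l]
    · simp [h1]
  · push Not at hu
    obtain ⟨m, hm, hne⟩ := hu
    rw [Finset.prod_eq_zero (Finset.mem_erase.2 ⟨hm, Finset.mem_univ m⟩)
      (by rw [hcol' m hm, if_neg hne]), mul_zero, if_neg (fun h => hne (by rw [h])),
      if_neg (fun h => hne (by rw [h]; simp [hm]))]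
    ring

theorem QuadLaw.exchange {h : FormComp n k → Mat n} (hh : QuadLaw n k h)
    {v : Fin k → Fin (n + 1)} (hv : Function.Injective v) (l : Fin k)
    {j : Fin (n + 1)} (hj : ∀ m, v m ≠ j) (h0 : h (basisComp n k v) = 0)
    {a c : Fin (n + 1)} {b : FormComp n k →ₗ[ℝ] FormComp n k →ₗ[ℝ] ℝ}
    (hb : ∀ s t, b s t = b t s) (hbt : ∀ t, h t a c = b t t) :
    h (basisComp n k (Function.update v l j)) a c = 0 ∧
      b (basisComp n k v) (basisComp n k (Function.update v l j)) = 0 := by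
  obtain ⟨p, r, hp, hr, hpr⟩ := exists_plane_params (n := n) (v l) j
  set e := basisComp n k v
  set e' := basisComp n k (Function.update v l j)
  have key : ∀ r, p ^ 2 + eps n (v l) * eps n j * r ^ 2 = 1 →
      2 * p * r * b e e' + r ^ 2 * b e' e' = 0 := by
    intro r hpr
    have h1 := hh.equivariant _ (planeIso_isometry (hj l) hpr) e
    rw [h0, mul_zero, zero_mul, pullComp_planeIso hv l hj] at h1
    have h2 := congrFun (congrFun h1 a) c
    have h3 := congrFun (congrFun h0 a) c
    rw [hbt] at h2 h3
    simp only [map_add, map_smul, LinearMap.add_apply, LinearMap.smul_apply, smul_eq_mul,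
      Matrix.zero_apply] at h2 h3
    linear_combination h2 - p ^ 2 * h3 - p * r * hb e' e
  have h1 := key r hpr
  have h2 := key (-r) (by rw [neg_sq]; exact hpr)
  have h3 : r ^ 2 * b e' e' = 0 := by linear_combination (h1 + h2) / 2
  have h4 : p * r * b e e' = 0 := by linear_combination (h1 - h2) / 4
  exact ⟨by rw [hbt]; exact (mul_eq_zero.1 h3).resolve_left (pow_ne_zero 2 hr),
    (mul_eq_zero.1 h4).resolve_left (mul_ne_zero hp hr)⟩

theorem QuadLaw.basisComp_comp {h : FormComp n k → Mat n} (hh : QuadLaw n k h)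
    (v : Fin k → Fin (n + 1)) (σ : Equiv.Perm (Fin k)) :
    h (basisComp n k (v ∘ σ)) = h (basisComp n k v) := by
  rw [← hh.alt, altz_basisComp_comp, hh.smul, hh.alt, sq, sign_mul_self, one_smul]

theorem update_injective {v : Fin k → Fin (n + 1)} (hv : Function.Injective v) (l : Fin k)
    {j : Fin (n + 1)} (hj : ∀ m, v m ≠ j) : Function.Injective (Function.update v l j) := by
  intro a b hab
  by_cases ha : a = l
  · by_cases hb : b = l
    · rw [ha, hb]
    · subst ha; simp [hb] at hab; exact absurd hab.symm (hj b)
  · by_cases hb : b = l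
    · subst hb; simp [ha] at hab; exact absurd hab (hj a)
    · simp [ha, hb] at hab; exact hv hab

theorem QuadLaw.basisComp_eq_zero {h : FormComp n k → Mat n} (hh : QuadLaw n k h)
    {v₀ : Fin k → Fin (n + 1)} (hv₀ : Function.Injective v₀) (h0 : h (basisComp n k v₀) = 0)
    {v : Fin k → Fin (n + 1)} (hv : Function.Injective v) : h (basisComp n k v) = 0 := by
  classical
  obtain ⟨m, hm⟩ : ∃ m, (Finset.univ.filter fun l => ∀ l', v₀ l' ≠ v l).card = m := ⟨_, rfl⟩
  induction m generalizing v with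
  | zero =>
    rw [Finset.card_eq_zero, Finset.filter_eq_empty_iff] at hm
    obtain ⟨σ, hσ⟩ := exists_perm_of_subset (w := v₀) hv fun l => by
      simpa using hm (Finset.mem_univ l)
    rw [← hσ, hh.basisComp_comp, h0]
  | succ m ih =>
    obtain ⟨l, hl⟩ : ∃ l, ∀ l', v₀ l' ≠ v l := by
      have hpos : 0 < m + 1 := Nat.succ_pos m
      rw [← hm, Finset.card_pos] at hpos
      obtain ⟨l, hl⟩ := hpos
      exact ⟨l, (Finset.mem_filter.1 hl).2⟩
    obtain ⟨l', hl'⟩ : ∃ l', ∀ m, v m ≠ v₀ l' := by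
      by_contra hne
      push Not at hne
      obtain ⟨σ, hσ⟩ := exists_perm_of_subset (w := v) hv₀ hne
      exact hl (σ⁻¹ l) (by rw [← hσ]; simp)
    have hw := update_injective hv l hl'
    have hcard : (Finset.univ.filter fun q => ∀ l'', v₀ l'' ≠
        Function.update v l (v₀ l') q) = (Finset.univ.filter fun q => ∀ l', v₀ l' ≠ v q).erase l := by
      ext q
      by_cases hq : q = l
      · subst hq; simp
      · simp [hq]
    have h1 := ih hw (by
      rw [hcard, Finset.card_erase_of_mem (by simpa using hl), hm, Nat.add_sub_cancel])
    have hj : ∀ q, Function.update v l (v₀ l') q ≠ v l := by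
      intro q
      by_cases hq : q = l
      · subst hq; simpa using hl l'
      · simpa [hq] using fun h => hq (hv h)
    ext a c
    obtain ⟨b, hb, hbt⟩ := hh.bilin a c
    have h2 := (hh.exchange hw l hj h1 hb hbt).1
    rwa [Function.update_idem, Function.update_eq_self] at h2

theorem QuadLaw.eq_zero {h : FormComp n k → Mat n} (hh : QuadLaw n k h)
    {v₀ : Fin k → Fin (n + 1)} (hv₀ : Function.Injective v₀) (h0 : h (basisComp n k v₀) = 0)
    (t : FormComp n k) : h t = 0 := by
  ext i j
  obtain ⟨b, hb, hbt⟩ := hh.bilin i j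
  suffices hz : b = 0 by rw [hbt, hz]; rfl
  have hperm : ∀ (s : FormComp n k) w (σ : Equiv.Perm (Fin k)), b s (basisComp n k w) = 0 →
      b s (basisComp n k (w ∘ σ)) = 0 := by
    intro s w σ hs
    rw [← hh.bilin_altz hb hbt, altz_basisComp_comp, map_smul, hh.bilin_altz hb hbt, hs, smul_zero]
  have hflip : ∀ c v w, (∏ m, flip c (v m)) * (∏ m, flip c (w m)) *
      b (basisComp n k v) (basisComp n k w) =
      flip c i * flip c j * b (basisComp n k v) (basisComp n k w) := by
    intro c v w
    rw [← hh.bilin_flip hb hbt, ← hh.bilin_altz hb hbt (pullComp _ _), ← pullComp_altz,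
      ← pullComp_altz, pullComp_diagonal_altz, pullComp_diagonal_altz, map_smul, map_smul,
      LinearMap.smul_apply, hh.bilin_altz hb hbt, smul_eq_mul, smul_eq_mul]
    ring
  have key : ∀ v w, b (basisComp n k v) (basisComp n k w) = 0 := by
    intro v w
    by_cases hv : Function.Injective v
    swap
    · rw [← hh.bilin_altz hb hbt, altz_basisComp_eq_zero hv, map_zero, LinearMap.zero_apply]
    by_cases hw : Function.Injective w
    swap
    · rw [← hh.bilin_altz hb hbt, altz_basisComp_eq_zero hw, map_zero]
    by_cases hsub : ∀ m, ∃ l, w l = v m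
    · obtain ⟨σ, rfl⟩ := exists_perm_of_subset hv hsub
      rw [hb]
      refine hperm _ _ _ ?_
      rw [← hbt, hh.basisComp_eq_zero hv₀ h0 hw]; rfl
    push Not at hsub
    obtain ⟨m, hm⟩ := hsub
    obtain ⟨l, hl⟩ : ∃ l, ∀ q, v q ≠ w l := by
      by_contra hne
      push Not at hne
      obtain ⟨σ, hσ⟩ := exists_perm_of_subset (w := v) hw hne
      exact hm (σ⁻¹ m) (by rw [← hσ]; simp)
    by_contra hne
    have hpar : ∀ c, (∏ m, flip c (v m)) * (∏ m, flip c (w m)) = flip c i * flip c j :=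
      fun c => mul_right_cancel₀ hne (hflip c v w)
    have hout : ∀ (u : Fin k → Fin (n + 1)) c, (∀ q, u q ≠ c) → ∏ q, flip c (u q) = 1 :=
      fun u c hc => Finset.prod_eq_one fun q _ => by simp [flip, hc q]
    have h1 := hpar (v m)
    rw [prod_flip hv, hout w _ hm] at h1
    have h2 := hpar (w l)
    rw [prod_flip hw, hout v _ hl] at h2
    have hml := hl m
    have hij : (i = v m ∧ j = w l) ∨ (i = w l ∧ j = v m) := by
      simp only [flip] at h1 h2
      split_ifs at h1 h2 <;> first | linarith | simp_all
    have hrest : ∀ c, c ≠ v m → c ≠ w l → flip c i * flip c j = 1 := by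
      intro c hc hc'
      rcases hij with ⟨rfl, rfl⟩ | ⟨rfl, rfl⟩ <;> simp [flip, Ne.symm hc, Ne.symm hc']
    obtain ⟨σ, hσ⟩ := exists_perm_of_subset (w := w) (update_injective hv m hl) fun q => by
      by_cases hq : q = m
      · exact ⟨l, by rw [hq]; simp⟩
      · by_contra hno
        push Not at hno
        simp only [Function.update_of_ne hq] at hno
        have h3 := hpar (v q)
        rw [prod_flip hv, hout w _ hno, hrest _ (fun h => hq (hv h)) (hl q)] at h3
        norm_num at h3
    have h4 := (hh.exchange hv m hl (hh.basisComp_eq_zero hv₀ h0 hv) hb hbt).2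
    rw [← hσ] at h4
    refine hne ?_
    have h5 := hperm _ _ σ⁻¹ h4
    rwa [Function.comp_assoc, show (σ : Fin k → Fin k) ∘ ⇑σ⁻¹ = id from funext fun x => by simp,
      Function.comp_id] at h5
  refine (Pi.basisFun ℝ _).ext fun v => (Pi.basisFun ℝ _).ext fun w => ?_
  rw [Pi.basisFun_apply, Pi.basisFun_apply]
  exact key v w

theorem iiM_basisComp {v : Fin k → Fin (n + 1)} (hk : 1 ≤ k) (hv : Function.Injective v) :
    ∃ α : ℝ, α ≠ 0 ∧ ∀ i j, iiM n k (mink n) (altz n k (basisComp n k v)) i j =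
      if i = j then eps n i * (if ∃ l, v l = i then α else 0) else 0 := by
  obtain ⟨α, β, hαβ⟩ := (quadLaw_ii (n := n) hk).apply_basisComp hv
  obtain ⟨m, rfl⟩ : ∃ m, k = m + 1 := ⟨k - 1, by omega⟩
  set t := altz n (m + 1) (basisComp n (m + 1) v) with ht
  have hE : ∏ j, eps n (v j) ≠ 0 := Finset.prod_ne_zero_iff.2 fun j _ => eps_ne_zero _ _
  have hval : ∀ i, iiM n (m + 1) (mink n) t i i = 1 / (m.factorial : ℝ) *
      ((eps n i * ∏ j, eps n (v j)) * ∑ u : Fin m → Fin (n + 1), t (Fin.cons i u) ^ 2) := by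
    intro i
    suffices hs : contr (mink n) (slot n (m + 1) i t) (slot n (m + 1) i t) =
        (eps n i * ∏ j, eps n (v j)) * ∑ u : Fin m → Fin (n + 1), t (Fin.cons i u) ^ 2 by
      rw [iiM, Matrix.of_apply, hs]; rfl
    rw [contr_mink, Finset.mul_sum]
    refine Finset.sum_congr rfl fun (u : Fin m → Fin (n + 1)) _ => ?_
    rw [slot_apply, dcons_succ]
    by_cases h : t (Fin.cons i u) = 0
    · rw [h]; ring
    · have h1 := altz_basisComp_comp_sq v _ h
      rw [Fin.prod_univ_succ, Fin.cons_zero] at h1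
      simp only [Fin.cons_succ] at h1
      rw [← h1]
      have h2 := eps_mul_eps n i
      change (∏ j, eps n (u j)) * _ * _ = _
      linear_combination -(∏ j, eps n (u j)) * t (Fin.cons i u) ^ 2 * h2
  refine ⟨α, fun hα => ?_, fun i j => ?_⟩
  · have h1 := hαβ (v 0) (v 0)
    rw [if_pos rfl, if_pos ⟨0, rfl⟩, hα, mul_zero, hval] at h1
    have hpos : 0 < ∑ u : Fin m → Fin (n + 1), t (Fin.cons (v 0) u) ^ 2 := by
      refine Finset.sum_pos' (fun u _ => sq_nonneg _) ⟨Fin.tail v, Finset.mem_univ _, ?_⟩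
      rw [Fin.cons_self_tail, ht, altz_basisComp_self hv]
      positivity
    exact mul_ne_zero (by positivity) (mul_ne_zero (mul_ne_zero (eps_ne_zero _ _) hE)
      hpos.ne') h1
  · by_cases hi : i = j ∧ ¬ ∃ l, v l = i
    · obtain ⟨rfl, hi⟩ := hi
      rw [if_pos rfl, if_neg hi, hval, Finset.sum_eq_zero]
      · ring
      · intro u _
        by_contra hne
        obtain ⟨σ, hσ⟩ := altz_basisComp_apply v _ (fun h : t (Fin.cons i u) = 0 => hne (by
          rw [h]; ring))
        refine hi ⟨σ⁻¹ 0, ?_⟩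
        rw [← hσ]; simp
    · refine (hαβ i j).trans ?_
      by_cases hij : i = j
      · have : ∃ l, v l = i := by by_contra h; exact hi ⟨hij, h⟩
        simp only [if_pos hij, if_pos this]
      · simp only [if_neg hij]

/-- Equivariant quadratic maps from forms to matrices are combinations of the two standard ones. -/
theorem QuadLaw.classification (hk1 : 1 ≤ k) (hk2 : k ≤ n + 1) {h : FormComp n k → Mat n}
    (hh : QuadLaw n k h) : ∃ c d : ℝ, ∀ t, h t = c • iiM n k (mink n) (altz n k t) +
      d • (sqM n k (mink n) (altz n k t) • mink n) := by
  set v₀ : Fin k → Fin (n + 1) := Fin.castLE hk2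
  have hv₀ : Function.Injective v₀ := Fin.castLE_injective hk2
  obtain ⟨α, β, hαβ⟩ := hh.apply_basisComp hv₀
  obtain ⟨α', hα', hii⟩ := iiM_basisComp (n := n) hk1 hv₀
  have hs := sqM_basisComp_ne_zero hv₀
  refine ⟨(α - β) / α', β / sqM n k (mink n) (altz n k (basisComp n k v₀)), fun t => ?_⟩
  have hD := (hh.sub_smul (quadLaw_ii hk1) ((α - β) / α')).sub_smul quadLaw_sq
    (β / sqM n k (mink n) (altz n k (basisComp n k v₀)))
  have h1 := hD.eq_zero hv₀ (by
    ext i j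
    simp only [Matrix.sub_apply, Matrix.smul_apply, hαβ, hii, smul_eq_mul, Matrix.zero_apply,
      Matrix.of_apply, minkM]
    by_cases hij : i = j
    · simp only [hij, if_true]
      by_cases hj : ∃ l, v₀ l = j
      · simp only [if_pos hj]; field_simp; ring
      · simp only [if_neg hj]; field_simp; ring
    · simp [hij]) t
  rw [sub_sub, sub_eq_zero] at h1
  exact h1

/-- Decomposable quadruple tensors. -/
def dec (u v w x : Pt n) : Quad n := fun a b c d => u a * v b * w c * x d

theorem quad_functional_eq_zero {D : Quad n →ₗ[ℝ] ℝ}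
    (hab : ∀ Q : Quad n, D (fun a b c d => Q b a c d) = D Q)
    (hcd : ∀ Q : Quad n, D (fun a b c d => Q a b d c) = D Q)
    (hg : ∀ z : Quad n, (∀ a b c d, z a b c d = z a c b d) → (∀ a b c d, z a b c d = z a b d c) →
      D z = 0)
    (hp : ∀ θ : Fin (n + 1) → Fin (n + 1) → ℝ, (∀ a c, θ c a = -θ a c) →
      D (fun a b c d => θ a c * θ b d) = 0) (Q : Quad n) : D Q = 0 := by
  have h1 : ∀ u v w x : Pt n, D (dec u v w x) = D (dec v u w x) := fun u v w x => by
    rw [← hab]; congr 1; ext a b c d; simp only [dec]; ring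
  have h2 : ∀ u v w x : Pt n, D (dec u v w x) = D (dec u v x w) := fun u v w x => by
    rw [← hcd]; congr 1; ext a b c d; simp only [dec]; ring
  have h3 : ∀ u v w x : Pt n, D (dec u v w x) + D (dec u w v x) + D (dec u x v w) = 0 := by
    intro u v w x
    have := hg (dec u v w x + dec u v x w + dec u w v x + dec u w x v + dec u x v w + dec u x w v)
      (fun a b c d => by simp only [dec, Pi.add_apply]; ring)
      (fun a b c d => by simp only [dec, Pi.add_apply]; ring)
    simp only [map_add] at this
    linarith [h2 u v w x, h2 u w v x, h2 u x v w]
  have h4 : ∀ u v w x : Pt n, D (dec u v w x) - D (dec u x w v) - D (dec w v u x) +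
      D (dec w x u v) = 0 := by
    intro u v w x
    have e1 := hp (fun a c => u a * w c - w a * u c + (v a * x c - x a * v c)) fun a c => by ring
    have e2 := hp (fun a c => u a * w c - w a * u c) fun a c => by ring
    have e3 := hp (fun a c => v a * x c - x a * v c) fun a c => by ring
    have e4 : (fun a b c d => (u a * w c - w a * u c + (v a * x c - x a * v c)) *
        (u b * w d - w b * u d + (v b * x d - x b * v d)) : Quad n) =
        (fun a b c d => (u a * w c - w a * u c) * (u b * w d - w b * u d)) +
        (fun a b c d => (v a * x c - x a * v c) * (v b * x d - x b * v d)) +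
        (dec u v w x - dec u x w v - dec w v u x + dec w x u v) +
        (dec v u x w - dec x u v w - dec v w x u + dec x w v u) := by
      ext a b c d; simp only [dec, Pi.add_apply, Pi.sub_apply]; ring
    rw [e4] at e1
    simp only [map_add, map_sub] at e1
    linarith [h1 u v w x, h2 v u w x, h1 u x w v, h2 x u w v, h1 w v u x, h2 v w u x,
      h1 w x u v, h2 x w u v]
  have h5 : ∀ u v w x : Pt n, D (dec u v w x) = 0 := by
    intro u v w x
    -- write everything through the six pairings
    have a1 := h3 u v w x
    have a2 := h3 v u w x
    have a3 := h3 w x u v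
    have a4 := h3 x w u v
    have p1 := h4 u v w x
    have p2 := h4 u w v x
    linarith [h1 u v w x, h1 v w u x, h1 v x u w, h2 u x w v, h1 w u x v, h1 w v x u, h2 u w v x,
      h1 x u w v, h1 x v w u, h1 x w u v, h2 w x u v, h2 w u x v, h2 w v x u, h2 x u w v,
      h2 x v w u, h1 u w v x, h1 u x v w, h1 w v u x, h2 w v u x, h2 v w u x, h2 v x u w,
      h2 u x v w, h1 w u v x, h2 w u v x, h1 x u v w, h1 x v u w, h2 x u v w, h2 x v u w,
      h1 v u w x, h2 v u w x, h2 u v w x, h1 w x u v, h1 u x w v, h1 v w x u, h1 u w x v]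
  have h6 : Q = ∑ a, ∑ b, ∑ c, ∑ d, Q a b c d •
      dec (Pi.single a 1) (Pi.single b 1) (Pi.single c 1) (Pi.single d 1) := by
    ext a b c d
    simp [dec, Finset.sum_apply, Pi.single_apply]
  rw [h6]
  simp [h5]

/-- The quadratic coefficients symmetrized in both pairs. -/
noncomputable def symQ (Q : Quad n) : Quad n := fun a b c d =>
  (Q a b c d + Q b a c d + Q a b d c + Q b a d c) / 4

/-- The linearized Riemann tensor of a quadratic perturbation of the flat metric. -/
noncomputable def riemLin (Q : Quad n) (d b c a : Fin (n + 1)) : ℝ :=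
  symQ Q d a c b - symQ Q a b c d - symQ Q d c a b + symQ Q c b a d

/-- The linearized Ricci tensor of a quadratic perturbation of the flat metric. -/
noncomputable def ricLin (a b : Fin (n + 1)) : Quad n →ₗ[ℝ] ℝ where
  toFun Q := ∑ c, eps n c * riemLin Q c b c a
  map_add' Q Q' := by
    simp only [riemLin, symQ, Pi.add_apply, ← Finset.sum_add_distrib]
    exact Finset.sum_congr rfl fun c _ => by ring
  map_smul' r Q := by
    simp only [riemLin, symQ, Pi.smul_apply, smul_eq_mul, Finset.mul_sum, RingHom.id_apply]
    exact Finset.sum_congr rfl fun c _ => by ring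

theorem ricLin_apply (a b : Fin (n + 1)) (Q : Quad n) :
    ricLin a b Q = ∑ c, eps n c * riemLin Q c b c a := rfl

theorem ricLin_swap_left (a b : Fin (n + 1)) (Q : Quad n) :
    ricLin a b (fun a b c d => Q b a c d) = ricLin a b Q := by
  simp only [ricLin_apply, riemLin, symQ]
  exact Finset.sum_congr rfl fun c _ => by ring

theorem ricLin_swap_right (a b : Fin (n + 1)) (Q : Quad n) :
    ricLin a b (fun a b c d => Q a b d c) = ricLin a b Q := by
  simp only [ricLin_apply, riemLin, symQ]
  exact Finset.sum_congr rfl fun c _ => by ring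

theorem riemLin_gauge {z : Quad n} (h1 : ∀ a b c d, z a b c d = z a c b d)
    (h2 : ∀ a b c d, z a b c d = z a b d c) (d b c a : Fin (n + 1)) : riemLin z d b c a = 0 := by
  simp only [riemLin, symQ]
  linarith [h2 d a c b, h1 d c a b, h2 d c a b, h1 a d c b, h2 a c d b, h1 a c b d, h2 a d c b,
    h2 a b c d, h2 b a c d, h1 b c a d, h2 b c a d, h2 c d a b, h1 c a d b, h2 c a b d, h1 c b a d,
    h2 c b a d]

theorem ricLin_gauge {z : Quad n} (h1 : ∀ a b c d, z a b c d = z a c b d)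
    (h2 : ∀ a b c d, z a b c d = z a b d c) (a b : Fin (n + 1)) : ricLin a b z = 0 := by
  simp [ricLin_apply, riemLin_gauge h1 h2]

theorem ricLin_decomposable {θ : Fin (n + 1) → Fin (n + 1) → ℝ} (hθ : ∀ a c, θ c a = -θ a c)
    (a b : Fin (n + 1)) : ricLin a b (fun a b c d => θ a c * θ b d) =
      -3 * ∑ c, eps n c * (θ a c * θ b c) := by
  rw [ricLin_apply, Finset.mul_sum]
  refine Finset.sum_congr rfl fun c _ => ?_
  have h0 : θ c c = 0 := by linarith [hθ c c]
  simp only [riemLin, symQ, h0, hθ a c, hθ b c, hθ b a]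
  ring

/-- The cubic map attached to a quadruple tensor. -/
noncomputable def cubicMap (z : Quad n) (x : Pt n) : Pt n := fun e =>
  x e + eps n e * ((1 / 6) * ∑ b, ∑ c, ∑ d, z e b c d * (x b * x c * x d))

theorem contDiff_cubicMap (z : Quad n) : ContDiff ℝ ∞ (cubicMap z) := by
  unfold cubicMap
  exact contDiff_pi.2 fun e => by fun_prop

/-- The differential of the cubic map, minus the identity. -/
noncomputable def cubicJac (z : Quad n) (x : Pt n) : Mat n := Matrix.of fun a e =>
  eps n e * ((1 / 2) * ∑ c, ∑ d, z e a c d * (x c * x d))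

theorem jacM_cubicMap {z : Quad n} (h1 : ∀ a b c d, z a b c d = z a c b d)
    (h2 : ∀ a b c d, z a b c d = z a b d c) (x : Pt n) :
    jacM n (cubicMap z) x = 1 + cubicJac z x := by
  ext a e
  have hx : ∀ b, HasFDerivAt (fun x : Pt n => x b) (ContinuousLinearMap.proj (R := ℝ) b) x :=
    fun b => hasFDerivAt_apply b x
  have hd : HasFDerivAt (fun x : Pt n => cubicMap z x e) _ x :=
    (hx e).add (HasFDerivAt.const_mul (HasFDerivAt.const_mul (HasFDerivAt.fun_sum fun b _ =>
      HasFDerivAt.fun_sum fun c _ => HasFDerivAt.fun_sum fun d _ =>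
        HasFDerivAt.const_mul (((hx b).mul (hx c)).mul (hx d)) (z e b c d)) (1 / 6)) (eps n e))
  have hc : jacM n (cubicMap z) x a e = fderiv ℝ (fun x => cubicMap z x e) x (Pi.single a 1) := by
    change fderiv ℝ (cubicMap z) x (Pi.single a 1) e = _
    have h3 := (contDiff_cubicMap z).differentiable (by simp) x
    have h4 := hasFDerivAt_pi'.1 h3.hasFDerivAt e
    rw [h4.fderiv]; rfl
  rw [hc, hd.fderiv]
  simp only [cubicJac, Matrix.add_apply, Matrix.of_apply, Matrix.one_apply]
  simp [Pi.single_apply, Finset.sum_add_distrib]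
  have e1 : ∀ c d, z e c d a * (x c * x d) = z e a c d * (x c * x d) := fun c d => by
    rw [h2 e c d a, h1 e c a d]
  have e2 : ∀ c d, z e c a d * (x d * x c) = z e a c d * (x c * x d) := fun c d => by
    rw [h1 e c a d, mul_comm (x d)]
  have e3 : ∀ c d, z e a c d * (x d * x c) = z e a c d * (x c * x d) := fun c d => by
    rw [mul_comm (x d)]
  simp only [e1, e2, e3, eq_comm (a := e)]
  ring

theorem quadMetric_gauge {T : NaturalTensor n k} (hT : T.ScaleInv) (hk : 1 ≤ k)
    {z : Quad n} (h1 : ∀ a b c d, z a b c d = z a c b d)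
    (h2 : ∀ a b c d, z a b c d = z a b d c) (i j : Fin (n + 1)) :
    T.val (quadMetric n z) (fun _ => 0) 0 i j = 0 := by
  have hflat : SmoothData n k (flat n) fun _ => 0 :=
    smoothData_of_flat (fun _ => contDiff_const) fun _ => isAlt_zero
  have hJ0 : ∀ (l : ℝ) x, cubicJac z (l • x) = l ^ 2 • cubicJac z x := by
    intro l x; ext a e
    simp only [cubicJac, Matrix.of_apply, Matrix.smul_apply, Pi.smul_apply, smul_eq_mul,
      Finset.mul_sum]
    exact Finset.sum_congr rfl fun c _ => Finset.sum_congr rfl fun d _ => by ring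
  have hφ0 : cubicMap z 0 = 0 := by ext e; simp [cubicMap]
  have hJ00 : cubicJac z 0 = 0 := by ext a e; simp [cubicJac]
  have hj : jacM n (cubicMap z) 0 = 1 := by rw [jacM_cubicMap h1 h2, hJ00, add_zero]
  have hp := val_pull T hflat (contDiff_cubicMap z) (x := 0) (by rw [hj]; simp)
    (by rw [hφ0]; exact zero_mem_lorDom rfl) i j
  rw [hj, hφ0, Matrix.one_mul, Matrix.transpose_one, Matrix.mul_one, Matrix.of_apply,
    val_flat_zero hT hk] at hp
  have hform : pullForm n k (cubicMap z) (fun _ => 0) = fun _ => 0 := by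
    ext x v; simp [pullForm]
  rw [hform] at hp
  have hsm := hflat.pull (contDiff_cubicMap z)
  rw [hform] at hsm
  let R : ℝ × Pt n → Fin (n + 1) → Fin (n + 1) → ℝ := fun p =>
    cubicJac z p.2 * mink n + mink n * (cubicJac z p.2)ᵀ +
      p.1 ^ 2 • (cubicJac z p.2 * mink n * (cubicJac z p.2)ᵀ)
  have hJs : ∀ a e, ContDiff ℝ ∞ fun p : ℝ × Pt n => cubicJac z p.2 a e := fun a e => by
    simp only [cubicJac, Matrix.of_apply]; fun_prop
  have hRs : ∀ a b, ContDiff ℝ ∞ fun p => R p a b := by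
    intro a b
    simp only [R, Matrix.add_apply, Matrix.smul_apply, Matrix.mul_apply, Matrix.transpose_apply,
      smul_eq_mul]
    fun_prop
  have hRsym : ∀ p, (show Mat n from R p)ᵀ = (show Mat n from R p) := by
    intro p
    simp only [R, Matrix.transpose_add, Matrix.transpose_mul, Matrix.transpose_transpose,
      Matrix.transpose_smul, mink_transpose, mul_assoc]
    abel
  have hadd := val_additive hT hk hsm (R := R) (θ := 0) (W := fun _ => 0) hRs
    (fun p a b => congrFun (congrFun (hRsym p) b) a) isAlt_zero (fun _ => contDiff_const)
    (fun _ => isAlt_zero) (fun l x a b => by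
      have e := pullTensor_eq (cubicMap z) (flat n) (l • x)
      rw [jacM_cubicMap h1 h2, hJ0] at e
      have e2 := congrFun (congrFun e a) b
      rw [Matrix.of_apply] at e2
      rw [e2]
      change _ = mink n a b + l ^ 2 * R (l, x) a b
      have e3 : (1 + l ^ 2 • cubicJac z x) * mink n * (1 + l ^ 2 • cubicJac z x)ᵀ =
          mink n + l ^ 2 • (show Mat n from R (l, x)) := by
        simp only [R, Matrix.transpose_add, Matrix.transpose_one, Matrix.transpose_smul, add_mul,
          mul_add, one_mul, mul_one, smul_mul_assoc, mul_smul_comm, smul_add, smul_smul]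
        abel
      exact congrFun (congrFun e3 a) b)
    (fun l x v => by simp) (fun l x a b => by
      simp only [R, hJ0]
      simp [Matrix.add_apply, mul_add]) (fun l x v => by simp) i j
  have hquad : (fun x c d => minkM n c d + R (0, x) c d) = quadMetric n z := by
    ext x c d
    simp only [R, quadMetric, Matrix.add_apply, mink_eq_diagonal, Matrix.mul_diagonal,
      Matrix.diagonal_mul, Matrix.transpose_apply, cubicJac, Matrix.of_apply]
    simp only [ne_eq, OfNat.ofNat_ne_zero, not_false_eq_true, zero_pow, zero_smul,
      Matrix.zero_apply, add_zero]
    congr 1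
    have hc := eps_mul_eps n c
    have hd := eps_mul_eps n d
    simp only [mul_add, add_mul, Finset.sum_add_distrib, Finset.mul_sum, Finset.sum_mul]
    rw [add_comm]
    refine congrArg₂ (· + ·) (Finset.sum_congr rfl fun p _ => Finset.sum_congr rfl fun q _ => ?_)
      (Finset.sum_congr rfl fun p _ => Finset.sum_congr rfl fun q _ => ?_)
    · linear_combination (1 / 2) * (z c d p q * (x p * x q)) * hc
    · linear_combination (1 / 2) * (z d c p q * (x p * x q)) * hd
  rw [hquad] at hadd
  have hz := val_flat_zero hT hk i j
  linarith

theorem sum_fin_two_fun {α : Type*} [Fintype α] (f : (Fin 2 → α) → ℝ) :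
    ∑ w, f w = ∑ c, ∑ d, f ![c, d] := by
  rw [← (finTwoArrowEquiv α).symm.sum_comp, Fintype.sum_prod_type]
  rfl

theorem sum_fin_one_fun {α : Type*} [Fintype α] (f : (Fin 1 → α) → ℝ) :
    ∑ w, f w = ∑ c, f ![c] := by
  rw [← (Equiv.funUnique (Fin 1) α).symm.sum_comp]
  refine Finset.sum_congr rfl fun c _ => congrArg f ?_
  ext i
  rw [Subsingleton.elim i 0]; rfl

/-- The skew matrix of a two-form. -/
noncomputable def skewM (n : ℕ) : FormComp n 2 →ₗ[ℝ] Mat n where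
  toFun t := Matrix.of fun a c => altz n 2 t ![a, c]
  map_add' s t := by ext a c; simp
  map_smul' r t := by ext a c; simp

theorem skewM_apply (t : FormComp n 2) (a c : Fin (n + 1)) :
    skewM n t a c = altz n 2 t ![a, c] := rfl

theorem skewM_pullComp (L : Mat n) (t : FormComp n 2) :
    skewM n (pullComp L t) = L * skewM n t * Lᵀ := by
  ext a c
  rw [skewM_apply, ← pullComp_altz, mul_mul_transpose_apply, pullComp, sum_fin_two_fun]
  simp [skewM_apply]

theorem exists_skewM {θ : Fin (n + 1) → Fin (n + 1) → ℝ} (hθ : ∀ a c, θ c a = -θ a c) :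
    ∃ t : FormComp n 2, ∀ a c, skewM n t a c = θ a c := by
  refine ⟨fun v => θ (v 0) (v 1), fun a c => ?_⟩
  have hperm : ∀ σ : Equiv.Perm (Fin 2), σ = 1 ∨ σ = Equiv.swap 0 1 := by decide
  have halt : IsAlt n 2 fun v => θ (v 0) (v 1) := by
    intro v σ
    rcases hperm σ with rfl | rfl
    · simp
    · rw [Equiv.Perm.sign_swap (by decide)]
      simp [hθ (v 0) (v 1)]
  rw [skewM_apply, altz_of_isAlt halt]
  rfl

/-- The decomposable quadratic perturbation attached to two two-forms. -/
noncomputable def skewQuad (n : ℕ) : FormComp n 2 →ₗ[ℝ] FormComp n 2 →ₗ[ℝ] Quad n :=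
  LinearMap.mk₂ ℝ (fun s t a b c d => skewM n s a c * skewM n t b d)
    (fun s s' t => by ext a b c d; simp [add_mul])
    (fun r s t => by ext a b c d; simp [mul_assoc])
    (fun s t t' => by ext a b c d; simp [mul_add])
    (fun r s t => by ext a b c d; simp [mul_left_comm])

theorem quadMetric_skewQuad (t : FormComp n 2) (x : Pt n) :
    Matrix.of (quadMetric n (skewQuad n t t) x) =
      mink n + Matrix.vecMulVec (skewM n t *ᵥ x) (skewM n t *ᵥ x) := by
  ext a b
  simp only [Matrix.of_apply, quadMetric, Matrix.add_apply, Matrix.vecMulVec_apply, Matrix.mulVec,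
    dotProduct, Finset.sum_mul_sum, skewQuad, LinearMap.mk₂_apply]
  congr 1
  have : ∀ c d, 1 / 2 * (skewM n t a c * skewM n t b d + skewM n t b c * skewM n t a d) *
      (x c * x d) = 1 / 2 * (skewM n t a c * x c * (skewM n t b d * x d)) +
        1 / 2 * (skewM n t a d * x d * (skewM n t b c * x c)) := fun c d => by ring
  simp only [this, Finset.sum_add_distrib]
  rw [Finset.sum_comm (f := fun c d => 1 / 2 * (skewM n t a d * x d * (skewM n t b c * x c)))]
  simp only [← Finset.mul_sum]
  ring

theorem iiM_two (t : FormComp n 2) (i j : Fin (n + 1)) :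
    iiM n 2 (mink n) (altz n 2 t) i j = ∑ c, eps n c * (skewM n t i c * skewM n t j c) := by
  have h1 : ∀ u w : FormComp n 1, contr (mink n) u w = ∑ c, eps n c * (u ![c] * w ![c]) := by
    intro u w
    rw [contr_mink, sum_fin_one_fun]
    exact Finset.sum_congr rfl fun c _ => by simp [mul_assoc]
  have h2 : ∀ (i c : Fin (n + 1)) (t : FormComp n 2), slot n 2 i t ![c] = t ![i, c] := by
    intro i c t
    rw [slot_apply]; exact congrArg t (dcons_succ 1 i ![c])
  have h3 : iiM n 2 (mink n) (altz n 2 t) i j = (1 / ((2 - 1).factorial : ℝ)) *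
    contr (k := 1) (mink n) (slot n 2 i (altz n 2 t)) (slot n 2 j (altz n 2 t)) := rfl
  rw [h3, h1]
  simp only [h2, skewM_apply]
  simp

theorem sqM_two (t : FormComp n 2) :
    sqM n 2 (mink n) (altz n 2 t) =
      1 / 2 * ∑ a, eps n a * ∑ c, eps n c * (skewM n t a c * skewM n t a c) := by
  rw [sqM, contr_mink, sum_fin_two_fun]
  simp only [Finset.mul_sum, skewM_apply]
  refine Finset.sum_congr rfl fun a _ => Finset.sum_congr rfl fun c _ => ?_
  simp [Fin.prod_univ_two]
  ring

theorem quadLaw_of_metricPart (T : NaturalTensor n k)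
    {A : Fin (n + 1) → Fin (n + 1) → Quad n →ₗ[ℝ] ℝ}
    (hA : ∀ Q i j, T.val (quadMetric n Q) (fun _ => 0) 0 i j = A i j Q) :
    QuadLaw n 2 fun t => Matrix.of fun i j => A i j (skewQuad n t t) where
  bilin i j := by
    let B := (skewQuad n).compr₂ (A i j)
    refine ⟨(1 / 2 : ℝ) • (B + B.flip), fun s t => ?_, fun t => ?_⟩
    · change (1 / 2 : ℝ) * (B s t + B t s) = 1 / 2 * (B t s + B s t)
      ring
    · change B t t = (1 / 2 : ℝ) * (B t t + B t t)
      ring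
  alt t := by
    have : skewM n (altz n 2 t) = skewM n t := by
      ext a c; rw [skewM_apply, altz_altz, skewM_apply]
    simp only [skewQuad, LinearMap.mk₂_apply, this]
  equivariant L hL t := by
    have h := val_linear_pull T (smoothData_quadMetric (k := k) (skewQuad n t t))
      (zero_mem_lorDom (quadMetric_zero _)) (isUnit_det_of_isometry hL)
      (g' := quadMetric n (skewQuad n (pullComp L t) (pullComp L t))) (ω' := fun _ => 0)
      (fun x => by
        rw [quadMetric_skewQuad, quadMetric_skewQuad, skewM_pullComp, mul_add, add_mul, hL,
          Matrix.mul_vecMulVec, Matrix.vecMulVec_mul, ← Matrix.mulVec_transpose Lᵀ]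
        rw [Matrix.transpose_transpose, Matrix.mulVec_mulVec, ← Matrix.mulVec_transpose L x,
          Matrix.mulVec_mulVec])
      (fun x => by ext v; simp [pullComp])
    ext i j
    have h2 := congrFun (congrFun h i) j
    have e : Matrix.of (T.val (quadMetric n (skewQuad n t t)) (fun _ => 0) 0) =
        Matrix.of fun i j => A i j (skewQuad n t t) := by
      ext a b
      exact hA _ a b
    rw [Matrix.of_apply, hA, e] at h2
    rw [Matrix.of_apply, h2]

/-- The metric part of a scale-invariant natural tensor is a combination of the linearized
Ricci tensor and the linearized scalar curvature. -/
theorem metricPart_formula {T : NaturalTensor n k} (hT : T.ScaleInv) (hk : 1 ≤ k) (hn : 1 ≤ n) :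
    ∃ a b : ℝ, ∀ Q i j, T.val (quadMetric n Q) (fun _ => 0) 0 i j =
      a * ricLin i j Q + b * (∑ c, eps n c * ricLin c c Q) * minkM n i j := by
  obtain ⟨A, hA⟩ := exists_metricPart hT hk
  obtain ⟨c, d, hcd⟩ := (quadLaw_of_metricPart T hA).classification (by norm_num) (by omega)
  refine ⟨-c / 3, -d / 6, fun Q i j => ?_⟩
  rw [hA]
  let D : Quad n →ₗ[ℝ] ℝ := A i j - (-c / 3) • ricLin i j -
    (-d / 6 * minkM n i j) • ∑ c, eps n c • ricLin c c
  have hD : ∀ Q, D Q = A i j Q - (-c / 3) * ricLin i j Q -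
      (-d / 6 * minkM n i j) * ∑ c, eps n c * ricLin c c Q := fun Q => by
    simp [D]
  have hz := quad_functional_eq_zero (D := D) (fun Q => ?_) (fun Q => ?_) (fun z h1 h2 => ?_)
    (fun θ hθ => ?_) Q
  · rw [hD] at hz; linear_combination hz
  · have hq : quadMetric n (fun a b c d => Q b a c d) = quadMetric n Q := by
      ext x a b
      simp only [quadMetric]
      congr 1
      exact Finset.sum_congr rfl fun c _ => Finset.sum_congr rfl fun d _ => by ring
    rw [hD, hD, ← hA, ← hA, hq]
    simp only [ricLin_swap_left]
  · have hq : quadMetric n (fun a b c d => Q a b d c) = quadMetric n Q := by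
      ext x a b
      simp only [quadMetric]
      congr 1
      rw [Finset.sum_comm]
      exact Finset.sum_congr rfl fun c _ => Finset.sum_congr rfl fun d _ => by ring
    rw [hD, hD, ← hA, ← hA, hq]
    simp only [ricLin_swap_right]
  · simp only [hD, ricLin_gauge h1 h2, ← hA, quadMetric_gauge hT hk h1 h2]
    simp
  · obtain ⟨t, ht⟩ := exists_skewM hθ
    have h1 := congrFun (congrFun (hcd t) i) j
    have h2 : skewQuad n t t = fun a b c d => θ a c * θ b d := by
      ext a b c d; simp [skewQuad, ht]
    simp only [Matrix.of_apply, h2, Matrix.add_apply, Matrix.smul_apply, iiM_two, sqM_two, ht,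
      smul_eq_mul] at h1
    rw [hD, h1]
    simp only [ricLin_decomposable hθ]
    simp only [mul_left_comm _ (-3 : ℝ), ← Finset.mul_sum]
    ring

theorem quadLaw_of_formPart {T : NaturalTensor n k} (hT : T.ScaleInv) (hk : 1 ≤ k) :
    QuadLaw n k fun t => Matrix.of (T.val (flat n) (fun _ => altz n k t) 0) where
  bilin i j := by
    obtain ⟨b, hb, hbT⟩ := exists_formPart hT hk
    exact ⟨b i j, hb i j, fun t => hbT t i j⟩
  alt t := by rw [altz_altz]
  equivariant L hL t := by
    have h := val_linear_pull T (g := flat n) (ω := fun _ => altz n k t) (g' := flat n)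
      (ω' := fun _ => altz n k (pullComp L t))
      (smoothData_of_flat (fun _ => contDiff_const) fun _ => isAlt_altz t)
      (zero_mem_lorDom rfl) (isUnit_det_of_isometry hL) (fun _ => hL.symm)
      (fun _ => (pullComp_altz L t).symm)
    exact h

/-- The value of a scale-invariant natural tensor in normal form. -/
theorem exists_normal_formula {T : NaturalTensor n k} (hT : T.ScaleInv) (hn : 1 ≤ n) (hk : 1 ≤ k)
    (hkn : k ≤ n + 1) (hk1 : k ≠ 1) (hk3 : k ≠ 3) :
    ∃ a b c d : ℝ, ∀ (g : MetricField n) (ω : FormField n k)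
      (R : ℝ × Pt n → Fin (n + 1) → Fin (n + 1) → ℝ) (Q : Quad n), SmoothData n k g ω →
      (∀ i j, ContDiff ℝ ∞ fun p => R p i j) → (∀ p i j, R p i j = R p j i) →
      (∀ (l : ℝ) x i j, g (l • x) i j = minkM n i j + l ^ 2 * R (l, x) i j) →
      (∀ x i j, R (0, x) i j = ∑ c, ∑ d, Q i j c d * (x c * x d)) → ∀ i j,
      T.val g ω 0 i j = a * ricLin i j Q + b * (∑ c, eps n c * ricLin c c Q) * minkM n i j +
        c * iiM n k (mink n) (ω 0) i j + d * sqM n k (mink n) (ω 0) * minkM n i j := by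
  obtain ⟨a, b, hab⟩ := metricPart_formula hT hk hn
  obtain ⟨c, d, hcd⟩ := (quadLaw_of_formPart hT hk).classification hk hkn
  refine ⟨a, b, c, d, fun g ω R Q h hR hRs hg hRQ i j => ?_⟩
  have hu : ∀ v, ContDiff ℝ ∞ fun p : ℝ × Pt n => ω (p.1 • p.2) v := fun v =>
    (h.smooth_form v).comp (contDiff_fst.smul contDiff_snd)
  choose V hV hVe hV0 using fun v => exists_hadamard (hu v)
  let W : ℝ × Pt n → FormComp n k := fun p => altz n k fun v => V v p
  let w : (Fin k → Fin (n + 1)) → Fin (n + 1) → ℝ := fun v e =>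
    fderiv ℝ (fun x => ω x v) 0 (Pi.single e 1)
  have hW0 : ∀ x, W (0, x) = altz n k fun v => ∑ e, w v e * x e := by
    intro x
    simp only [W]
    congr 1
    ext v
    rw [hV0]
    have h1 : HasFDerivAt (fun x => ω x v) (fderiv ℝ (fun x => ω x v) 0) ((0 : ℝ) • x) := by
      rw [zero_smul]
      exact ((h.smooth_form v).differentiable (by simp) 0).hasFDerivAt
    have h2 := HasFDerivAt.fun_smul (𝕜 := ℝ) (x := ((0 : ℝ), x)) (c := Prod.fst) (f := Prod.snd)
      hasFDerivAt_fst hasFDerivAt_snd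
    have h3 := (HasFDerivAt.comp (g := fun x => ω x v) ((0 : ℝ), x) h1 h2).fderiv
    change fderiv ℝ ((fun x => ω x v) ∘ fun p : ℝ × Pt n => p.1 • p.2) (0, x) (1, 0) = _
    rw [h3]
    have h4 : fderiv ℝ (fun x => ω x v) 0 x =
        fderiv ℝ (fun x => ω x v) 0 (∑ e, x e • Pi.single e 1) := by
      congr 1
      ext e
      simp [Finset.sum_apply, Pi.single_apply]
    simp only [ContinuousLinearMap.comp_apply, zero_smul,
      ContinuousLinearMap.smulRight_apply, ContinuousLinearMap.coe_fst', one_smul, zero_add]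
    rw [h4, map_sum]
    exact Finset.sum_congr rfl fun e _ => by rw [map_smul, smul_eq_mul, mul_comm]
  have hadd := val_additive hT hk h (R := R) (θ := ω 0) (W := W) hR hRs (h.alt 0)
    (fun v => by simp only [W, altz_apply]; fun_prop) (fun p => isAlt_altz _) hg
    (fun l x v => ?_) (fun l x i j => ?_) (fun l x v => ?_) i j
  · rw [hadd]
    have e1 : T.val (flat n) (fun x => W (0, x)) 0 i j = 0 := by
      simp only [hW0]
      exact linear_formPart_eq_zero hT hk hk1 hk3 w i j
    have e2 : (fun x i j => minkM n i j + R (0, x) i j) = quadMetric n Q := by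
      ext x i j
      rw [quadMetric]
      congr 1
      have h1 := hRQ x i j
      have h2 := hRQ x j i
      rw [hRs (0, x) j i] at h2
      have : R (0, x) i j = 1 / 2 * R (0, x) i j + 1 / 2 * R (0, x) i j := by ring
      rw [this]
      nth_rw 1 [h1]
      rw [h2]
      simp only [Finset.mul_sum, ← Finset.sum_add_distrib]
      exact Finset.sum_congr rfl fun c _ => Finset.sum_congr rfl fun d _ => by ring
    have e3 := congrFun (congrFun (hcd (ω 0)) i) j
    rw [altz_of_isAlt (h.alt 0)] at e3
    simp only [Matrix.of_apply, Matrix.add_apply, Matrix.smul_apply, smul_eq_mul] at e3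
    rw [e1, e2, hab, e3]
    ring
  · have h1 := h.alt (l • x)
    rw [← altz_of_isAlt h1]
    conv_rhs => rw [← altz_of_isAlt (h.alt 0)]
    have : ω (l • x) = ω 0 + l • fun v => V v (l, x) := by
      ext v
      have := hVe v l x
      simp only [zero_smul] at this
      simpa using this
    rw [this]
    simp [W]
  · rw [hRQ, hRQ]
    simp only [Finset.mul_sum]
    exact Finset.sum_congr rfl fun c _ => Finset.sum_congr rfl fun d _ => by
      simp only [Pi.smul_apply, smul_eq_mul]; ring
  · rw [hW0, hW0]
    have : (fun v => ∑ e, w v e * (l • x) e) = l • fun v => ∑ e, w v e * x e := by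
      ext v
      simp only [Pi.smul_apply, smul_eq_mul, Finset.mul_sum]
      exact Finset.sum_congr rfl fun c _ => by ring
    rw [this]
    simp

theorem contDiff_pd {f : Pt n → ℝ} (hf : ContDiff ℝ ∞ f) (c : Fin (n + 1)) :
    ContDiff ℝ ∞ (pd n c f) := by
  unfold pd
  exact (hf.fderiv_right (m := ∞) (by simp)).clm_apply contDiff_const

theorem fderiv_eq_sum_pd (f : Pt n → ℝ) (x z : Pt n) :
    fderiv ℝ f x z = ∑ c, pd n c f x * z c := by
  have h : z = ∑ c, z c • Pi.single c (1 : ℝ) := by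
    ext c
    simp [Finset.sum_apply, Pi.single_apply]
  conv_lhs => rw [h]
  rw [map_sum]
  exact Finset.sum_congr rfl fun c _ => by rw [map_smul, smul_eq_mul, mul_comm]; rfl

theorem hasDerivAt_line {f : Pt n → ℝ} (hf : ContDiff ℝ ∞ f) (x z : Pt n) (l : ℝ) :
    HasDerivAt (fun l : ℝ => f (x + l • z)) (∑ c, pd n c f (x + l • z) * z c) l := by
  have h1 : HasDerivAt (fun l : ℝ => x + l • z) z l := by
    simpa using ((hasDerivAt_id l).smul_const z).const_add x
  have h2 := (hf.differentiable (by simp) (x + l • z)).hasFDerivAt.comp_hasDerivAt l h1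
  rwa [fderiv_eq_sum_pd] at h2

/-- Second-order Taylor expansion with smooth remainder. -/
theorem exists_taylor_two {f : Pt n → ℝ} (hf : ContDiff ℝ ∞ f) (x : Pt n) :
    ∃ v : ℝ × Pt n → ℝ, ContDiff ℝ ∞ v ∧
      (∀ (l : ℝ) z, f (x + l • z) = f x + l * ∑ c, pd n c f x * z c + l ^ 2 * v (l, z)) ∧
      ∀ z, v (0, z) = ∑ c, ∑ d, 1 / 2 * pd n d (pd n c f) x * (z c * z d) := by
  have hu : ContDiff ℝ ∞ fun p : ℝ × Pt n => f (x + p.1 • p.2) :=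
    hf.comp (contDiff_const.add (contDiff_fst.smul contDiff_snd))
  obtain ⟨v₁, hv₁, e₁, -⟩ := exists_hadamard hu
  obtain ⟨v₂, hv₂, e₂, -⟩ := exists_hadamard hv₁
  have hline : ∀ {v : ℝ × Pt n → ℝ} (z : Pt n), ContDiff ℝ ∞ v →
      ContDiff ℝ ∞ fun l : ℝ => v (l, z) := fun z hv =>
    hv.comp (contDiff_id.prodMk contDiff_const)
  have hd : ∀ {v : ℝ × Pt n → ℝ} (z : Pt n) (l : ℝ), ContDiff ℝ ∞ v →
      HasDerivAt (fun l : ℝ => v (l, z)) (deriv (fun l : ℝ => v (l, z)) l) l := fun z l hv =>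
    ((hline z hv).differentiable (by simp) l).hasDerivAt
  have e3 : ∀ (l : ℝ) z, f (x + l • z) = f x + l * v₁ (0, z) + l ^ 2 * v₂ (l, z) := by
    intro l z
    have h1 := e₁ l z
    have h2 := e₂ l z
    simp only [zero_smul, add_zero] at h1
    rw [h1, h2]; ring
  have hder : ∀ (l : ℝ) z, ∑ c, pd n c f (x + l • z) * z c =
      v₁ (0, z) + (2 * l * v₂ (l, z) + l ^ 2 * deriv (fun l : ℝ => v₂ (l, z)) l) := by
    intro l z
    have h1 := hasDerivAt_line hf x z l
    have h2 : HasDerivAt (fun l : ℝ => f x + l * v₁ (0, z) + l ^ 2 * v₂ (l, z))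
        (1 * v₁ (0, z) + (2 * l * v₂ (l, z) + l ^ 2 * deriv (fun l : ℝ => v₂ (l, z)) l)) l := by
      have := (((hasDerivAt_id l).mul_const (v₁ (0, z))).const_add (f x)).add
        ((hasDerivAt_pow 2 l).mul (hd z l hv₂))
      simpa using! this
    rw [← funext fun l => e3 l z] at h2
    rw [h1.unique h2, one_mul]
  have hv10 : ∀ z, v₁ (0, z) = ∑ c, pd n c f x * z c := fun z => by
    have := hder 0 z
    simp at this
    exact this.symm
  refine ⟨v₂, hv₂, fun l z => by rw [e3, hv10], fun z => ?_⟩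
  have h1 : HasDerivAt (fun l : ℝ => ∑ c, pd n c f (x + l • z) * z c)
      (∑ c, (∑ d, pd n d (pd n c f) (x + (0 : ℝ) • z) * z d) * z c) 0 :=
    HasDerivAt.fun_sum fun c _ => (hasDerivAt_line (contDiff_pd hf c) x z 0).mul_const (z c)
  have h2 : HasDerivAt (fun l : ℝ => v₁ (0, z) +
      (2 * l * v₂ (l, z) + l ^ 2 * deriv (fun l : ℝ => v₂ (l, z)) l)) (2 * v₂ (0, z)) 0 := by
    have hd2 : HasDerivAt (deriv fun l : ℝ => v₂ (l, z)) _ 0 :=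
      (((hline z hv₂).iterate_deriv 1).differentiable (by simp) 0).hasDerivAt
    have := ((((hasDerivAt_id (0 : ℝ)).const_mul 2).mul (hd z 0 hv₂)).add
      ((hasDerivAt_pow 2 (0 : ℝ)).mul hd2)).const_add (v₁ (0, z))
    simpa using! this
  rw [← funext fun l => hder l z] at h2
  have h3 := h1.unique h2
  simp only [zero_smul, add_zero] at h3
  have : v₂ (0, z) = 1 / 2 * (2 * v₂ (0, z)) := by ring
  rw [this, ← h3, Finset.mul_sum]
  refine Finset.sum_congr rfl fun c _ => ?_
  rw [Finset.sum_mul, Finset.mul_sum]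
  exact Finset.sum_congr rfl fun d _ => by ring

/-- The quadratic map with second-order coefficients `-Γ`. -/
noncomputable def quadMap (Γ : Fin (n + 1) → Fin (n + 1) → Fin (n + 1) → ℝ) (x₀ y : Pt n) : Pt n :=
  fun e => x₀ e + (y e - 1 / 2 * ∑ c, ∑ d, Γ e c d * (y c * y d))

theorem contDiff_quadMap (Γ : Fin (n + 1) → Fin (n + 1) → Fin (n + 1) → ℝ) (x₀ : Pt n) :
    ContDiff ℝ ∞ (quadMap Γ x₀) := by
  unfold quadMap
  exact contDiff_pi.2 fun e => by fun_prop

/-- The matrix of `Γ` contracted with a vector. -/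
def gamM (Γ : Fin (n + 1) → Fin (n + 1) → Fin (n + 1) → ℝ) (y : Pt n) : Mat n :=
  Matrix.of fun a e => ∑ c, Γ e a c * y c

theorem gamM_smul (Γ : Fin (n + 1) → Fin (n + 1) → Fin (n + 1) → ℝ) (l : ℝ) (y : Pt n) :
    gamM Γ (l • y) = l • gamM Γ y := by
  ext a e
  simp only [gamM, Matrix.of_apply, Pi.smul_apply, smul_eq_mul, Matrix.smul_apply, Finset.mul_sum]
  exact Finset.sum_congr rfl fun c _ => by ring

theorem jacM_quadMap {Γ : Fin (n + 1) → Fin (n + 1) → Fin (n + 1) → ℝ}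
    (hΓ : ∀ e c d, Γ e c d = Γ e d c) (x₀ y : Pt n) :
    jacM n (quadMap Γ x₀) y = 1 - gamM Γ y := by
  ext a e
  have hy : ∀ b, HasFDerivAt (fun y : Pt n => y b) (ContinuousLinearMap.proj (R := ℝ) b) y :=
    fun b => hasFDerivAt_apply b y
  have hd : HasFDerivAt (fun y : Pt n => quadMap Γ x₀ y e) _ y :=
    ((hy e).sub (HasFDerivAt.const_mul (HasFDerivAt.fun_sum fun c _ =>
      HasFDerivAt.fun_sum fun d _ =>
        HasFDerivAt.const_mul ((hy c).mul (hy d)) (Γ e c d)) (1 / 2))).const_add (x₀ e)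
  have hc : jacM n (quadMap Γ x₀) y a e =
      fderiv ℝ (fun y => quadMap Γ x₀ y e) y (Pi.single a 1) := by
    change fderiv ℝ (quadMap Γ x₀) y (Pi.single a 1) e = _
    rw [fderiv_apply ((contDiff_quadMap Γ x₀).differentiable (by simp) y)]
    rfl
  rw [hc, hd.fderiv]
  simp only [gamM, Matrix.sub_apply, Matrix.one_apply, Matrix.of_apply]
  have hs : ∀ c, Γ e c a = Γ e a c := fun c => hΓ e c a
  simp [Pi.single_apply, Finset.sum_add_distrib, eq_comm, hs]
  ring

/-- The quadratic coefficients of a metric after the quadratic change of coordinates. -/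
noncomputable def gaugeQuad (g : MetricField n) (Γ : Fin (n + 1) → Fin (n + 1) → Fin (n + 1) → ℝ)
    (x₀ : Pt n) : Quad n := fun a b c d =>
  1 / 2 * pd n d (pd n c fun y => g y a b) x₀
    - 1 / 2 * (∑ e, pd n e (fun y => g y a b) x₀ * Γ e c d)
    - (∑ e, Γ e a c * pd n d (fun y => g y e b) x₀)
    - (∑ e, Γ e b c * pd n d (fun y => g y a e) x₀)
    + ∑ e, ∑ f, Γ e a c * Γ f b d * g x₀ e f

theorem contDiff_matrix_mul {X : Type*} [NormedAddCommGroup X] [NormedSpace ℝ X] {A B : X → Mat n}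
    (hA : ∀ a b, ContDiff ℝ ∞ fun x => A x a b) (hB : ∀ a b, ContDiff ℝ ∞ fun x => B x a b)
    (a b : Fin (n + 1)) : ContDiff ℝ ∞ fun x => (A x * B x) a b := by
  simp only [Matrix.mul_apply]
  exact ContDiff.sum fun c _ => (hA a c).mul (hB c b)

theorem conj_expansion (l : ℝ) (C G D H : Mat n) (hD : D = C * G + G * Cᵀ) :
    (1 - l • C) * (G + l • D + l ^ 2 • H) * (1 - l • C)ᵀ =
      G + l ^ 2 • (H - C * D - D * Cᵀ + C * G * Cᵀ + l • (C * D * Cᵀ - C * H - H * Cᵀ) +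
        l ^ 2 • (C * H * Cᵀ)) := by
  subst hD
  simp only [Matrix.transpose_sub, Matrix.transpose_one, Matrix.transpose_smul, sub_mul, mul_sub,
    one_mul, mul_one, mul_add, add_mul, smul_mul_assoc, mul_smul_comm, mul_assoc, smul_add, smul_sub,
    smul_smul]
  module

theorem sum_comm_four {α : Type*} [Fintype α] (F : α → α → α → α → ℝ) :
    ∑ a, ∑ b, ∑ c, ∑ d, F a b c d = ∑ c, ∑ d, ∑ a, ∑ b, F a b c d := by
  simp_rw [Finset.sum_comm (f := fun b c => ∑ d, F _ b c d)]
  rw [Finset.sum_comm]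
  refine Finset.sum_congr rfl fun c _ => ?_
  simp_rw [Finset.sum_comm (f := fun b d => F _ b c d)]
  rw [Finset.sum_comm]

theorem exists_gauge_expansion {g : MetricField n} {ω : FormField n k} (h : SmoothData n k g ω)
    {Γ : Fin (n + 1) → Fin (n + 1) → Fin (n + 1) → ℝ} {x₀ : Pt n}
    (hΓ : ∀ e c d, Γ e c d = Γ e d c)
    (hcomp : ∀ e a b, pd n e (fun y => g y a b) x₀ =
      (∑ f, Γ f a e * g x₀ f b) + ∑ f, g x₀ a f * Γ f b e) :
    ∃ R : ℝ × Pt n → Fin (n + 1) → Fin (n + 1) → ℝ, (∀ a b, ContDiff ℝ ∞ fun p => R p a b) ∧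
      (∀ p a b, R p a b = R p b a) ∧
      (∀ (l : ℝ) x a b, pullTensor n (quadMap Γ x₀) g (l • x) a b =
        g x₀ a b + l ^ 2 * R (l, x) a b) ∧
      ∀ x a b, R (0, x) a b = ∑ c, ∑ d, gaugeQuad g Γ x₀ a b c d * (x c * x d) := by
  choose V' hV' hVe' hV0' using fun f : {f : Pt n → ℝ // ContDiff ℝ ∞ f} =>
    exists_taylor_two f.2 x₀
  let V : Fin (n + 1) → Fin (n + 1) → ℝ × Pt n → ℝ := fun a b =>
    V' ⟨fun y => g y a b, h.smooth_metric a b⟩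
  have hV : ∀ a b, ContDiff ℝ ∞ (V a b) := fun a b => hV' _
  have hVe : ∀ a b (l : ℝ) z, g (x₀ + l • z) a b = g x₀ a b +
      l * ∑ c, pd n c (fun y => g y a b) x₀ * z c + l ^ 2 * V a b (l, z) := fun a b => hVe' ⟨_, h.smooth_metric a b⟩
  have hV0 : ∀ a b z, V a b (0, z) =
      ∑ c, ∑ d, 1 / 2 * pd n d (pd n c fun y => g y a b) x₀ * (z c * z d) := fun a b => hV0' ⟨_, h.smooth_metric a b⟩
  have hgs : ∀ a b, (fun y => g y a b) = fun y => g y b a := fun a b => funext fun y => h.symm y a b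
  have hVs : ∀ a b, V a b = V b a := fun a b => by
    simp only [V, hgs a b]
  let q : Pt n → Pt n := fun y e => ∑ c, ∑ d, Γ e c d * (y c * y d)
  have hq : ContDiff ℝ ∞ q := contDiff_pi.2 fun e => by simp only [q]; fun_prop
  let D : Pt n → Mat n := fun y => Matrix.of fun a b => ∑ c, pd n c (fun y => g y a b) x₀ * y c
  let H : ℝ × Pt n → Mat n := fun p => Matrix.of fun a b =>
    -(1 / 2) * (∑ e, pd n e (fun y => g y a b) x₀ * q p.2 e) +
      V a b (p.1, p.2 - (p.1 / 2) • q p.2)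
  have hG : (Matrix.of (g x₀))ᵀ = Matrix.of (g x₀) := by ext a b; exact h.symm x₀ b a
  have hDs : ∀ y, (D y)ᵀ = D y := fun y => by
    ext a b; simp only [D, Matrix.transpose_apply, Matrix.of_apply, hgs a b]
  have hHs : ∀ p, (H p)ᵀ = H p := fun p => by
    ext a b; simp only [H, Matrix.transpose_apply, Matrix.of_apply, hgs a b, hVs a b]
  have hD : ∀ y, D y = gamM Γ y * Matrix.of (g x₀) + Matrix.of (g x₀) * (gamM Γ y)ᵀ := by
    intro y
    ext a b
    simp only [D, gamM, Matrix.of_apply, Matrix.add_apply, Matrix.mul_apply, Matrix.transpose_apply,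
      hcomp, add_mul, Finset.sum_add_distrib, Finset.sum_mul, Finset.mul_sum]
    congr 1
    · rw [Finset.sum_comm]
      exact Finset.sum_congr rfl fun c _ => Finset.sum_congr rfl fun d _ => by ring
    · rw [Finset.sum_comm]
      exact Finset.sum_congr rfl fun c _ => Finset.sum_congr rfl fun d _ => by ring
  have hexp : ∀ (l : ℝ) y, Matrix.of (g (quadMap Γ x₀ (l • y))) =
      Matrix.of (g x₀) + l • D y + l ^ 2 • H (l, y) := by
    intro l y
    have e : quadMap Γ x₀ (l • y) = x₀ + l • (y - (l / 2) • q y) := by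
      ext e
      simp only [quadMap, q, Pi.add_apply, Pi.smul_apply, Pi.sub_apply, smul_eq_mul]
      have : ∑ c, ∑ d, Γ e c d * (l * y c * (l * y d)) =
          l ^ 2 * ∑ c, ∑ d, Γ e c d * (y c * y d) := by
        simp only [Finset.mul_sum]
        exact Finset.sum_congr rfl fun c _ => Finset.sum_congr rfl fun d _ => by ring
      rw [this]; ring
    ext a b
    simp only [Matrix.of_apply, Matrix.add_apply, Matrix.smul_apply, smul_eq_mul, D, H]
    rw [e, hVe]
    have : ∑ c, pd n c (fun y => g y a b) x₀ * (y - (l / 2) • q y) c =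
        (∑ c, pd n c (fun y => g y a b) x₀ * y c) -
          l / 2 * ∑ c, pd n c (fun y => g y a b) x₀ * q y c := by
      rw [Finset.mul_sum, ← Finset.sum_sub_distrib]
      exact Finset.sum_congr rfl fun c _ => by
        simp only [Pi.sub_apply, Pi.smul_apply, smul_eq_mul]; ring
    rw [this]; ring
  let G := Matrix.of (g x₀)
  let R : ℝ × Pt n → Mat n := fun p => H p - gamM Γ p.2 * D p.2 - D p.2 * (gamM Γ p.2)ᵀ +
    gamM Γ p.2 * G * (gamM Γ p.2)ᵀ + p.1 • (gamM Γ p.2 * D p.2 * (gamM Γ p.2)ᵀ -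
      gamM Γ p.2 * H p - H p * (gamM Γ p.2)ᵀ) + p.1 ^ 2 • (gamM Γ p.2 * H p * (gamM Γ p.2)ᵀ)
  refine ⟨R, fun a b => ?_, fun p a b => ?_, fun l x a b => ?_, fun x a b => ?_⟩
  · have hs1 : ∀ a b, ContDiff ℝ ∞ fun p : ℝ × Pt n => gamM Γ p.2 a b := fun a b => by
      simp only [gamM, Matrix.of_apply]; fun_prop
    have hs2 : ∀ a b, ContDiff ℝ ∞ fun p : ℝ × Pt n => D p.2 a b := fun a b => by
      simp only [D, Matrix.of_apply]; fun_prop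
    have hs3 : ∀ a b, ContDiff ℝ ∞ fun p : ℝ × Pt n => H p a b := fun a b => by
      simp only [H, Matrix.of_apply]; fun_prop
    have hs4 : ∀ a b, ContDiff ℝ ∞ fun p : ℝ × Pt n => (gamM Γ p.2)ᵀ a b := fun a b => hs1 b a
    have hs5 : ∀ a b, ContDiff ℝ ∞ fun _ : ℝ × Pt n => G a b := fun a b => contDiff_const
    have t1 := contDiff_matrix_mul hs1 hs2 a b
    have t2 := contDiff_matrix_mul hs2 hs4 a b
    have t3 := contDiff_matrix_mul (contDiff_matrix_mul hs1 hs5) hs4 a b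
    have t4 := contDiff_matrix_mul (contDiff_matrix_mul hs1 hs2) hs4 a b
    have t5 := contDiff_matrix_mul hs1 hs3 a b
    have t6 := contDiff_matrix_mul hs3 hs4 a b
    have t7 := contDiff_matrix_mul (contDiff_matrix_mul hs1 hs3) hs4 a b
    exact (((((hs3 a b).sub t1).sub t2).add t3).add
      (contDiff_fst.mul ((t4.sub t5).sub t6))).add ((contDiff_fst.pow 2).mul t7)
  · have : (R p)ᵀ = R p := by
      simp only [R, Matrix.transpose_add, Matrix.transpose_sub, Matrix.transpose_smul,
        Matrix.transpose_mul, Matrix.transpose_transpose, hHs, hDs, hG, G, mul_assoc]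
      module
    exact congrFun (congrFun this b) a
  · have h1 : Matrix.of (pullTensor n (quadMap Γ x₀) g (l • x)) = G + l ^ 2 • R (l, x) := by
      rw [pullTensor_eq, jacM_quadMap hΓ, gamM_smul, hexp, conj_expansion l _ _ _ _ (hD x)]
    exact congrFun (congrFun h1 a) b
  · have h1 : R (0, x) a b = H (0, x) a b - (gamM Γ x * D x) a b - (D x * (gamM Γ x)ᵀ) a b +
        (gamM Γ x * G * (gamM Γ x)ᵀ) a b := by
      simp [R]
    rw [h1, mul_mul_transpose_apply]
    have hH : H (0, x) a b = -(1 / 2) * (∑ e, pd n e (fun y => g y a b) x₀ * q x e) +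
        ∑ c, ∑ d, 1 / 2 * pd n d (pd n c fun y => g y a b) x₀ * (x c * x d) := by
      simp only [H, Matrix.of_apply, zero_div, zero_smul, sub_zero, hV0]
    have s1 : ∑ e, pd n e (fun y => g y a b) x₀ * q x e =
        ∑ c, ∑ d, (∑ e, pd n e (fun y => g y a b) x₀ * Γ e c d) * (x c * x d) := by
      simp only [q, Finset.mul_sum, Finset.sum_mul]
      rw [Finset.sum_comm]
      refine Finset.sum_congr rfl fun c _ => ?_
      rw [Finset.sum_comm]
      exact Finset.sum_congr rfl fun d _ => Finset.sum_congr rfl fun e _ => by ring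
    have s2 : (gamM Γ x * D x) a b =
        ∑ c, ∑ d, (∑ e, Γ e a c * pd n d (fun y => g y e b) x₀) * (x c * x d) := by
      simp only [Matrix.mul_apply, gamM, D, Matrix.of_apply, Finset.sum_mul_sum]
      simp only [Finset.sum_mul]
      rw [Finset.sum_comm]
      refine Finset.sum_congr rfl fun c _ => ?_
      rw [Finset.sum_comm]
      exact Finset.sum_congr rfl fun d _ => Finset.sum_congr rfl fun e _ => by ring
    have s3 : (D x * (gamM Γ x)ᵀ) a b =
        ∑ c, ∑ d, (∑ e, Γ e b c * pd n d (fun y => g y a e) x₀) * (x c * x d) := by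
      have : (D x * (gamM Γ x)ᵀ) a b = ∑ e, gamM Γ x b e * D x a e := by
        rw [Matrix.mul_apply]
        exact Finset.sum_congr rfl fun e _ => mul_comm _ _
      rw [this]
      simp only [gamM, D, Matrix.of_apply, Finset.sum_mul_sum]
      simp only [Finset.sum_mul]
      rw [Finset.sum_comm]
      refine Finset.sum_congr rfl fun c _ => ?_
      rw [Finset.sum_comm]
      exact Finset.sum_congr rfl fun d _ => Finset.sum_congr rfl fun e _ => by ring
    have s4 : ∑ e, ∑ f, gamM Γ x a e * gamM Γ x b f * G e f =
        ∑ c, ∑ d, (∑ e, ∑ f, Γ e a c * Γ f b d * g x₀ e f) * (x c * x d) := by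
      simp only [gamM, G, Matrix.of_apply, Finset.sum_mul_sum]
      simp only [Finset.sum_mul]
      rw [sum_comm_four]
      exact Finset.sum_congr rfl fun c _ => Finset.sum_congr rfl fun d _ =>
        Finset.sum_congr rfl fun e _ => Finset.sum_congr rfl fun f _ => by ring
    rw [hH, s1, s2, s3, s4, Finset.mul_sum]
    simp only [Finset.mul_sum (s := Finset.univ) (a := -(1 / 2 : ℝ)), ← Finset.sum_add_distrib,
      ← Finset.sum_sub_distrib]
    refine Finset.sum_congr rfl fun c _ => Finset.sum_congr rfl fun d _ => ?_
    rw [gaugeQuad]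
    ring

/-- Evaluation of a quadruple tensor on four vectors. -/
def quadEval (Q : Quad n) (u v w x : Pt n) : ℝ :=
  ∑ i, ∑ j, ∑ k, ∑ l, Q i j k l * (u i * v j * (w k * x l))

/-- Transport of a quadruple tensor by a matrix. -/
def quadTr (P : Mat n) (Q : Quad n) : Quad n := fun a b c d => quadEval Q (P a) (P b) (P c) (P d)

theorem quadEval_swap_left (Q : Quad n) (u v w x : Pt n) :
    quadEval (fun a b c d => Q b a c d) u v w x = quadEval Q v u w x := by
  unfold quadEval
  rw [Finset.sum_comm]
  exact Finset.sum_congr rfl fun i _ => Finset.sum_congr rfl fun j _ => by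
    simp only [mul_comm (u j)]

theorem quadEval_swap_right (Q : Quad n) (u v w x : Pt n) :
    quadEval (fun a b c d => Q a b d c) u v w x = quadEval Q u v x w := by
  unfold quadEval
  refine Finset.sum_congr rfl fun i _ => Finset.sum_congr rfl fun j _ => ?_
  rw [Finset.sum_comm]
  exact Finset.sum_congr rfl fun k _ => Finset.sum_congr rfl fun l _ => by
    rw [mul_comm (w l)]

theorem quadEval_swap_mid (Q : Quad n) (u v w x : Pt n) :
    quadEval (fun a b c d => Q a c b d) u v w x = quadEval Q u w v x := by
  unfold quadEval
  refine Finset.sum_congr rfl fun i _ => ?_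
  rw [Finset.sum_comm]
  exact Finset.sum_congr rfl fun j _ => Finset.sum_congr rfl fun k _ =>
    Finset.sum_congr rfl fun l _ => by ring

theorem quadEval_add (Q Q' : Quad n) (u v w x : Pt n) :
    quadEval (fun a b c d => Q a b c d + Q' a b c d) u v w x =
      quadEval Q u v w x + quadEval Q' u v w x := by
  simp only [quadEval, add_mul, Finset.sum_add_distrib]

theorem quadEval_sub (Q Q' : Quad n) (u v w x : Pt n) :
    quadEval (fun a b c d => Q a b c d - Q' a b c d) u v w x =
      quadEval Q u v w x - quadEval Q' u v w x := by
  simp only [quadEval, sub_mul, Finset.sum_sub_distrib]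

theorem quadEval_div (Q : Quad n) (r : ℝ) (u v w x : Pt n) :
    quadEval (fun a b c d => Q a b c d / r) u v w x = quadEval Q u v w x / r := by
  simp only [quadEval, Finset.sum_div]
  exact Finset.sum_congr rfl fun i _ => Finset.sum_congr rfl fun j _ =>
    Finset.sum_congr rfl fun k _ => Finset.sum_congr rfl fun l _ => by ring

theorem symQ_quadTr (P : Mat n) (Q : Quad n) (a b c d : Fin (n + 1)) :
    symQ (quadTr P Q) a b c d = quadEval (symQ Q) (P a) (P b) (P c) (P d) := by
  have e : quadEval (symQ Q) (P a) (P b) (P c) (P d) = quadEval (fun a b c d =>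
      (Q a b c d + Q b a c d + Q a b d c + Q b a d c) / 4) (P a) (P b) (P c) (P d) := rfl
  have b1 : quadEval (fun a b c d => Q b a d c) (P a) (P b) (P c) (P d) =
      quadEval Q (P b) (P a) (P d) (P c) :=
    (quadEval_swap_left (fun a b c d => Q a b d c) ..).trans (quadEval_swap_right ..)
  rw [e, quadEval_div fun a b c d => Q a b c d + Q b a c d + Q a b d c + Q b a d c,
    quadEval_add fun a b c d => Q a b c d + Q b a c d + Q a b d c,
    quadEval_add fun a b c d => Q a b c d + Q b a c d, quadEval_add, b1,
    quadEval_swap_left Q, quadEval_swap_right Q]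
  rfl

theorem riemLin_quadTr (P : Mat n) (Q : Quad n) (d b c a : Fin (n + 1)) :
    riemLin (quadTr P Q) d b c a = quadEval (riemLin Q) (P d) (P b) (P c) (P a) := by
  set S := symQ Q with hS
  have e1 : quadEval (fun d b c a => S d a c b) (P d) (P b) (P c) (P a) =
      quadEval S (P d) (P a) (P c) (P b) := by
    rw [quadEval_swap_mid fun d c b a => S d a c b, quadEval_swap_right fun d c a b => S d a c b,
      quadEval_swap_mid fun d a c b => S d a c b]
  have e2 : quadEval (fun d b c a => S a b c d) (P d) (P b) (P c) (P a) =
      quadEval S (P a) (P b) (P c) (P d) := by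
    rw [quadEval_swap_left fun b d c a => S a b c d, quadEval_swap_mid fun b c d a => S a b c d,
      quadEval_swap_right fun b c a d => S a b c d, quadEval_swap_mid fun b a c d => S a b c d,
      quadEval_swap_left fun a b c d => S a b c d]
  have e3 : quadEval (fun d b c a => S d c a b) (P d) (P b) (P c) (P a) =
      quadEval S (P d) (P c) (P a) (P b) := by
    rw [quadEval_swap_mid fun d c b a => S d c a b, quadEval_swap_right fun d c a b => S d c a b]
  have e4 : quadEval (fun d b c a => S c b a d) (P d) (P b) (P c) (P a) =
      quadEval S (P c) (P b) (P a) (P d) := by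
    rw [quadEval_swap_left fun b d c a => S c b a d, quadEval_swap_mid fun b c d a => S c b a d,
      quadEval_swap_left fun c b d a => S c b a d, quadEval_swap_right fun c b a d => S c b a d]
  have e5 : quadEval (riemLin Q) (P d) (P b) (P c) (P a) =
      quadEval (fun d b c a => S d a c b - S a b c d - S d c a b + S c b a d)
        (P d) (P b) (P c) (P a) := rfl
  rw [e5, quadEval_add, quadEval_sub, quadEval_sub, e1, e2, e3, e4]
  simp only [riemLin, symQ_quadTr, hS]

/-- The Ricci contraction of the linearized Riemann tensor with an inverse metric. -/
noncomputable def ricWith (M : Mat n) (Q : Quad n) : Mat n :=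
  Matrix.of fun a b => ∑ c, ∑ d, M c d * riemLin Q d b c a

theorem sum_comm_three {α : Type*} [Fintype α] (F : α → α → α → ℝ) :
    ∑ e, ∑ d, ∑ a, F a d e = ∑ a, ∑ d, ∑ e, F a d e := by
  rw [Finset.sum_comm (f := fun a d => ∑ e, F a d e), Finset.sum_comm]
  refine Finset.sum_congr rfl fun d _ => ?_
  rw [Finset.sum_comm]

theorem ricLin_quadTr {P M : Mat n} (hM : Pᵀ * mink n * P = M) (Q : Quad n) (a b : Fin (n + 1)) :
    ricLin a b (quadTr P Q) = (P * ricWith M Q * Pᵀ) a b := by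
  have hMe : ∀ i j, M i j = ∑ c, eps n c * (P c i * P c j) := fun i j => by
    rw [← hM, mink_eq_diagonal, Matrix.mul_apply]
    exact Finset.sum_congr rfl fun c _ => by
      rw [Matrix.mul_diagonal, Matrix.transpose_apply]; ring
  rw [ricLin_apply, mul_mul_transpose_apply]
  simp only [riemLin_quadTr, quadEval, ricWith, Matrix.of_apply, hMe, Finset.mul_sum, Finset.sum_mul]
  rw [sum_comm_four]
  have hsw : ∀ F : Fin (n + 1) → Fin (n + 1) → Fin (n + 1) → Fin (n + 1) → Fin (n + 1) → ℝ,
      ∑ b, ∑ c, ∑ e, ∑ d, ∑ a, F a b c d e = ∑ a, ∑ b, ∑ c, ∑ d, ∑ e, F a b c d e := by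
    intro F
    rw [Finset.sum_comm (f := fun a b => ∑ c, ∑ d, ∑ e, F a b c d e)]
    refine Finset.sum_congr rfl fun b _ => ?_
    rw [Finset.sum_comm (f := fun a c => ∑ d, ∑ e, F a b c d e)]
    refine Finset.sum_congr rfl fun c _ => ?_
    rw [sum_comm_three]
  rw [hsw]
  exact Finset.sum_congr rfl fun i _ => Finset.sum_congr rfl fun j _ =>
    Finset.sum_congr rfl fun c _ => Finset.sum_congr rfl fun d _ => Finset.sum_congr rfl
      fun e _ => by ring

/-- The value of a scale-invariant natural tensor, read off in a frame. -/
theorem exists_frame_formula {T : NaturalTensor n k} (hT : T.ScaleInv) (hn : 1 ≤ n) (hk : 1 ≤ k)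
    (hkn : k ≤ n + 1) (hk1 : k ≠ 1) (hk3 : k ≠ 3) :
    ∃ a b c d : ℝ, ∀ (g : MetricField n) (ω : FormField n k) (x₀ : Pt n)
      (Γ : Fin (n + 1) → Fin (n + 1) → Fin (n + 1) → ℝ) (P : Mat n), SmoothData n k g ω →
      (∀ e c d, Γ e c d = Γ e d c) →
      (∀ e a b, pd n e (fun y => g y a b) x₀ =
        (∑ f, Γ f a e * g x₀ f b) + ∑ f, g x₀ a f * Γ f b e) →
      IsUnit P.det → P * Matrix.of (g x₀) * Pᵀ = mink n → ∀ i j,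
      (P * Matrix.of (T.val g ω x₀) * Pᵀ) i j =
        a * ricLin i j (quadTr P (gaugeQuad g Γ x₀)) +
        b * (∑ c, eps n c * ricLin c c (quadTr P (gaugeQuad g Γ x₀))) * minkM n i j +
        c * iiM n k (mink n) (pullComp P (ω x₀)) i j +
        d * sqM n k (mink n) (pullComp P (ω x₀)) * minkM n i j := by
  obtain ⟨a, b, c, d, hF⟩ := exists_normal_formula hT hn hk hkn hk1 hk3
  refine ⟨a, b, c, d, fun g ω x₀ Γ P h hΓ hcomp hP hPg i j => ?_⟩
  obtain ⟨R, hR, hRs, hRe, hR0⟩ := exists_gauge_expansion h hΓ hcomp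
  set g₁ := pullTensor n (quadMap Γ x₀) g with hg₁
  set ω₁ := pullForm n k (quadMap Γ x₀) ω with hω₁
  have h₁ : SmoothData n k g₁ ω₁ := h.pull (contDiff_quadMap Γ x₀)
  have hj : jacM n (quadMap Γ x₀) 0 = 1 := by
    rw [jacM_quadMap hΓ]
    ext a e
    simp [gamM]
  have hq0 : quadMap Γ x₀ 0 = x₀ := by
    ext e; simp [quadMap]
  have hx₀ : x₀ ∈ lorDom n g := by
    refine ⟨by ext a b; exact h.symm x₀ b a, Pᵀ, by rwa [Matrix.det_transpose], ?_⟩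
    rw [Matrix.transpose_transpose, hPg]
  have hg₁0 : Matrix.of (g₁ 0) = Matrix.of (g x₀) := by
    rw [hg₁, pullTensor_eq, hj, hq0]; simp
  have hω₁0 : ω₁ 0 = ω x₀ := by
    have := pullComp_smul_one (n := n) 1 (ω x₀)
    simp only [one_smul, one_pow] at this
    rw [hω₁, pullForm_eq, hj, hq0, this]
  have hv₁ : Matrix.of (T.val g₁ ω₁ 0) = Matrix.of (T.val g ω x₀) := by
    ext a b
    have := val_pull T h (contDiff_quadMap Γ x₀) (x := 0) (by rw [hj]; simp) (by rwa [hq0]) a b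
    rw [hj, hq0] at this
    simpa using this
  have h0₁ : (0 : Pt n) ∈ lorDom n g₁ := by
    change Lor n (Matrix.of (g₁ 0))
    rw [hg₁0]; exact hx₀
  set g₂ := pullTensor n (fun x : Pt n => x ᵥ* P) g₁ with hg₂
  set ω₂ := pullForm n k (fun x : Pt n => x ᵥ* P) ω₁ with hω₂
  have h₂ : SmoothData n k g₂ ω₂ := h₁.pull (contDiff_vecMul P)
  have hg₂e : ∀ x, Matrix.of (g₂ x) = P * Matrix.of (g₁ (x ᵥ* P)) * Pᵀ := fun x => by
    rw [hg₂, pullTensor_eq, jacM_vecMul]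
  have hω₂e : ∀ x, ω₂ x = pullComp P (ω₁ (x ᵥ* P)) := fun x => by
    rw [hω₂, pullForm_eq, jacM_vecMul]
  have hv₂ : Matrix.of (T.val g₂ ω₂ 0) = P * Matrix.of (T.val g₁ ω₁ 0) * Pᵀ :=
    val_linear_pull T h₁ h0₁ hP hg₂e hω₂e
  rw [← hv₁, ← hv₂]
  have hω₂0 : ω₂ 0 = pullComp P (ω x₀) := by rw [hω₂e, Matrix.zero_vecMul, hω₁0]
  rw [← hω₂0]
  let R₂ : ℝ × Pt n → Mat n := fun p => P * Matrix.of (R (p.1, p.2 ᵥ* P)) * Pᵀ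
  refine hF g₂ ω₂ R₂ _ h₂ (fun a b => ?_) (fun p a b => ?_) (fun l x a b => ?_)
    (fun x a b => ?_) i j
  · simp only [R₂, mul_mul_transpose_apply, Matrix.of_apply]
    exact ContDiff.sum fun c _ => ContDiff.sum fun d _ => contDiff_const.mul
      ((hR c d).comp (contDiff_fst.prodMk ((contDiff_vecMul P).comp contDiff_snd)))
  · have hs : (Matrix.of (R (p.1, p.2 ᵥ* P)))ᵀ = Matrix.of (R (p.1, p.2 ᵥ* P)) := by
      ext a b; exact hRs _ b a
    have : (R₂ p)ᵀ = R₂ p := by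
      simp only [R₂, Matrix.transpose_mul, Matrix.transpose_transpose, hs, mul_assoc]
    exact congrFun (congrFun this b) a
  · have e1 : Matrix.of (g₁ (l • (x ᵥ* P))) =
        Matrix.of (g x₀) + l ^ 2 • Matrix.of (R (l, x ᵥ* P)) := by
      ext a b; exact hRe l _ a b
    have e2 : Matrix.of (g₂ (l • x)) = mink n + l ^ 2 • R₂ (l, x) := by
      rw [hg₂e, Matrix.smul_vecMul, e1, mul_add, add_mul, hPg, mul_smul_comm, smul_mul_assoc]
    exact congrFun (congrFun e2 a) b
  · have e1 : R₂ (0, x) a b = ∑ i, ∑ j, P a i * P b j * ∑ k, ∑ l, gaugeQuad g Γ x₀ i j k l *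
        ((∑ c, x c * P c k) * ∑ d, x d * P d l) := by
      simp only [R₂, mul_mul_transpose_apply, Matrix.of_apply, hR0]
      rfl
    rw [e1]
    simp only [quadTr, quadEval, Finset.sum_mul_sum]
    simp only [Finset.mul_sum, Finset.sum_mul]
    symm
    rw [sum_comm_four (fun c d i j => _)]
    refine Finset.sum_congr rfl fun i _ => Finset.sum_congr rfl fun j _ => ?_
    rw [sum_comm_four (fun c d k l => _)]
    exact Finset.sum_congr rfl fun k _ => Finset.sum_congr rfl fun l _ =>
      Finset.sum_congr rfl fun c _ => Finset.sum_congr rfl fun d _ => by ring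

section Ricci

variable {g : MetricField n} {x₀ : Pt n}

theorem contDiff_matrix_det {X m : Type*} [NormedAddCommGroup X] [NormedSpace ℝ X] [Fintype m]
    [DecidableEq m] {A : X → Matrix m m ℝ} (hA : ∀ a b, ContDiff ℝ ∞ fun x => A x a b) :
    ContDiff ℝ ∞ fun x => (A x).det := by
  simp only [Matrix.det_apply]
  exact ContDiff.sum fun σ _ => (contDiff_prod fun i _ => hA _ _).const_smul _

theorem differentiableAt_ginv (hg : ∀ a b, ContDiff ℝ ∞ fun y => g y a b)
    (hdet : (Matrix.of (g x₀)).det ≠ 0) (a b : Fin (n + 1)) :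
    DifferentiableAt ℝ (fun y => ginv n g y a b) x₀ := by
  have h1 : ∀ y, ginv n g y a b =
      ((Matrix.of (g y)).det)⁻¹ * (Matrix.of (g y)).adjugate a b := fun y => by
    change (Matrix.of (g y))⁻¹ a b = _
    rw [Matrix.inv_def, Ring.inverse_eq_inv', Matrix.smul_apply, smul_eq_mul]
  simp only [h1, Matrix.adjugate_apply]
  refine DifferentiableAt.mul (DifferentiableAt.inv ?_ hdet) ?_
  · exact (contDiff_matrix_det fun a b => hg a b).differentiable (by simp) x₀
  · refine (contDiff_matrix_det fun c d => ?_).differentiable (by simp) x₀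
    by_cases hc : c = b
    · subst hc; simp only [Matrix.updateRow_self]; exact contDiff_const
    · simp only [Matrix.updateRow_ne hc, Matrix.of_apply]; exact hg c d

/-- The Christoffel symbols of the first kind. -/
noncomputable def lowGam (g : MetricField n) (x : Pt n) (d a b : Fin (n + 1)) : ℝ :=
  (1 / 2) * (pd n a (fun y => g y d b) x + pd n b (fun y => g y d a) x
    - pd n d (fun y => g y a b) x)

theorem christoffel_eq (g : MetricField n) (x : Pt n) (c a b : Fin (n + 1)) :
    christoffel n g x c a b = ∑ d, ginv n g x c d * lowGam g x d a b := by
  simp only [christoffel, lowGam, Finset.mul_sum]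
  exact Finset.sum_congr rfl fun d _ => by ring

theorem lowGam_comm (hs : ∀ x a b, g x a b = g x b a) (x : Pt n) (d a b : Fin (n + 1)) :
    lowGam g x d a b = lowGam g x d b a := by
  simp only [lowGam, hs _ a b]
  ring

theorem christoffel_comm (hs : ∀ x a b, g x a b = g x b a) (x : Pt n) (d a b : Fin (n + 1)) :
    christoffel n g x d a b = christoffel n g x d b a := by
  simp only [christoffel_eq, lowGam_comm hs x _ a b]

theorem pd_eq_lowGam (hs : ∀ x a b, g x a b = g x b a) (x : Pt n) (e a b : Fin (n + 1)) :
    pd n e (fun y => g y a b) x = lowGam g x a b e + lowGam g x b a e := by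
  simp only [lowGam, hs _ a b, hs _ a e, hs _ b e]
  ring

theorem differentiable_lowGam (hg : ∀ a b, ContDiff ℝ ∞ fun y => g y a b) (d a b : Fin (n + 1)) :
    Differentiable ℝ fun y => lowGam g y d a b := by
  have h : ∀ a b c, Differentiable ℝ fun y => pd n a (fun y => g y b c) y := fun a b c =>
    (contDiff_pd (hg b c) a).differentiable (by simp)
  unfold lowGam
  exact (((h a d b).add (h b d a)).sub (h d a b)).const_mul _

theorem differentiableAt_christoffel (hg : ∀ a b, ContDiff ℝ ∞ fun y => g y a b)
    (hdet : (Matrix.of (g x₀)).det ≠ 0) (c a b : Fin (n + 1)) :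
    DifferentiableAt ℝ (fun y => christoffel n g y c a b) x₀ := by
  simp only [christoffel_eq]
  exact DifferentiableAt.fun_sum fun d _ => (differentiableAt_ginv hg hdet c d).mul
    (differentiable_lowGam hg d a b x₀)

theorem sum_metric_mul_ginv (hdet : (Matrix.of (g x₀)).det ≠ 0) (f : Fin (n + 1) → ℝ)
    (d : Fin (n + 1)) : ∑ e, g x₀ d e * ∑ c, ginv n g x₀ e c * f c = f d := by
  have h : Matrix.of (g x₀) *ᵥ ((Matrix.of (g x₀))⁻¹ *ᵥ f) = f := by
    rw [Matrix.mulVec_mulVec, Matrix.mul_nonsing_inv _ (isUnit_iff_ne_zero.2 hdet),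
      Matrix.one_mulVec]
  exact congrFun h d

theorem sum_ginv_mul_metric (hdet : (Matrix.of (g x₀)).det ≠ 0) (f : Fin (n + 1) → ℝ)
    (d : Fin (n + 1)) : ∑ e, ginv n g x₀ d e * ∑ c, g x₀ e c * f c = f d := by
  have h : (Matrix.of (g x₀))⁻¹ *ᵥ (Matrix.of (g x₀) *ᵥ f) = f := by
    rw [Matrix.mulVec_mulVec, Matrix.nonsing_inv_mul _ (isUnit_iff_ne_zero.2 hdet),
      Matrix.one_mulVec]
  exact congrFun h d

theorem sum_metric_christoffel (hdet : (Matrix.of (g x₀)).det ≠ 0) (d a b : Fin (n + 1)) :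
    ∑ e, g x₀ d e * christoffel n g x₀ e a b = lowGam g x₀ d a b := by
  simp only [christoffel_eq]
  exact sum_metric_mul_ginv hdet (fun d => lowGam g x₀ d a b) d

theorem pd_christoffel (hg : ∀ a b, ContDiff ℝ ∞ fun y => g y a b)
    (hdet : (Matrix.of (g x₀)).det ≠ 0) (f c a b : Fin (n + 1)) :
    pd n f (fun y => christoffel n g y c a b) x₀ =
      ∑ d, ginv n g x₀ c d * (pd n f (fun y => lowGam g y d a b) x₀ -
        ∑ e, pd n f (fun y => g y d e) x₀ * christoffel n g x₀ e a b) := by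
  have hev : ∀ᶠ y in 𝓝 x₀, (Matrix.of (g y)).det ≠ 0 :=
    (contDiff_matrix_det fun a b => hg a b).continuous.continuousAt.eventually_ne hdet
  have h1 : ∀ d, ∑ e, g x₀ d e * pd n f (fun y => christoffel n g y e a b) x₀ =
      pd n f (fun y => lowGam g y d a b) x₀ -
        ∑ e, pd n f (fun y => g y d e) x₀ * christoffel n g x₀ e a b := by
    intro d
    have h2 : (fun y => ∑ e, g y d e * christoffel n g y e a b) =ᶠ[𝓝 x₀]
        fun y => lowGam g y d a b := by
      filter_upwards [hev] with y hy using sum_metric_christoffel hy d a b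
    have h3 : HasFDerivAt (fun y => ∑ e, g y d e * christoffel n g y e a b) _ x₀ :=
      HasFDerivAt.fun_sum fun e _ =>
        ((hg d e).differentiable (by simp) x₀).hasFDerivAt.mul
          (differentiableAt_christoffel hg hdet e a b).hasFDerivAt
    have h4 := congrArg (fun L : Pt n →L[ℝ] ℝ => L (Pi.single f 1))
      (h3.fderiv.symm.trans h2.fderiv_eq)
    simp only [sum_apply, add_apply, smul_apply, smul_eq_mul, Finset.sum_add_distrib] at h4
    change (∑ e, g x₀ d e * pd n f (fun y => christoffel n g y e a b) x₀) +
      (∑ e, christoffel n g x₀ e a b * pd n f (fun y => g y d e) x₀) =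
        pd n f (fun y => lowGam g y d a b) x₀ at h4
    rw [← h4]
    simp only [mul_comm (christoffel n g x₀ _ a b), add_sub_cancel_right]
  simp only [← h1]
  exact (sum_ginv_mul_metric hdet (fun e => pd n f (fun y => christoffel n g y e a b) x₀) c).symm

theorem pd_lowGam (hg : ∀ a b, ContDiff ℝ ∞ fun y => g y a b) (f d a b : Fin (n + 1)) (x : Pt n) :
    pd n f (fun y => lowGam g y d a b) x = (1 / 2) * (pd n f (pd n a fun y => g y d b) x +
      pd n f (pd n b fun y => g y d a) x - pd n f (pd n d fun y => g y a b) x) := by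
  have h : ∀ a b c, HasFDerivAt (pd n a fun y => g y b c) _ x := fun a b c =>
    ((contDiff_pd (hg b c) a).differentiable (by simp) x).hasFDerivAt
  have h1 : HasFDerivAt (fun y => lowGam g y d a b) _ x :=
    (((h a d b).add (h b d a)).sub (h d a b)).const_mul (1 / 2 : ℝ)
  rw [pd, h1.fderiv]
  rfl

theorem pd_comm {f : Pt n → ℝ} (hf : ContDiff ℝ ∞ f) (a b : Fin (n + 1)) (x : Pt n) :
    pd n a (pd n b f) x = pd n b (pd n a f) x := by
  have h : ∀ a b, pd n a (pd n b f) x =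
      fderiv ℝ (fderiv ℝ f) x (Pi.single a 1) (Pi.single b 1) := fun a b => by
    have hd : HasFDerivAt (fderiv ℝ f) _ x :=
      ((hf.fderiv_right (m := ∞) (by simp)).differentiable (by simp) x).hasFDerivAt
    have h1 : HasFDerivAt (pd n b f) _ x := hd.clm_apply (hasFDerivAt_const (Pi.single b 1) x)
    rw [pd, h1.fderiv]
    simp
  rw [h, h]
  exact (hf.contDiffAt.isSymmSndFDerivAt (by
    rw [minSmoothness_of_isRCLikeNormedField]; exact WithTop.coe_le_coe.2 le_top)) _ _

/-- The contraction of two Christoffel symbols through the metric. -/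
noncomputable def gamSq (g : MetricField n) (x : Pt n) (a b c d : Fin (n + 1)) : ℝ :=
  ∑ e, lowGam g x e a b * christoffel n g x e c d

/-- The contraction of two Christoffel symbols through a lower index. -/
noncomputable def gamMix (g : MetricField n) (x : Pt n) (a b c d : Fin (n + 1)) : ℝ :=
  ∑ e, lowGam g x a b e * christoffel n g x e c d

theorem gamSq_swap (hs : ∀ x a b, g x a b = g x b a) (x : Pt n) (a b c d : Fin (n + 1)) :
    gamSq g x a b c d = gamSq g x c d a b := by
  have hi : ∀ e f, ginv n g x e f = ginv n g x f e := fun e f => by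
    have : (Matrix.of (g x))⁻¹ᵀ = (Matrix.of (g x))⁻¹ := by
      rw [Matrix.transpose_nonsing_inv]
      congr 1
      ext a b; exact hs x b a
    exact congrFun (congrFun this f) e
  simp only [gamSq, christoffel_eq, Finset.mul_sum]
  rw [Finset.sum_comm]
  exact Finset.sum_congr rfl fun e _ => Finset.sum_congr rfl fun f _ => by rw [hi]; ring

theorem sum_pd_mul_christoffel (hs : ∀ x a b, g x a b = g x b a) (x : Pt n)
    (f d a b : Fin (n + 1)) :
    ∑ e, pd n f (fun y => g y d e) x * christoffel n g x e a b =
      gamMix g x d f a b + gamSq g x f d a b := by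
  simp only [gamMix, gamSq, ← Finset.sum_add_distrib]
  refine Finset.sum_congr rfl fun e _ => ?_
  rw [pd_eq_lowGam hs, lowGam_comm hs x d, lowGam_comm hs x e]
  ring

theorem ricci_eq_sum (hg : ∀ a b, ContDiff ℝ ∞ fun y => g y a b)
    (hs : ∀ x a b, g x a b = g x b a) (hdet : (Matrix.of (g x₀)).det ≠ 0) (a b : Fin (n + 1)) :
    ricci n g x₀ a b = ∑ c, ∑ d, ginv n g x₀ c d *
      (pd n c (fun y => lowGam g y d a b) x₀ - pd n a (fun y => lowGam g y d c b) x₀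
        - gamSq g x₀ c d a b + gamSq g x₀ a d c b) := by
  have h1 : ∀ c a b p, ∑ d, christoffel n g x₀ c p d * christoffel n g x₀ d a b =
      ∑ d, ginv n g x₀ c d * gamMix g x₀ d p a b := by
    intro c a b p
    simp only [gamMix, christoffel_eq g x₀ c, Finset.sum_mul, Finset.mul_sum]
    rw [Finset.sum_comm]
    exact Finset.sum_congr rfl fun e _ => Finset.sum_congr rfl fun f _ => by ring
  simp only [ricci, pd_christoffel hg hdet, sum_pd_mul_christoffel hs]
  simp only [h1, ← Finset.sum_sub_distrib, ← Finset.sum_add_distrib]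
  exact Finset.sum_congr rfl fun c _ => Finset.sum_congr rfl fun d _ => by ring

theorem christoffel_compat (hs : ∀ x a b, g x a b = g x b a)
    (hdet : (Matrix.of (g x₀)).det ≠ 0) (e a b : Fin (n + 1)) :
    pd n e (fun y => g y a b) x₀ = (∑ f, christoffel n g x₀ f a e * g x₀ f b) +
      ∑ f, g x₀ a f * christoffel n g x₀ f b e := by
  rw [sum_metric_christoffel hdet, pd_eq_lowGam hs, ← sum_metric_christoffel hdet b, add_comm]
  congr 1
  exact Finset.sum_congr rfl fun f _ => by rw [hs _ f b, mul_comm]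

theorem gaugeQuad_christoffel (hs : ∀ x a b, g x a b = g x b a)
    (hdet : (Matrix.of (g x₀)).det ≠ 0) (a b c d : Fin (n + 1)) :
    gaugeQuad g (christoffel n g x₀) x₀ a b c d =
      1 / 2 * pd n d (pd n c fun y => g y a b) x₀
        - 1 / 2 * (gamMix g x₀ a b c d + gamMix g x₀ b a c d)
        - (gamSq g x₀ d b a c + gamMix g x₀ b d a c)
        - (gamSq g x₀ d a b c + gamMix g x₀ a d b c) + gamSq g x₀ b d a c := by
  have h1 : ∑ e, pd n e (fun y => g y a b) x₀ * christoffel n g x₀ e c d =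
      gamMix g x₀ a b c d + gamMix g x₀ b a c d := by
    simp only [gamMix, ← Finset.sum_add_distrib, pd_eq_lowGam hs, add_mul]
  have h2 : ∀ a b c d, ∑ e, christoffel n g x₀ e a c * pd n d (fun y => g y e b) x₀ =
      gamSq g x₀ d b a c + gamMix g x₀ b d a c := fun a b c d => by
    rw [add_comm (gamSq ..), ← sum_pd_mul_christoffel hs]
    exact Finset.sum_congr rfl fun e _ => by simp only [hs _ e b]; ring
  have h3 : ∑ e, christoffel n g x₀ e b c * pd n d (fun y => g y a e) x₀ =
      gamSq g x₀ d a b c + gamMix g x₀ a d b c := by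
    rw [add_comm (gamSq ..), ← sum_pd_mul_christoffel hs]
    exact Finset.sum_congr rfl fun e _ => by ring
  have h4 : ∑ e, ∑ f, christoffel n g x₀ e a c * christoffel n g x₀ f b d * g x₀ e f =
      gamSq g x₀ b d a c := by
    refine Finset.sum_congr rfl fun e _ => ?_
    rw [← sum_metric_christoffel hdet, Finset.sum_mul]
    exact Finset.sum_congr rfl fun f _ => by ring
  rw [gaugeQuad, h1, h2, h3, h4]

theorem riemLin_gaugeQuad (hg : ∀ a b, ContDiff ℝ ∞ fun y => g y a b)
    (hs : ∀ x a b, g x a b = g x b a) (hdet : (Matrix.of (g x₀)).det ≠ 0)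
    (d b c a : Fin (n + 1)) :
    riemLin (gaugeQuad g (christoffel n g x₀) x₀) d b c a =
      pd n c (fun y => lowGam g y d a b) x₀ - pd n a (fun y => lowGam g y d c b) x₀
        - gamSq g x₀ c d a b + gamSq g x₀ a d c b := by
  have hD : ∃ D : Quad n, (∀ a b c d, pd n c (pd n d fun y => g y a b) x₀ = D a b c d) ∧
      (∀ a b c d, D a b c d = D b a c d) ∧ ∀ a b c d, D a b c d = D a b d c :=
    ⟨fun a b c d => pd n c (pd n d fun y => g y a b) x₀, fun _ _ _ _ => rfl,
      fun a b c d => by simp only [hs _ a b], fun a b c d => pd_comm (hg a b) c d x₀⟩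
  have hX : ∃ X : Quad n, gamSq g x₀ = X ∧ (∀ a b c d, X a b c d = X b a c d) ∧
      (∀ a b c d, X a b c d = X a b d c) ∧ ∀ a b c d, X a b c d = X c d a b :=
    ⟨_, rfl, fun a b c d => by simp only [gamSq, lowGam_comm hs _ _ a b],
      fun a b c d => by simp only [gamSq, christoffel_comm hs _ _ c d], gamSq_swap hs x₀⟩
  have hY : ∃ Y : Quad n, gamMix g x₀ = Y ∧ ∀ a b c d, Y a b c d = Y a b d c :=
    ⟨_, rfl, fun a b c d => by simp only [gamMix, christoffel_comm hs _ _ c d]⟩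
  obtain ⟨D, hD, hD1, hD2⟩ := hD
  obtain ⟨X, hX, hX1, hX2, hX3⟩ := hX
  obtain ⟨Y, hY, hY1⟩ := hY
  simp only [riemLin, symQ, gaugeQuad_christoffel hs hdet, pd_lowGam hg, hD, hX, hY]
  simp only [hD1 b a, hD1 d a, hD1 c b, hD1 d b, hD1 d c,
    hD2 _ _ b a, hD2 _ _ c a, hD2 _ _ d a, hD2 _ _ c b, hD2 _ _ d c]
  simp only [hX1 b a, hX1 c a, hX1 d a, hX1 c b, hX1 d b, hX1 d c,
    hX2 _ _ b a, hX2 _ _ c a, hX2 _ _ d a, hX2 _ _ c b, hX2 _ _ d b, hX2 _ _ d c]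
  simp only [hX3 c d, hX3 b d, hX3 b c, hY1 _ _ b a, hY1 _ _ c a, hY1 _ _ d a, hY1 _ _ c b,
    hY1 _ _ d b, hY1 _ _ d c]
  ring

theorem ricci_eq_ricWith (hg : ∀ a b, ContDiff ℝ ∞ fun y => g y a b)
    (hs : ∀ x a b, g x a b = g x b a) (hdet : (Matrix.of (g x₀)).det ≠ 0) :
    Matrix.of (ricci n g x₀) =
      ricWith (ginv n g x₀) (gaugeQuad g (christoffel n g x₀) x₀) := by
  ext a b
  simp only [ricWith, Matrix.of_apply, ricci_eq_sum hg hs hdet, riemLin_gaugeQuad hg hs hdet]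

end Ricci

theorem pd_eventuallyEq {f f' : Pt n → ℝ} {x : Pt n} (h : f =ᶠ[𝓝 x] f') (a : Fin (n + 1)) :
    pd n a f =ᶠ[𝓝 x] pd n a f' := by
  filter_upwards [h.fderiv (𝕜 := ℝ)] with y hy
  rw [pd, hy, pd]

theorem ginv_congr {g g' : MetricField n} {x : Pt n} (h : g x = g' x) :
    ginv n g x = ginv n g' x := by
  rw [ginv, h, ginv]

theorem christoffel_eventuallyEq {g g' : MetricField n} {x : Pt n} (h : g =ᶠ[𝓝 x] g')
    (c a b : Fin (n + 1)) :
    (fun y => christoffel n g y c a b) =ᶠ[𝓝 x] fun y => christoffel n g' y c a b := by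
  have hc : ∀ a b, (fun y => g y a b) =ᶠ[𝓝 x] fun y => g' y a b := fun a b => by
    filter_upwards [h] with y hy
    rw [hy]
  have hp : ∀ᶠ y in 𝓝 x, ∀ e a b, pd n e (fun y => g y a b) y = pd n e (fun y => g' y a b) y :=
    Filter.eventually_all.2 fun e => Filter.eventually_all.2 fun a =>
      Filter.eventually_all.2 fun b => pd_eventuallyEq (hc a b) e
  filter_upwards [h, hp] with y hy hpy
  simp only [christoffel, ginv_congr hy, hpy]

theorem ricci_congr {g g' : MetricField n} {x : Pt n} (h : g =ᶠ[𝓝 x] g') :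
    ricci n g x = ricci n g' x := by
  ext a b
  have h1 : ∀ e c a b, pd n e (fun y => christoffel n g y c a b) x =
      pd n e (fun y => christoffel n g' y c a b) x := fun e c a b =>
    (pd_eventuallyEq (christoffel_eventuallyEq h c a b) e).eq_of_nhds
  have h2 : ∀ c a b, christoffel n g x c a b = christoffel n g' x c a b := fun c a b =>
    (christoffel_eventuallyEq h c a b).eq_of_nhds
  simp only [ricci, h1, h2]

theorem exists_smoothData {W : Set (Pt n)} {g : MetricField n} {ω : FormField n k} (hW : IsOpen W)
    (hg : IsMetricOn n W g) (hω : IsFormOn n k W ω) {x : Pt n} (hx : x ∈ W) :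
    ∃ g' ω', SmoothData n k g' ω' ∧ g' =ᶠ[𝓝 x] g ∧ ω' =ᶠ[𝓝 x] ω := by
  choose G hG hGe using fun a b => exists_contDiff_eventuallyEq hW hx (hg.1 a b)
  choose Ω hΩ hΩe using fun v => exists_contDiff_eventuallyEq hW hx (hω.1 v)
  have hWn : W ∈ 𝓝 x := hW.mem_nhds hx
  have hGe' : ∀ᶠ y in 𝓝 x, ∀ a b, G a b y = g y a b :=
    Filter.eventually_all.2 fun a => Filter.eventually_all.2 fun b => hGe a b
  have hΩe' : ∀ᶠ y in 𝓝 x, ∀ v, Ω v y = ω y v := Filter.eventually_all.2 hΩe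
  refine ⟨fun y a b => (G a b y + G b a y) / 2, fun y => altz n k fun v => Ω v y,
    ⟨fun a b => ((hG a b).add (hG b a)).div_const 2, fun y a b => by rw [add_comm], fun v => ?_,
      fun y => isAlt_altz _⟩, ?_, ?_⟩
  · simp only [altz_apply]
    exact contDiff_const.mul (ContDiff.sum fun σ _ => contDiff_const.mul (hΩ _))
  · filter_upwards [hGe', hWn] with y hy hyW
    ext a b
    rw [hy, hy, (hg.2 y hyW).1 b a]
    ring
  · filter_upwards [hΩe', hWn] with y hy hyW
    rw [funext hy]
    exact altz_of_isAlt (hω.2 y hyW)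

/-- The classification in matrix form, for globally defined data. -/
theorem exists_val_formula {T : NaturalTensor n k} (hT : T.ScaleInv) (hn : 1 ≤ n) (hk : 1 ≤ k)
    (hkn : k ≤ n + 1) (hk1 : k ≠ 1) (hk3 : k ≠ 3) :
    ∃ a b c d : ℝ, ∀ (g : MetricField n) (ω : FormField n k) (x : Pt n), SmoothData n k g ω →
      x ∈ lorDom n g → Matrix.of (T.val g ω x) = a • Matrix.of (ricci n g x) +
        (b * scalarCurv n g x) • Matrix.of (g x) + c • Matrix.of (iiInner n k g ω x) +
        (d * scalarSq n k g ω x) • Matrix.of (g x) := by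
  obtain ⟨a, b, c, d, hF⟩ := exists_frame_formula hT hn hk hkn hk1 hk3
  refine ⟨a, b, c, d, fun g ω x h ⟨_, Q, hQ, hQg⟩ => ?_⟩
  set G : Mat n := Matrix.of (g x) with hG
  set P : Mat n := Qᵀ with hPdef
  have hP : IsUnit P.det := by rwa [Matrix.det_transpose]
  have hPg : P * G * Pᵀ = mink n := by rwa [Matrix.transpose_transpose]
  have hPt : IsUnit Pᵀ.det := by rwa [Matrix.det_transpose]
  have hdet : G.det ≠ 0 := fun h0 => by
    have h1 := congrArg Matrix.det (mink_mul_mink n)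
    rw [← hPg] at h1
    simp [h0] at h1
  have hM : Pᵀ * mink n * P = ginv n g x := by
    have h1 : ginv n g x = G⁻¹ := rfl
    rw [h1]
    refine (Matrix.inv_eq_left_inv ?_).symm
    have h2 : P * (G * (Pᵀ * mink n)) = P * P⁻¹ := by
      rw [← mul_assoc, ← mul_assoc, hPg, mink_mul_mink, Matrix.mul_nonsing_inv _ hP]
    have h3 : G * (Pᵀ * mink n) = P⁻¹ := by
      have := congrArg (P⁻¹ * ·) h2
      simpa only [Matrix.nonsing_inv_mul_cancel_left _ _ hP] using this
    have h4 : G * (Pᵀ * mink n * P) = 1 := by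
      rw [← mul_assoc, h3, Matrix.nonsing_inv_mul _ hP]
    exact mul_eq_one_comm.1 h4
  set Γ := christoffel n g x
  have hric : ∀ i j, ricLin i j (quadTr P (gaugeQuad g Γ x)) =
      (P * Matrix.of (ricci n g x) * Pᵀ) i j := fun i j => by
    rw [ricLin_quadTr hM, ricci_eq_ricWith h.smooth_metric h.symm hdet]
  have hscal : ∑ e, eps n e * ricLin e e (quadTr P (gaugeQuad g Γ x)) = scalarCurv n g x := by
    have h1 : ∀ a b, ginv n g x a b = ∑ e, eps n e * (P e a * P e b) := fun a b => by
      rw [← hM, mink_eq_diagonal, Matrix.mul_apply]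
      exact Finset.sum_congr rfl fun e _ => by
        rw [Matrix.mul_diagonal, Matrix.transpose_apply]; ring
    simp only [hric, mul_mul_transpose_apply, Matrix.of_apply, scalarCurv, h1, Finset.mul_sum,
      Finset.sum_mul]
    rw [Finset.sum_comm]
    refine Finset.sum_congr rfl fun a _ => ?_
    rw [Finset.sum_comm]
    exact Finset.sum_congr rfl fun b _ => Finset.sum_congr rfl fun e _ => by ring
  have key : P * Matrix.of (T.val g ω x) * Pᵀ = P * (a • Matrix.of (ricci n g x) +
      (b * scalarCurv n g x) • G + c • Matrix.of (iiInner n k g ω x) +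
      (d * scalarSq n k g ω x) • G) * Pᵀ := by
    ext i j
    rw [hF g ω x Γ P h (christoffel_comm h.symm x) (christoffel_compat h.symm hdet) hP hPg i j,
      hscal, hric, iiM_pull hk hM, sqM_pull hM, ← iiInner_eq, ← scalarSq_eq]
    simp only [mul_add, add_mul, mul_smul_comm, smul_mul_assoc, hPg, Matrix.add_apply,
      Matrix.smul_apply, smul_eq_mul]
    rfl
  have h1 := congrArg (P⁻¹ * · * Pᵀ⁻¹) key
  simpa only [mul_assoc, Matrix.nonsing_inv_mul_cancel_left _ _ hP,
    Matrix.mul_nonsing_inv _ hPt, mul_one] using h1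

end Paper

namespace Paper

/-- for `k ∉ {1,3}`, a natural tensor independent of the unit of scale is a
linear combination of `Ricci(g)`, `r(g)g`, `⟨i_−ω,i_−ω⟩_g` and `⟨ω,ω⟩_g g`. -/
theorem statement3 (n k : ℕ) (hn : 1 ≤ n) (hk1 : 1 ≤ k) (hk2 : k ≤ n + 1)
    (hk3 : k ≠ 1) (hk4 : k ≠ 3)
    (T : NaturalTensor n k)
    (scale : ∀ W g ω, IsOpen W → IsMetricOn n W g → IsFormOn n k W ω →
      ∀ lam : ℝ, 0 < lam → ∀ x ∈ W, ∀ a b,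
        T.T W (fun y c d => lam ^ 2 * g y c d) (fun y v => lam ^ (k - 1) * ω y v) x a b
          = T.T W g ω x a b) :
    ∃ a b c d : ℝ, ∀ W g ω, IsOpen W → IsMetricOn n W g → IsFormOn n k W ω →
      ∀ x ∈ W, ∀ i j,
        T.T W g ω x i j =
          a * ricci n g x i j + b * scalarCurv n g x * g x i j
          + c * iiInner n k g ω x i j + d * scalarSq n k g ω x * g x i j := by
  obtain ⟨a, b, c, d, hF⟩ := exists_val_formula (T := T) scale hn hk1 hk2 hk3 hk4
  refine ⟨a, b, c, d, fun W g ω hW hg hω x hx i j => ?_⟩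
  obtain ⟨g', ω', h, heg, heω⟩ := exists_smoothData hW hg hω hx
  have hgx : g' x = g x := heg.eq_of_nhds
  have hωx : ω' x = ω x := heω.eq_of_nhds
  have hr : ricci n g' x = ricci n g x := ricci_congr heg
  have hi : ginv n g' x = ginv n g x := ginv_congr hgx
  have hx' : x ∈ lorDom n g' := by
    have : x ∈ lorDom n g := (isMetricOn_iff.1 hg).2 hx
    change Lor n (Matrix.of (g' x))
    rw [hgx]
    exact this
  have h1 := congrFun (congrFun (hF g' ω' x h hx') i) j
  rw [T.val_eq h hW hg hω hx heg heω, hr, hgx, iiInner_eq, scalarSq_eq, hi, hωx, ← iiInner_eq,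
    ← scalarSq_eq, scalarCurv, hr, hi, ← scalarCurv] at h1
  exact h1

end Paper
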